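/- For every k ∈ {1,2,3} and every (r,s) ∈ ℝ² ∖ (1/2)ℤ², the functions τ ↦ Z(r_k, s_k, τ) and τ ↦ Z^{(𝐦_k)}(r,s,τ) have no common zero in the τ-variable: there is no τ ∈ ℍ with Z(r_k, s_k, τ) = 0 and Z^{(𝐦_k)}(r,s,τ) = 0. -/

import Mathlib

open Metric Set Filter Topology

noncomputable section

/-- The lattice `Λ_τ = ℤ + τℤ` as a set of complex numbers. -/
def lat (τ : ℂ) : Set ℂ := {z | ∃ m n : ℤ, z = (m : ℂ) + (n : ℂ) * τ}

/-- The lattice point `m + nτ` attached to a pair of integers. -/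
def latPt (τ : ℂ) (p : ℤ × ℤ) : ℂ := (p.1 : ℂ) + (p.2 : ℂ) * τ

/-- The Weierstrass elliptic function `℘(z|τ)`. -/
def wp (τ z : ℂ) : ℂ :=
  1 / z ^ 2 + ∑' p : {p : ℤ × ℤ // p ≠ 0},
    (1 / (z - latPt τ p.1) ^ 2 - 1 / latPt τ p.1 ^ 2)

/-- `℘′(z|τ)`. -/
def wpd (τ z : ℂ) : ℂ := deriv (wp τ) z

/-- `℘″(z|τ)`. -/
def wpdd (τ z : ℂ) : ℂ := deriv (deriv (wp τ)) z

/-- The Weierstrass zeta function `ζ(z|τ)` (odd primitive of `-℘`). -/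
def wzeta (τ z : ℂ) : ℂ :=
  1 / z + ∑' p : {p : ℤ × ℤ // p ≠ 0},
    (1 / (z - latPt τ p.1) + 1 / latPt τ p.1 + z / latPt τ p.1 ^ 2)

/-- The Weierstrass sigma function `σ(z|τ)`. -/
def wsigma (τ z : ℂ) : ℂ :=
  z * ∏' p : {p : ℤ × ℤ // p ≠ 0},
    ((1 - z / latPt τ p.1) * Complex.exp (z / latPt τ p.1 + z ^ 2 / (2 * latPt τ p.1 ^ 2)))

/-- The periods `ω₀ = 0, ω₁ = 1, ω₂ = τ, ω₃ = 1 + τ`. -/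
def per (τ : ℂ) : ℕ → ℂ
  | 0 => 0
  | 1 => 1
  | 2 => τ
  | 3 => 1 + τ
  | _ => 0

/-- `e_k(τ) = ℘(ω_k/2|τ)`. -/
def eper (τ : ℂ) (k : ℕ) : ℂ := wp τ (per τ k / 2)

/-- The quasi-period `η₁(τ) = 2ζ(1/2|τ)`. -/
def eta1 (τ : ℂ) : ℂ := 2 * wzeta τ (1 / 2)

/-- The quasi-period `η₂(τ) = 2ζ(τ/2|τ)`. -/
def eta2 (τ : ℂ) : ℂ := 2 * wzeta τ (τ / 2)

/-- `η_k(τ)`, with `η₃ = η₁ + η₂`. -/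
def etaq (τ : ℂ) : ℕ → ℂ
  | 1 => eta1 τ
  | 2 => eta2 τ
  | 3 => eta1 τ + eta2 τ
  | _ => 0

/-- The Hecke form `Z(r,s,τ) = ζ(r+sτ|τ) - r η₁(τ) - s η₂(τ)`. -/
def heckeZ (r s τ : ℂ) : ℂ := wzeta τ (r + s * τ) - r * eta1 τ - s * eta2 τ

/-- The pre-modular form `Z^{(𝐦_k)}(r,s,τ) = Z(r,s,τ)² - ℘(r+sτ|τ) + e_k(τ)`. -/
def heckeZm (k : ℕ) (r s τ : ℂ) : ℂ := heckeZ r s τ ^ 2 - wp τ (r + s * τ) + eper τ k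

/-- First component of `(r_k, s_k)`. -/
def rkr (k : ℕ) (r : ℂ) : ℂ := if k = 2 then r else r + 1 / 2

/-- Second component of `(r_k, s_k)`. -/
def rks (k : ℕ) (s : ℂ) : ℂ := if k = 1 then s else s + 1 / 2

/-- `(r,s)` is a half-integer pair, i.e. belongs to `(1/2)ℤ²`. -/
def IsHalfIntPair (r s : ℂ) : Prop := ∃ m n : ℤ, r = (m : ℂ) / 2 ∧ s = (n : ℂ) / 2

/-- The singular set of the curvature equation: lattice translates of the points `ω_k/2`
with `m_k ≥ 1`. -/
def singSet (τ : ℂ) (m : Fin 4 → ℕ) : Set ℂ :=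
  {z | ∃ k : Fin 4, 1 ≤ m k ∧ ∃ l ∈ lat τ, z = per τ (k : ℕ) / 2 + l}

/-- The Laplacian of a real-valued function on `ℂ ≃ ℝ²`. -/
def lapl (u : ℂ → ℝ) (z : ℂ) : ℝ :=
  fderiv ℝ (fun w => fderiv ℝ u w (1 : ℂ)) z (1 : ℂ) +
  fderiv ℝ (fun w => fderiv ℝ u w Complex.I) z Complex.I

/-- `u` is a solution of the curvature equation `Δu + e^u = 8π Σ m_k δ_{ω_k/2}` on `E_τ`. -/
def IsCurvatureSolution (τ : ℂ) (m : Fin 4 → ℕ) (u : ℂ → ℝ) : Prop :=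
  (∀ z, u (z + 1) = u z) ∧ (∀ z, u (z + τ) = u z) ∧
  (∀ z ∉ singSet τ m, (∀ n : ℕ, ContDiffAt ℝ n u z) ∧ lapl u z + Real.exp (u z) = 0) ∧
  (∀ k : Fin 4, 1 ≤ m k → ∀ l ∈ lat τ,
    ∃ C ε : ℝ, 0 < ε ∧ ∀ z : ℂ, z ≠ per τ (k : ℕ) / 2 + l →
      dist z (per τ (k : ℕ) / 2 + l) < ε →
      |u z - 4 * (m k : ℝ) * Real.log (dist z (per τ (k : ℕ) / 2 + l))| ≤ C)

/-- Multiplicities for equation `(★_k)`: `m₀ = m_k = 1`, the others `0`. -/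
def starM (k : ℕ) : Fin 4 → ℕ := fun j => if (j : ℕ) = 0 ∨ (j : ℕ) = k then 1 else 0

/-- `f` is a developing map of `u`: `f` is meromorphic on `ℂ` and
`u = log (8|f′|²/(1+|f|²)²)` wherever `f` is analytic with nonvanishing derivative. -/
def IsDevelopingMapOf (u : ℂ → ℝ) (f : ℂ → ℂ) : Prop :=
  (∀ z : ℂ, MeromorphicAt f z) ∧
  ∀ z : ℂ, AnalyticAt ℂ f z → deriv f z ≠ 0 →
    u z = Real.log (8 * ‖deriv f z‖ ^ 2 / (1 + ‖f z‖ ^ 2) ^ 2)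

/-- `f` satisfies the type II constraint for the torus `E_τ`. -/
def IsTypeII (τ : ℂ) (f : ℂ → ℂ) : Prop :=
  ∃ θ₁ θ₂ : ℝ,
    (∀ z, f (z + 1) = Complex.exp (2 * Complex.I * (θ₁ : ℂ)) * f z) ∧
    (∀ z, f (z + τ) = Complex.exp (2 * Complex.I * (θ₂ : ℂ)) * f z)

/-- The one-parameter family of solutions generated by the developing map `f`
(with members `u_β` having developing map `e^β f`) contains an even solution. -/
def FamilyHasEven (τ : ℂ) (m : Fin 4 → ℕ) (f : ℂ → ℂ) : Prop :=
  ∃ (β : ℝ) (v : ℂ → ℝ), IsCurvatureSolution τ m v ∧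
    IsDevelopingMapOf v (fun z => (Real.exp β : ℂ) * f z) ∧ ∀ z, v (-z) = v z

/-- `u`, with type II developing map `f`, generates a non-even family of solutions. -/
def GeneratesNonEvenFamily (τ : ℂ) (m : Fin 4 → ℕ) (u : ℂ → ℝ) (f : ℂ → ℂ) : Prop :=
  IsCurvatureSolution τ m u ∧ IsDevelopingMapOf u f ∧ IsTypeII τ f ∧ ¬ FamilyHasEven τ m f

/-- The curvature equation has a non-even family of solutions. -/
def HasNonEvenFamily (τ : ℂ) (m : Fin 4 → ℕ) : Prop :=
  ∃ u f, GeneratesNonEvenFamily τ m u f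

/-- The curvature equation has an even family of solutions. -/
def HasEvenFamily (τ : ℂ) (m : Fin 4 → ℕ) : Prop :=
  ∃ (u : ℂ → ℝ) (f : ℂ → ℂ), IsCurvatureSolution τ m u ∧ IsDevelopingMapOf u f ∧
    IsTypeII τ f ∧ FamilyHasEven τ m f

/-- `y` is a (meromorphic, global) solution of `y″ = q·y` away from the singular set `S`. -/
def SolvesODEOn (q : ℂ → ℂ) (S : Set ℂ) (y : ℂ → ℂ) : Prop :=
  (∀ z : ℂ, MeromorphicAt y z) ∧
  ∀ z ∉ S, AnalyticAt ℂ y z ∧ deriv (deriv y) z = q z * y z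

/-- Linear independence of two functions, tested away from the singular set `S`. -/
def LinIndepOn (S : Set ℂ) (y₁ y₂ : ℂ → ℂ) : Prop :=
  ∀ a b : ℂ, (∀ z ∉ S, a * y₁ z + b * y₂ z = 0) → a = 0 ∧ b = 0

/-- The equation `y″ = q·y` (with singular set `S`) on `E_τ` has unitary monodromy: there is a
fundamental system of solutions whose monodromy matrices w.r.t. `z ↦ z+1` and `z ↦ z+τ`
lie in `SU(2)`. -/
def HasUnitaryMonodromy (q : ℂ → ℂ) (S : Set ℂ) (τ : ℂ) : Prop :=
  ∃ y₁ y₂ : ℂ → ℂ, SolvesODEOn q S y₁ ∧ SolvesODEOn q S y₂ ∧ LinIndepOn S y₁ y₂ ∧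
    ∃ M₁ M₂ : Matrix (Fin 2) (Fin 2) ℂ,
      M₁ ∈ Matrix.unitaryGroup (Fin 2) ℂ ∧ M₁.det = 1 ∧
      M₂ ∈ Matrix.unitaryGroup (Fin 2) ℂ ∧ M₂.det = 1 ∧
      (∀ z, y₁ (z + 1) = M₁ 0 0 * y₁ z + M₁ 0 1 * y₂ z) ∧
      (∀ z, y₂ (z + 1) = M₁ 1 0 * y₁ z + M₁ 1 1 * y₂ z) ∧
      (∀ z, y₁ (z + τ) = M₂ 0 0 * y₁ z + M₂ 0 1 * y₂ z) ∧
      (∀ z, y₂ (z + τ) = M₂ 1 0 * y₁ z + M₂ 1 1 * y₂ z)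

/-- The potential of the Fuchsian equation `L(𝐦_k, T, E, τ)`. -/
def LPot (k : ℕ) (T E τ : ℂ) (z : ℂ) : ℂ :=
  2 * wp τ z + 2 * wp τ (z - per τ k / 2) +
    T * (wzeta τ (z - per τ k / 2) - wzeta τ z) - E

/-- The singular set of `L(𝐦_k, T, E, τ)`: lattice translates of `0` and `ω_k/2`. -/
def LSing (τ : ℂ) (k : ℕ) : Set ℂ := {z | ∃ l ∈ lat τ, z = l ∨ z = per τ k / 2 + l}

/-- The equation `y″ = q·y` is apparent (free of logarithmic singularity) at `p`: there are two
linearly independent single-valued solutions on a punctured neighborhood of `p`, both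
meromorphic at `p`. -/
def ApparentAt (q : ℂ → ℂ) (p : ℂ) : Prop :=
  ∃ (y₁ y₂ : ℂ → ℂ) (ε : ℝ), 0 < ε ∧
    (∀ z ∈ Metric.ball p ε, z ≠ p →
      AnalyticAt ℂ y₁ z ∧ AnalyticAt ℂ y₂ z ∧
      deriv (deriv y₁) z = q z * y₁ z ∧ deriv (deriv y₂) z = q z * y₂ z) ∧
    MeromorphicAt y₁ p ∧ MeromorphicAt y₂ p ∧
    ∀ a b : ℂ, (∀ z ∈ Metric.ball p ε, z ≠ p → a * y₁ z + b * y₂ z = 0) → a = 0 ∧ b = 0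

/-- The translated (even) potential `q_k(z;T,E)` of `L(𝐦_k, T, E, τ)`. -/
def qPot (k : ℕ) (T E τ : ℂ) (z : ℂ) : ℂ :=
  2 * (wp τ (z + per τ k / 4) + wp τ (z - per τ k / 4)) +
    T * (wzeta τ (z + per τ k / 4) - wzeta τ (z - per τ k / 4)) - E

/-- The singular set of the translated potential: lattice translates of `±ω_k/4`. -/
def qSing (τ : ℂ) (k : ℕ) : Set ℂ :=
  {z | ∃ l ∈ lat τ, z = per τ k / 4 + l ∨ z = -(per τ k / 4) + l}

/-- The even elliptic solution `Φ_e(z;T,E)` of the second symmetric product equation. -/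
def PhiE (τ : ℂ) (k : ℕ) (T E : ℂ) (z : ℂ) : ℂ :=
  (wpd τ (per τ k / 4)) ^ 4 / (wp τ z - wp τ (per τ k / 4)) ^ 2 +
  (wpd τ (per τ k / 4)) ^ 2 * (wpd τ (per τ k / 4) * T + wpdd τ (per τ k / 4)) /
      (wp τ z - wp τ (per τ k / 4)) +
  (1 / 4) * (4 * (wpd τ (per τ k / 4)) ^ 2 * E + 3 * (wpd τ (per τ k / 4)) ^ 2 * T ^ 2
    - 8 * wzeta τ (per τ k / 4) * (wpd τ (per τ k / 4)) ^ 2 * T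
    + 32 * wp τ (per τ k / 4) * (wpd τ (per τ k / 4)) ^ 2
    - 3 * (wpdd τ (per τ k / 4)) ^ 2)

/-- For `k ∈ {1,2,3}`, the other two indices, so that `{k, i, i′} = {1,2,3}`. -/
def otherTwo : ℕ → ℕ × ℕ
  | 1 => (2, 3)
  | 2 => (1, 3)
  | 3 => (1, 2)
  | _ => (0, 0)

/-- The Wirtinger derivative `∂_z g = (1/2)(∂_x g - i ∂_y g)`. -/
def wirt (g : ℂ → ℂ) (z : ℂ) : ℂ :=
  (1 / 2) * (fderiv ℝ g z (1 : ℂ) - Complex.I * fderiv ℝ g z Complex.I)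

/-- The potential `q(z) = -(1/2)(u_zz - (1/2) u_z²)` associated with a solution `u`. -/
def uPot (u : ℂ → ℝ) (z : ℂ) : ℂ :=
  -(1 / 2) * (wirt (wirt (fun w => ((u w : ℝ) : ℂ))) z -
    (1 / 2) * (wirt (fun w => ((u w : ℝ) : ℂ)) z) ^ 2)

/-- All lattice translates of the four half-periods. -/
def fullSing (τ : ℂ) : Set ℂ := {z | ∃ k : Fin 4, ∃ l ∈ lat τ, z = per τ (k : ℕ) / 2 + l}

/-- The potential of the general Fuchsian equation (with residues `T₁, T₂, T₃`). -/
def q8 (τ : ℂ) (m : Fin 4 → ℕ) (T₁ T₂ T₃ E : ℂ) (z : ℂ) : ℂ :=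
  (∑ k : Fin 4, (m k : ℂ) * ((m k : ℂ) + 1) * wp τ (z - per τ (k : ℕ) / 2)) +
  T₁ * (wzeta τ (z - per τ 1 / 2) - wzeta τ z) +
  T₂ * (wzeta τ (z - per τ 2 / 2) - wzeta τ z) +
  T₃ * (wzeta τ (z - per τ 3 / 2) - wzeta τ z) - E

/-- The elliptic-of-the-second-kind ansatz built from sigma functions. -/
def sigY (τ : ℂ) (k : ℕ) (a₁ a₂ c : ℂ) (z : ℂ) : ℂ :=
  Complex.exp (c * z) * wsigma τ (z - a₁) * wsigma τ (z - a₂) /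
    (wsigma τ (z - per τ k / 4) * wsigma τ (z + per τ k / 4))

end

namespace HZ
open ComplexConjugate

structure Core (L : PeriodPair) (F : ℂ → ℂ) (c0 : ℂ) : Prop where
  diff : ∀ z, z ∉ L.lattice → DifferentiableAt ℂ F z
  per : ∀ z l, l ∈ L.lattice → F (z + l) = F z + conj l
  odd : ∀ z, F (-z) = -F z
  pole : ∃ κ : ℂ, κ ≠ 0 ∧ ∃ H : ℂ → ℂ, AnalyticAt ℂ H 0 ∧ ∀ᶠ z in 𝓝[≠] (0:ℂ), F z = κ / z + H z
  crit : ∀ z, z ∉ L.lattice → deriv F z = 0 → z - c0 ∈ L.lattice ∨ z + c0 ∈ L.lattice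

/-- the dynamics -/
noncomputable def gm (F : ℂ → ℂ) (v z : ℂ) : ℂ := conj (F z - v)

lemma lat_sep (L : PeriodPair) : ∃ ρ > 0, ∀ l ∈ L.lattice, l ≠ 0 → ρ ≤ ‖l‖ := by
  have h := L.compl_lattice_sdiff_singleton_mem_nhds 0
  obtain ⟨ρ, hρ, hb⟩ := Metric.mem_nhds_iff.1 h
  refine ⟨ρ, hρ, fun l hl h0 => ?_⟩
  by_contra! hlt
  exact hb (by simpa using hlt) ⟨hl, h0⟩

lemma lat_cov (L : PeriodPair) : ∃ D > 0, ∀ z : ℂ, ∃ l ∈ L.lattice, ‖z - l‖ ≤ D := by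
  refine ⟨∑ i, ‖L.basis i‖ + 1, by positivity, fun z => ⟨ZSpan.floor L.basis z, ?_, ?_⟩⟩
  · rw [L.lattice_eq_span_range_basis]
    exact (ZSpan.floor L.basis z).2
  · have := ZSpan.norm_fract_le L.basis z
    rw [ZSpan.fract_apply] at this
    linarith

lemma lat_nhds {L : PeriodPair} {z : ℂ} (hz : z ∉ L.lattice) : ∀ᶠ y in 𝓝 z, y ∉ L.lattice :=
  L.isClosed_lattice.isOpen_compl.mem_nhds hz

lemma add_mem_iff {L : PeriodPair} {z l : ℂ} (hl : l ∈ L.lattice) :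
    z + l ∈ L.lattice ↔ z ∈ L.lattice :=
  ⟨fun h => by simpa using sub_mem h hl, fun h => add_mem h hl⟩

variable {L : PeriodPair} {F : ℂ → ℂ} {c0 : ℂ}

namespace Core

lemma gper (h : Core L F c0) (v z : ℂ) {l : ℂ} (hl : l ∈ L.lattice) :
    gm F v (z + l) = gm F v z + l := by
  simp only [gm, h.per z l hl, map_sub, map_add, Complex.conj_conj]; ring

lemma giter_per (h : Core L F c0) (v : ℂ) (n : ℕ) (z : ℂ) {l : ℂ} (hl : l ∈ L.lattice) :
    (gm F v)^[n] (z + l) = (gm F v)^[n] z + l := by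
  induction n generalizing z with
  | zero => rfl
  | succ n ih => rw [Function.iterate_succ_apply, h.gper v z hl, ih, Function.iterate_succ_apply]

lemma Zper (h : Core L F c0) (z : ℂ) {l : ℂ} (hl : l ∈ L.lattice) :
    F (z + l) - conj (z + l) = F z - conj z := by
  rw [h.per z l hl, map_add]; ring

lemma dper (h : Core L F c0) (z : ℂ) {l : ℂ} (hl : l ∈ L.lattice) :
    deriv F (z + l) = deriv F z := by
  have : (fun z => F (z + l)) = fun z => F z + conj l := by
    funext z; exact h.per z l hl
  have h2 := congrArg (fun f => deriv f z) this
  simpa [deriv_comp_add_const] using h2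

lemma dodd (h : Core L F c0) (z : ℂ) : deriv F (-z) = deriv F z := by
  have : (fun z => F (-z)) = fun z => - F z := by
    funext z; exact h.odd z
  have h2 := congrArg (fun f => deriv f z) this
  simp only [deriv_comp_neg, deriv.fun_neg] at h2
  simpa using h2

lemma godd (h : Core L F c0) (z : ℂ) : gm F 0 (-z) = - gm F 0 z := by
  simp [gm, h.odd]

lemma anal (h : Core L F c0) {z : ℂ} (hz : z ∉ L.lattice) : AnalyticAt ℂ F z := by
  rw [Complex.analyticAt_iff_eventually_differentiableAt]
  filter_upwards [lat_nhds hz] with y hy using h.diff y hy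

lemma hd (h : Core L F c0) {z : ℂ} (hz : z ∉ L.lattice) : HasDerivAt F (deriv F z) z :=
  (h.diff z hz).hasDerivAt

lemma gcont (h : Core L F c0) (v : ℂ) {z : ℂ} (hz : z ∉ L.lattice) : ContinuousAt (gm F v) z := by
  unfold gm
  exact Complex.continuous_conj.continuousAt.comp ((h.diff z hz).continuousAt.sub continuousAt_const)

lemma tendsto_pole (h : Core L F c0) : Tendsto (fun z => ‖F z‖) (𝓝[≠] 0) atTop := by
  obtain ⟨κ, hκ, H, hH, hF⟩ := h.pole
  have h1 : Tendsto (fun z : ℂ => ‖κ‖ * ‖z⁻¹‖) (𝓝[≠] 0) atTop :=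
    (tendsto_norm_cobounded_atTop.comp tendsto_inv₀_nhdsNE_zero).const_mul_atTop
      (norm_pos_iff.2 hκ)
  have h2 : Tendsto (fun z => ‖κ * z⁻¹‖ - ‖H z‖) (𝓝[≠] 0) atTop := by
    have := h1.atTop_add
      ((hH.continuousAt.norm.tendsto.mono_left nhdsWithin_le_nhds).neg)
    simpa [Function.comp_def, sub_eq_add_neg] using this
  refine tendsto_atTop_mono' _ ?_ h2
  filter_upwards [hF] with z hz
  rw [hz, div_eq_mul_inv]
  have := norm_sub_le (κ * z⁻¹ + H z) (H z)
  simp only [add_sub_cancel_right] at this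
  linarith

lemma near_lat (h : Core L F c0) (C : ℝ) : ∃ δ > 0, ∀ z, ∀ l ∈ L.lattice, z ≠ l → ‖z - l‖ < δ →
    C < ‖F z - conj z‖ := by
  have h1 : ∀ᶠ z in 𝓝[≠] (0:ℂ), C < ‖F z - conj z‖ := by
    have h3 : ∀ᶠ z in 𝓝[≠] (0:ℂ), ‖z‖ < 1 := by
      filter_upwards [nhdsWithin_le_nhds (Metric.ball_mem_nhds (0:ℂ) one_pos)] with z hz
      simpa using hz
    filter_upwards [h.tendsto_pole.eventually_gt_atTop (C + 1), h3] with z hz hz'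
    have := norm_sub_norm_le (F z) (conj z)
    rw [RCLike.norm_conj] at this
    linarith
  rw [eventually_nhdsWithin_iff, Metric.eventually_nhds_iff] at h1
  obtain ⟨δ, hδ, hb⟩ := h1
  refine ⟨δ, hδ, fun z l hl hne hlt => ?_⟩
  have := hb (y := z - l) (by simpa using hlt) (by simpa [sub_eq_zero] using hne)
  rwa [← h.Zper (z - l) hl, sub_add_cancel] at this

lemma bdd (h : Core L F c0) {δ : ℝ} (hδ : 0 < δ) : ∃ M, ∀ z, (∀ l ∈ L.lattice, δ ≤ ‖z - l‖) →
    ‖F z - conj z‖ ≤ M := by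
  obtain ⟨D, hD, hcov⟩ := lat_cov L
  let S : Set ℂ := {z | ∀ l ∈ L.lattice, δ ≤ ‖z - l‖}
  have hS : IsClosed S := by
    have : S = ⋂ l ∈ L.lattice, {z | δ ≤ ‖z - l‖} := by ext; simp [S]
    rw [this]
    refine isClosed_biInter fun l hl => isClosed_le continuous_const (by fun_prop)
  have hnot : ∀ z ∈ S, z ∉ L.lattice := fun z hz hl => by
    have := hz z hl; simp at this; linarith
  have hcomp : IsCompact (S ∩ closedBall 0 D) :=
    (isCompact_closedBall 0 D).inter_left hS
  have hc : ContinuousOn (fun z => ‖F z - conj z‖) (S ∩ closedBall 0 D) := fun z hz =>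
    (((h.diff z (hnot z hz.1)).continuousAt.sub
      Complex.continuous_conj.continuousAt).norm).continuousWithinAt
  obtain ⟨M, hM⟩ := (hcomp.image_of_continuousOn hc).bddAbove
  refine ⟨M, fun z hz => ?_⟩
  obtain ⟨l, hl, hzl⟩ := hcov z
  have hz' : z - l ∈ S := fun m hm => by
    have := hz (l + m) (add_mem hl hm)
    rwa [← sub_sub] at this
  have := hM ⟨z - l, ⟨hz', by simpa using hzl⟩, rfl⟩
  simp only at this
  rwa [← h.Zper (z - l) hl, sub_add_cancel] at this

end Core
end HZ

namespace HZ
open ComplexConjugate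
variable {L : PeriodPair} {F : ℂ → ℂ} {c0 : ℂ}
namespace Core

/-- coordinates -/
noncomputable def co (L : PeriodPair) (i : Fin 2) : ℂ →L[ℝ] ℝ :=
  LinearMap.toContinuousLinearMap (L.basis.coord i)

lemma co_int (L : PeriodPair) (i : Fin 2) {l : ℂ} (hl : l ∈ L.lattice) : ∃ m : ℤ, co L i l = m := by
  rw [L.lattice_eq_span_range_basis] at hl
  obtain ⟨c, hc⟩ := (L.basis.mem_span_iff_repr_mem ℤ l).1 hl i
  exact ⟨c, by simpa [co] using hc.symm⟩

lemma norm_le_co (L : PeriodPair) : ∃ A > 0, ∀ z : ℂ, ∀ m : ℝ, (∀ i, |co L i z| ≤ m) → ‖z‖ ≤ A * m := by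
  refine ⟨∑ i, ‖L.basis i‖ + 1, by positivity, fun z m hm => ?_⟩
  have hm0 : 0 ≤ m := (abs_nonneg _).trans (hm 0)
  have hz : z = ∑ i, co L i z • L.basis i := by
    simpa [co] using (L.basis.sum_repr z).symm
  calc ‖z‖ = ‖∑ i, co L i z • L.basis i‖ := by rw [← hz]
    _ ≤ ∑ i, ‖co L i z • L.basis i‖ := norm_sum_le _ _
    _ ≤ ∑ i, m * ‖L.basis i‖ := by
        refine Finset.sum_le_sum fun i _ => ?_
        rw [norm_smul]
        exact mul_le_mul_of_nonneg_right (hm i) (norm_nonneg _)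
    _ = (∑ i, ‖L.basis i‖) * m := by rw [← Finset.mul_sum]; ring
    _ ≤ _ := by nlinarith

lemma co_bound (L : PeriodPair) : ∃ K > 0, ∀ i, ∀ z : ℂ, |co L i z| ≤ K * ‖z‖ := by
  refine ⟨‖co L 0‖ + ‖co L 1‖ + 1, by positivity, fun i z => ?_⟩
  have h1 := (co L i).le_opNorm z
  rw [Real.norm_eq_abs] at h1
  refine h1.trans (mul_le_mul_of_nonneg_right ?_ (norm_nonneg _))
  have := norm_nonneg (co L 0)
  have := norm_nonneg (co L 1)
  fin_cases i <;> simp <;> linarith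

/-- a large compact box on whose boundary `gm` is large -/
lemma box (h : Core L F c0) (v : ℂ) (C R : ℝ) : ∃ m : ℕ, R < m ∧ ∀ z, (∀ i, |co L i z| ≤ m + 1/2) →
    z ∉ L.lattice → ‖gm F v z‖ ≤ C → ∀ i, |co L i z| < m + 1/2 := by
  obtain ⟨K, hK, hKb⟩ := co_bound L
  obtain ⟨M, hM⟩ := h.bdd (δ := 1 / (2 * K)) (by positivity)
  obtain ⟨m, hm⟩ := exists_nat_gt (max R (K * (C + M + ‖v‖ + 1)))
  refine ⟨m, (le_max_left _ _).trans_lt hm, fun z hz hzL hg i => ?_⟩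
  refine lt_of_le_of_ne (hz i) fun heq => ?_
  have hfar : ∀ l ∈ L.lattice, 1 / (2 * K) ≤ ‖z - l‖ := by
    intro l hl
    obtain ⟨n, hn⟩ := co_int L i hl
    have h1 : (1:ℝ)/2 ≤ |co L i (z - l)| := by
      rw [map_sub, hn]
      have hodd : ∀ k : ℤ, (1:ℝ)/2 ≤ |(k:ℝ) + 1/2| := by
        intro k
        rcases le_or_gt 0 k with hk | hk
        · have : (0:ℝ) ≤ k := by exact_mod_cast hk
          rw [abs_of_nonneg (by linarith)]; linarith
        · have : (k:ℝ) ≤ -1 := by exact_mod_cast (by omega : k ≤ -1)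
          rw [abs_of_nonpos (by linarith)]; linarith
      rcases abs_cases (co L i z) with ⟨h2, _⟩ | ⟨h2, _⟩
      · have := hodd (m - n)
        push_cast at this
        rw [← h2, heq]; convert this using 2; ring
      · have := hodd (m + n)
        push_cast at this
        rw [show co L i z = -((m:ℝ) + 1/2) by linarith, ← abs_neg]; convert this using 2; ring
    have h2 := hKb i (z - l)
    rw [div_le_iff₀ (by positivity)]
    nlinarith
  have h1 := hM z hfar
  have h2 : ‖z‖ ≤ C + M + ‖v‖ := by
    have e : z = gm F v z - conj (F z - conj z) + conj v := by
      simp [gm]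
    calc ‖z‖ = ‖gm F v z - conj (F z - conj z) + conj v‖ := by rw [← e]
      _ ≤ ‖gm F v z‖ + ‖conj (F z - conj z)‖ + ‖conj v‖ :=
        (norm_add_le _ _).trans (add_le_add_left (norm_sub_le _ _) _)
      _ ≤ _ := by
        rw [RCLike.norm_conj, RCLike.norm_conj]; linarith
  have h3 := hKb i z
  rw [heq] at h3
  have h4 := (le_max_right _ _).trans_lt hm
  nlinarith

lemma box_compact (h : Core L F c0) (v : ℂ) (C : ℝ) (m : ℝ) :
    IsCompact {z | (∀ i, |co L i z| ≤ m) ∧ z ∉ L.lattice ∧ ‖gm F v z‖ ≤ C} := by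
  obtain ⟨A, hA, hAb⟩ := norm_le_co L
  refine (isCompact_closedBall (0:ℂ) (A * m)).of_isClosed_subset ?_ ?_
  · rw [← isOpen_compl_iff, isOpen_iff_mem_nhds]
    intro z hz
    by_cases hzL : z ∈ L.lattice
    · obtain ⟨δ, hδ, hb⟩ := h.near_lat (C + ‖z‖ + 1 + ‖v‖)
      filter_upwards [Metric.ball_mem_nhds z (lt_min hδ one_pos)] with y hy hy2
      have hy' : ‖y - z‖ < min δ 1 := by simpa [dist_eq_norm] using hy
      have h1 := hb y z hzL (fun e => hy2.2.1 (e ▸ hzL)) (hy'.trans_le (min_le_left _ _))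
      have h2 := hy2.2.2
      have h3 : ‖y‖ ≤ ‖z‖ + 1 := by
        have := norm_le_norm_add_norm_sub' y z
        have := (hy'.trans_le (min_le_right _ _)).le
        linarith
      have e : F y - conj y = conj (gm F v y) + v - conj y := by
        simp [gm]
      rw [e] at h1
      have h4 := norm_sub_le (conj (gm F v y) + v) (conj y)
      have h5 := norm_add_le (conj (gm F v y)) v
      rw [RCLike.norm_conj] at h4 h5
      linarith
    · simp only [mem_compl_iff, mem_ofPred_eq, not_and_or, not_not] at hz
      rcases hz with hz | hz | hz
      · push Not at hz
        obtain ⟨i, hi⟩ := hz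
        filter_upwards [((co L i).continuous.abs.continuousAt (x := z)).eventually_const_lt hi] with y hy hy2
        exact absurd (hy2.1 i) (not_le.2 hy)
      · exact absurd hz hzL
      · push Not at hz
        filter_upwards [(h.gcont v hzL).norm.eventually_const_lt hz] with y hy hy2
        exact absurd hy2.2.2 (not_le.2 hy)
  · intro z hz
    simpa using hAb z m hz.1

lemma crit_val (h : Core L F c0) {z : ℂ} (hz : z ∉ L.lattice) (hd : deriv F z = 0) :
    ∃ ε, (ε = c0 ∨ ε = -c0) ∧ ∃ l ∈ L.lattice, z = ε + l := by
  rcases h.crit z hz hd with h1 | h1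
  · exact ⟨c0, Or.inl rfl, _, h1, by ring⟩
  · exact ⟨-c0, Or.inr rfl, _, h1, by ring⟩

lemma local_inj (h : Core L F c0) (v : ℂ) {z : ℂ} (hz : z ∉ L.lattice) (hd : deriv F z ≠ 0) :
    ∃ φ : OpenPartialHomeomorph ℂ ℂ, z ∈ φ.source ∧ (φ : ℂ → ℂ) = gm F v := by
  have hs : HasStrictDerivAt F (deriv F z) z := (h.anal hz).hasStrictDerivAt
  let φ := (hs.hasStrictFDerivAt_equiv hd).toOpenPartialHomeomorph F
  let ψ : ℂ ≃ₜ ℂ := (Homeomorph.subRight v).trans Complex.conjLIE.toHomeomorph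
  refine ⟨φ.trans ψ.toOpenPartialHomeomorph, ?_, ?_⟩
  · simp [φ]
    exact HasStrictFDerivAt.mem_toOpenPartialHomeomorph_source _
  · ext y
    simp [φ, ψ, gm]

lemma closed_translate (L : PeriodPair) (a : ℂ) : IsClosed {y | ∃ l ∈ L.lattice, y = a + l} := by
  have : {y | ∃ l ∈ L.lattice, y = a + l} = (fun y => y - a) ⁻¹' (L.lattice : Set ℂ) := by
    ext y
    constructor
    · rintro ⟨l, hl, rfl⟩; simpa using hl
    · intro hy; exact ⟨y - a, hy, by ring⟩
  rw [this]
  exact L.isClosed_lattice.preimage (by fun_prop)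

lemma lift (h : Core L F c0) (v : ℂ) {z0 : ℂ} {r : ℝ} (hr : 0 < r) {f : ℂ → ℂ}
    (hf : ContinuousOn f (closedBall z0 r))
    (hCV : ∀ b ∈ closedBall z0 r, ∀ ε, (ε = c0 ∨ ε = -c0) → ∀ l ∈ L.lattice, f b ≠ gm F v ε + l)
    {e0 : ℂ} (he0 : e0 ∉ L.lattice) (hge : gm F v e0 = f z0) :
    ∃ f' : ℂ → ℂ, ContinuousOn f' (closedBall z0 r) ∧ f' z0 = e0 ∧
      ∀ b ∈ closedBall z0 r, f' b ∉ L.lattice ∧ gm F v (f' b) = f b := by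
  classical
  obtain ⟨C0, hC0⟩ := ((isCompact_closedBall z0 r).image_of_continuousOn hf).isBounded.exists_norm_le
  set C := C0 + 1
  obtain ⟨K0, hK0, hKb⟩ := co_bound L
  obtain ⟨m, hm, hbox⟩ := h.box v C (K0 * ‖e0‖)
  let K : Set ℂ := {z | (∀ i, |co L i z| ≤ (m:ℝ) + 1/2) ∧ z ∉ L.lattice ∧ ‖gm F v z‖ ≤ C}
  have hKc : IsCompact K := h.box_compact v C _
  have : CompactSpace K := isCompact_iff_compactSpace.1 hKc
  let p : K → ℂ := fun z => gm F v z
  have hgK : ∀ z ∈ K, ContinuousAt (gm F v) z := fun z hz => h.gcont v hz.2.1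
  have hp : Continuous p := by
    have : ContinuousOn (gm F v) K := fun z hz => (hgK z hz).continuousWithinAt
    exact this.domRestrict
  let CV : Set ℂ := {y | ∃ l ∈ L.lattice, y = gm F v c0 + l} ∪ {y | ∃ l ∈ L.lattice, y = gm F v (-c0) + l}
  let s : Set ℂ := ball 0 C \ CV
  have hcov : IsCoveringMapOn p s := by
    apply IsCoveringMapOn.of_isLocalHomeomorphOn hp
    rintro ⟨z, hz⟩ hzs
    have hzs : gm F v z ∈ s := hzs
    have hd : deriv F z ≠ 0 := by
      intro hd
      obtain ⟨ε, hε, l, hl, rfl⟩ := h.crit_val hz.2.1 hd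
      apply hzs.2
      rcases hε with rfl | rfl
      · exact Or.inl ⟨l, hl, h.gper v _ hl⟩
      · exact Or.inr ⟨l, hl, h.gper v _ hl⟩
    obtain ⟨φ, hzφ, hφ⟩ := h.local_inj v hz.2.1 hd
    have hnb : K ∈ 𝓝 z := by
      have h1 : ∀ i, ∀ᶠ y in 𝓝 z, |co L i y| < (m:ℝ) + 1/2 := fun i =>
        ((co L i).continuous.abs.continuousAt (x := z)).eventually_lt_const (hbox z hz.1 hz.2.1 hz.2.2 i)
      have h2 : ∀ᶠ y in 𝓝 z, ‖gm F v y‖ < C :=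
        (h.gcont v hz.2.1).norm.eventually_lt_const (by simpa using hzs.1)
      filter_upwards [eventually_all.2 h1, lat_nhds hz.2.1, h2] with y a b c
      exact ⟨fun i => (a i).le, b, c.le⟩
    obtain ⟨V, hVK, hVo, hzV⟩ := _root_.mem_nhds_iff.1 hnb
    let e : OpenPartialHomeomorph K ℂ := 
      { toFun := p
        invFun := fun y => if hy : φ.symm y ∈ K then ⟨φ.symm y, hy⟩ else ⟨z, hz⟩
        source := Subtype.val ⁻¹' (V ∩ φ.source)
        target := φ '' (V ∩ φ.source)
        map_source' := fun x hx => ⟨x, hx, by rw [hφ]⟩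
        map_target' := by
          rintro _ ⟨y, hy, rfl⟩
          have : φ.symm (φ y) ∈ K := by rw [φ.left_inv hy.2]; exact hVK hy.1
          simp only [this, dif_pos, mem_preimage]
          rwa [φ.left_inv hy.2]
        left_inv' := by
          rintro ⟨x, hxK⟩ hx
          have e1 : φ.symm (p ⟨x, hxK⟩) = x := by
            show φ.symm (gm F v x) = x
            rw [← hφ]; exact φ.left_inv hx.2
          simp only [e1, hxK, dif_pos]
        right_inv' := by
          rintro _ ⟨y, hy, rfl⟩
          have : φ.symm (φ y) ∈ K := by rw [φ.left_inv hy.2]; exact hVK hy.1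
          simp only [this, dif_pos]
          show gm F v (φ.symm (φ y)) = _
          rw [← hφ, φ.left_inv hy.2]
        open_source := (hVo.inter φ.open_source).preimage continuous_subtype_val
        open_target := φ.isOpen_image_of_subset_source (hVo.inter φ.open_source) inter_subset_right
        continuousOn_toFun := hp.continuousOn
        continuousOn_invFun := by
          rw [continuousOn_iff_continuous_domRestrict, continuous_induced_rng]
          have h1 : ContinuousOn φ.symm (φ '' (V ∩ φ.source)) := by
            refine φ.continuousOn_symm.mono ?_
            rintro _ ⟨y, hy, rfl⟩
            exact φ.map_source hy.2
          refine h1.domRestrict.congr ?_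
          rintro ⟨_, y, hy, rfl⟩
          have : φ.symm (φ y) ∈ K := by rw [φ.left_inv hy.2]; exact hVK hy.1
          simp only [domRestrict_apply, Function.comp_apply]
          rw [dif_pos this] }
    exact ⟨e, ⟨hzV, hzφ⟩, rfl⟩
  have : ContractibleSpace (closedBall z0 r) :=
    (convex_closedBall z0 r).contractibleSpace ⟨z0, mem_closedBall_self hr.le⟩
  have : LocallyPathConnectedSpace (closedBall z0 r) :=
    (convex_closedBall z0 r).locallyPathConnectedSpace
  have he0K : e0 ∈ K := by
    refine ⟨fun i => ?_, he0, ?_⟩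
    · have := hKb i e0; linarith
    · rw [hge]
      have := hC0 (f z0) ⟨z0, mem_closedBall_self hr.le, rfl⟩
      simp only [C]; linarith
  obtain ⟨G, ⟨hG0, hG⟩, -⟩ := hcov.existsUnique_continuousMap_lifts
    (f := ⟨fun b : closedBall z0 r => f b, hf.domRestrict⟩) (a₀ := ⟨z0, mem_closedBall_self hr.le⟩)
    (e₀ := ⟨e0, he0K⟩) hge (fun a => by
      refine ⟨?_, ?_⟩
      · have := hC0 (f a) ⟨a, a.2, rfl⟩
        rw [mem_ball_zero_iff]
        change ‖f a‖ < C0 + 1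
        linarith
      · rintro (⟨l, hl, e⟩ | ⟨l, hl, e⟩)
        · exact hCV a a.2 c0 (Or.inl rfl) l hl e
        · exact hCV a a.2 (-c0) (Or.inr rfl) l hl e)
  refine ⟨fun b => if hb : b ∈ closedBall z0 r then (G ⟨b, hb⟩ : ℂ) else 0, ?_, ?_, ?_⟩
  · rw [continuousOn_iff_continuous_domRestrict]
    have : Continuous fun b => (G b : ℂ) := continuous_subtype_val.comp G.continuous
    refine this.congr ?_
    rintro ⟨b, hb⟩
    simp only [domRestrict_apply]
    rw [dif_pos hb]
  · beta_reduce
    rw [dif_pos (mem_closedBall_self hr.le), hG0]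
  · intro b hb
    beta_reduce
    rw [dif_pos hb]
    exact ⟨(G ⟨b, hb⟩).2.2.1, congrFun hG ⟨b, hb⟩⟩

end Core
end HZ

namespace HZ
open ComplexConjugate
variable {L : PeriodPair} {F : ℂ → ℂ} {c0 : ℂ}
namespace Core

/-- contraction near an attracting fixed point -/
lemma contr (h : Core L F c0) {v z0 : ℂ} (hz0 : z0 ∉ L.lattice) (hv : F z0 - conj z0 = v)
    (hd : ‖deriv F z0‖ < 1) : ∃ q, 0 ≤ q ∧ q < 1 ∧ ∀ᶠ y in 𝓝 z0, ‖gm F v y - z0‖ ≤ q * ‖y - z0‖ := by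
  set d := ‖deriv F z0‖ with hdd
  refine ⟨(1 + d) / 2, by positivity, by linarith, ?_⟩
  have h1 := (hasDerivAt_iff_isLittleO.1 (h.hd hz0)).bound (c := (1 - d)/2) (by linarith)
  filter_upwards [h1] with y hy
  have e : gm F v y - z0 = conj (F y - F z0) := by
    simp only [gm, ← hv, map_sub, Complex.conj_conj]; ring
  rw [e, RCLike.norm_conj]
  have h2 : F y - F z0 = (F y - F z0 - (y - z0) • deriv F z0) + (y - z0) • deriv F z0 := by ring
  rw [h2]
  refine (norm_add_le _ _).trans ?_
  rw [norm_smul, ← hdd]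
  linarith

lemma contr_iter {g : ℂ → ℂ} {z0 : ℂ} {q r : ℝ} (hq0 : 0 ≤ q) (hq : q < 1)
    (hc : ∀ y ∈ closedBall z0 r, ‖g y - z0‖ ≤ q * ‖y - z0‖) (n : ℕ) {y : ℂ} (hy : y ∈ closedBall z0 r) :
    ‖g^[n] y - z0‖ ≤ q ^ n * r := by
  have hr : 0 ≤ r := by
    have := mem_closedBall.1 hy
    exact dist_nonneg.trans this
  induction n with
  | zero => simpa [dist_eq_norm] using hy
  | succ n ih =>
    rw [Function.iterate_succ_apply']
    have : g^[n] y ∈ closedBall z0 r := by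
      rw [mem_closedBall, dist_eq_norm]
      refine ih.trans (mul_le_of_le_one_left hr (pow_le_one₀ hq0 hq.le))
    refine (hc _ this).trans ?_
    rw [pow_succ']
    nlinarith

/-- the doubled map is holomorphic -/
lemma hasDerivAt_gg (h : Core L F c0) (v : ℂ) {z : ℂ} (hz : z ∉ L.lattice)
    (hz2 : gm F v z ∉ L.lattice) :
    HasDerivAt (fun z => gm F v (gm F v z)) (conj (deriv F (gm F v z)) * deriv F z) z := by
  have h1 : HasDerivAt (fun y => F y - v) (deriv F z) z := (h.hd hz).sub_const v
  have h2 : HasDerivAt (fun y => conj (F (conj y) - v)) (conj (deriv F (gm F v z))) (F z - v) := by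
    have h3 : HasDerivAt (fun y => F y - v) (deriv F (gm F v z)) (conj (F z - v)) :=
      (h.hd hz2).sub_const v
    have := h3.conj_conj
    simpa [Function.comp_def] using this
  exact HasDerivAt.comp (h₂ := fun y => conj (F (conj y) - v)) (h := fun y => F y - v) z h2 h1

theorem fatou (h : Core L F c0) {v z0 : ℂ} (hz0 : z0 ∉ L.lattice) (hv : F z0 - conj z0 = v)
    (hd : ‖deriv F z0‖ < 1) : ∃ ε, (ε = c0 ∨ ε = -c0) ∧ ∀ δ > 0, ∃ N, ∀ n ≥ N, ∃ l ∈ L.lattice,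
      ‖(gm F v)^[n] ε - (z0 + l)‖ < δ := by
  set g := gm F v with hg
  obtain ⟨q, hq0, hq1, hq⟩ := h.contr hz0 hv hd
  obtain ⟨ρ, hρ, hρb⟩ := lat_sep L
  obtain ⟨r1, hr1, hb1⟩ := Metric.eventually_nhds_iff_ball.1 (hq.and (lat_nhds hz0))
  set r := min (r1/2) (ρ/3) with hrdef
  have hr : 0 < r := by positivity
  have hrb : closedBall z0 r ⊆ ball z0 r1 := closedBall_subset_ball (by
    have := min_le_left (r1/2) (ρ/3); linarith)
  have hrρ : 2 * r < ρ := by have := min_le_right (r1/2) (ρ/3); linarith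
  have hc : ∀ y ∈ closedBall z0 r, ‖g y - z0‖ ≤ q * ‖y - z0‖ := fun y hy => (hb1 y (hrb hy)).1
  by_contra! hcon
  -- orbits never enter the ball
  have key : ∀ ε, (ε = c0 ∨ ε = -c0) → ∀ n, ∀ l ∈ L.lattice, g^[n] ε + l ∉ closedBall z0 r := by
    intro ε hε n l hl hmem
    obtain ⟨δ, hδ, hN⟩ := hcon ε hε
    have hlim : Tendsto (fun n => q ^ n * r) atTop (𝓝 0) := by
      simpa using (tendsto_pow_atTop_nhds_zero_of_lt_one hq0 hq1).mul_const r
    obtain ⟨N, hN2⟩ := eventually_atTop.1 (hlim.eventually_lt_const hδ)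
    obtain ⟨m, hm, hm2⟩ := hN (n + N)
    have h1 := hm2 (-l) (neg_mem hl)
    have h2 := contr_iter hq0 hq1 hc (m - n) hmem
    have h3 := hN2 (m - n) (by omega)
    rw [hg, h.giter_per v _ _ hl, ← hg, ← Function.iterate_add_apply, Nat.sub_add_cancel (by omega)] at h2
    rw [show g^[m] ε - (z0 + -l) = g^[m] ε + l - z0 by ring] at h1
    linarith
  have hgz0 : g z0 = z0 := by simp [hg, gm, ← hv]
  have hD0 : deriv F z0 ≠ 0 := by
    intro h0
    obtain ⟨ε, hε, l, hl, e⟩ := h.crit_val hz0 h0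
    refine key ε hε 0 l hl ?_
    simp only [Function.iterate_zero, id]
    rw [← e]; exact mem_closedBall_self hr.le
  set G : ℂ → ℂ := fun z => g (g z) with hG
  have hGit : ∀ n z, G^[n] z = g^[2*n] z := by
    intro n z
    induction n generalizing z with
    | zero => rfl
    | succ n ih => rw [Function.iterate_succ_apply, ih]; rfl
  set D : ℂ := conj (deriv F z0) * deriv F z0 with hD
  have hGd : HasDerivAt G D z0 := by
    have := h.hasDerivAt_gg v hz0 (by rw [← hg, hgz0]; exact hz0)
    rw [← hg, hgz0] at this
    exact this
  have hDn : ‖D‖ = ‖deriv F z0‖ ^ 2 := by rw [hD, norm_mul, RCLike.norm_conj]; ring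
  have main : ∀ n : ℕ, ∃ f : ℂ → ℂ, ContinuousOn f (closedBall z0 r) ∧ f z0 = z0 ∧
      ∀ b ∈ closedBall z0 r, G^[n] (f b) = b ∧ ∃ d, d ≠ 0 ∧ HasDerivAt (G^[n]) d (f b) := by
    intro n
    induction n with
    | zero => exact ⟨id, continuousOn_id, rfl, fun b hb => ⟨rfl, 1, one_ne_zero, hasDerivAt_id _⟩⟩
    | succ n ih =>
      obtain ⟨f, hf, hf0, hfb⟩ := ih
      have hz0b : z0 ∈ closedBall z0 r := mem_closedBall_self hr.le
      obtain ⟨f1, hf1, hf10, hf1b⟩ := h.lift v hr hf (fun b hb ε hε l hl e => by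
        refine key ε hε (2*n+1) l hl ?_
        have := (hfb b hb).1
        rw [e, hGit, hg, h.giter_per v _ _ hl, ← hg] at this
        rw [Function.iterate_succ_apply, this]; exact hb) hz0 (by rw [hf0]; exact hgz0)
      obtain ⟨f2, hf2, hf20, hf2b⟩ := h.lift v hr hf1 (fun b hb ε hε l hl e => by
        refine key ε hε (2*n+2) l hl ?_
        have := (hfb b hb).1
        rw [← (hf1b b hb).2, e, hGit, h.gper v _ hl, h.giter_per v _ _ hl, ← hg] at this
        rw [Function.iterate_succ_apply, Function.iterate_succ_apply, this]; exact hb) hz0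
          (by rw [hf10]; exact hgz0)
      refine ⟨f2, hf2, hf20, fun b hb => ⟨?_, ?_⟩⟩
      · rw [Function.iterate_succ_apply]
        simp only [hG, hg]
        rw [(hf2b b hb).2, (hf1b b hb).2]
        exact (hfb b hb).1
      · obtain ⟨d, hd0, hdd⟩ := (hfb b hb).2
        have e2 : g (f2 b) = f1 b := (hf2b b hb).2
        have e1 : g (f1 b) = f b := (hf1b b hb).2
        have n1 : deriv F (f1 b) ≠ 0 := by
          intro h0
          obtain ⟨ε, hε, l, hl, e⟩ := h.crit_val (hf1b b hb).1 h0
          refine key ε hε (2*n+1) l hl ?_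
          have := (hfb b hb).1
          rw [← e1, e, hGit, hg, h.gper v _ hl, h.giter_per v _ _ hl, ← hg] at this
          rw [Function.iterate_succ_apply, this]; exact hb
        have n2 : deriv F (f2 b) ≠ 0 := by
          intro h0
          obtain ⟨ε, hε, l, hl, e⟩ := h.crit_val (hf2b b hb).1 h0
          refine key ε hε (2*n+2) l hl ?_
          have := (hfb b hb).1
          rw [← e1, ← e2, e, hGit, hg, h.gper v _ hl, h.gper v _ hl, h.giter_per v _ _ hl, ← hg] at this
          rw [Function.iterate_succ_apply, Function.iterate_succ_apply, this]; exact hb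
        have hh := h.hasDerivAt_gg v (hf2b b hb).1 (by rw [(hf2b b hb).2]; exact (hf1b b hb).1)
        rw [(hf2b b hb).2] at hh
        refine ⟨d * (conj (deriv F (f1 b)) * deriv F (f2 b)), ?_, ?_⟩
        · simp [hd0, n1, n2]
        · rw [Function.iterate_succ]
          refine HasDerivAt.comp (f2 b) ?_ hh
          have : gm F v (gm F v (f2 b)) = f b := by rw [← hg, e2, e1]
          rw [show G (f2 b) = f b from this]
          exact hdd
  -- choose a nonzero lattice vector
  have hω : L.ω₁ ∈ L.lattice := L.ω₁_mem_lattice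
  have hω0 : L.ω₁ ≠ 0 := by
    intro h0; have := L.ω₁_div_two_notMem_lattice; rw [h0] at this; simp at this
  set w := L.ω₁
  have bound : ∀ n : ℕ, (‖D‖⁻¹) ^ n ≤ 2 * ‖w‖ ^ 2 / r ^ 2 := by
    intro n
    obtain ⟨f, hf, hf0, hfb⟩ := main n
    have hfar : ∀ b ∈ closedBall z0 r, r ≤ ‖f b - (z0 + w)‖ := by
      intro b hb
      by_contra! hlt
      have hm : f b - w ∈ closedBall z0 r := by
        rw [mem_closedBall, dist_eq_norm, sub_sub, add_comm w]; exact hlt.le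
      have h1 := contr_iter hq0 hq1 hc (2*n) hm
      have h2 := (hfb b hb).1
      rw [hGit, ← sub_add_cancel (f b) w, hg, h.giter_per v _ _ hω, ← hg] at h2
      have h3 : ‖w‖ < ρ := by
        have e : w = (b - z0) - (g^[2*n] (f b - w) - z0) := by linear_combination h2
        have h4 : ‖w‖ ≤ ‖b - z0‖ + ‖g^[2*n] (f b - w) - z0‖ := by
          conv_lhs => rw [e]
          exact norm_sub_le _ _
        have h5 : ‖b - z0‖ ≤ r := by simpa [dist_eq_norm] using hb
        have h6 : q ^ (2*n) * r ≤ r := mul_le_of_le_one_left hr.le (pow_le_one₀ hq0 hq1.le)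
        linarith
      have := hρb w hω hω0
      linarith
    have hfd : ∀ b ∈ ball z0 r, DifferentiableAt ℂ f b := by
      intro b hb
      obtain ⟨d, hd0, hdd⟩ := (hfb b (ball_subset_closedBall hb)).2
      refine (HasDerivAt.of_local_left_inverse ?_ hdd hd0 ?_).differentiableAt
      · exact hf.continuousAt (closedBall_mem_nhds_of_mem hb)
      · filter_upwards [isOpen_ball.mem_nhds hb] with y hy
        exact (hfb y (ball_subset_closedBall hy)).1
    have hDne : D ^ n ≠ 0 := pow_ne_zero _ (by simp [hD, hD0])
    have hf' : HasDerivAt f (D ^ n)⁻¹ z0 := by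
      refine HasDerivAt.of_local_left_inverse (f := G^[n]) ?_ ?_ hDne ?_
      · exact hf.continuousAt (closedBall_mem_nhds z0 hr)
      · rw [hf0]; exact hGd.iterate z0 (show g (g z0) = z0 by rw [hgz0, hgz0]) n
      · filter_upwards [closedBall_mem_nhds z0 hr] with y hy
        exact (hfb y hy).1
    have hne : ∀ b ∈ closedBall z0 r, f b - (z0 + w) ≠ 0 := fun b hb h0 => by
      have := hfar b hb; rw [h0, norm_zero] at this; linarith
    have hu : HasDerivAt (fun b => (f b - (z0 + w))⁻¹) (-(D^n)⁻¹ / (f z0 - (z0+w))^2) z0 :=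
      (hf'.sub_const _).fun_inv (hne z0 (mem_closedBall_self hr.le))
    have hcl : closedBall z0 (r/2) ⊆ ball z0 r := closedBall_subset_ball (by linarith)
    have hdiff : DiffContOnCl ℂ (fun b => (f b - (z0 + w))⁻¹) (ball z0 (r/2)) := by
      apply DifferentiableOn.diffContOnCl_ball (U := ball z0 r) _ hcl
      intro b hb
      exact (((hfd b hb).sub_const _).fun_inv (hne b (ball_subset_closedBall hb))).differentiableWithinAt
    have hC := Complex.norm_deriv_le_of_forall_mem_sphere_norm_le (by linarith : 0 < r/2) hdiff
      (C := r⁻¹) (fun b hb => by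
        rw [norm_inv]
        exact inv_anti₀ hr (hfar b (ball_subset_closedBall (hcl (sphere_subset_closedBall hb)))))
    rw [hu.deriv, hf0, norm_div, norm_neg, norm_inv, norm_pow, norm_pow,
      show z0 - (z0 + w) = -w by ring, norm_neg] at hC
    have hw : 0 < ‖w‖ := norm_pos_iff.2 hω0
    rw [div_le_iff₀ (by positivity)] at hC
    rw [inv_pow]
    refine hC.trans (le_of_eq ?_)
    field_simp
  have hDpos : 0 < ‖D‖ := by rw [hDn]; have := norm_pos_iff.2 hD0; positivity
  have hDlt : ‖D‖ < 1 := by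
    rw [hDn]
    have := norm_nonneg (deriv F z0)
    nlinarith
  have := tendsto_pow_atTop_atTop_of_one_lt ((one_lt_inv₀ hDpos).2 hDlt)
  obtain ⟨n, hn⟩ := (this.eventually_gt_atTop (2 * ‖w‖ ^ 2 / r ^ 2)).exists
  linarith [bound n]

end Core
end HZ

namespace HZ
open ComplexConjugate MeasureTheory

/-- fundamental domain -/
def PD (L : PeriodPair) : Set ℂ := ZSpan.fundamentalDomain L.basis

lemma PD_exists (L : PeriodPair) (z : ℂ) : ∃ l ∈ L.lattice, z + l ∈ PD L := by
  refine ⟨-(ZSpan.floor L.basis z : ℂ), neg_mem ?_, ?_⟩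
  · rw [L.lattice_eq_span_range_basis]
    exact (ZSpan.floor L.basis z).2
  · rw [← sub_eq_add_neg, ← ZSpan.fract_apply]
    exact ZSpan.fract_mem_fundamentalDomain _ _

lemma PD_unique {L : PeriodPair} {z z' : ℂ} (hz : z ∈ PD L) (hz' : z' ∈ PD L)
    (h : z - z' ∈ L.lattice) : z = z' := by
  rw [L.lattice_eq_span_range_basis] at h
  have h1 := (ZSpan.fract_eq_self (b := L.basis)).2 hz
  have h2 := (ZSpan.fract_eq_self (b := L.basis)).2 hz'
  have h3 := ZSpan.fract_eq_fract L.basis z' z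
  rw [← h1, ← h2]
  exact (h3.2 (by rwa [neg_add_eq_sub])).symm

lemma PD_meas (L : PeriodPair) : MeasurableSet (PD L) := ZSpan.fundamentalDomain_measurableSet _

lemma PD_bdd (L : PeriodPair) : ∃ R > 0, PD L ⊆ closedBall 0 R := by
  obtain ⟨R, hR⟩ := (ZSpan.fundamentalDomain_isBounded L.basis).subset_closedBall 0
  exact ⟨max R 1, by positivity, hR.trans (closedBall_subset_closedBall (le_max_left _ _))⟩

lemma PD_int {L : PeriodPair} {E : Type*} [NormedAddCommGroup E] {f : ℂ → E} (hf : Continuous f) :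
    IntegrableOn f (PD L) := by
  obtain ⟨R, _, hR⟩ := PD_bdd L
  exact (hf.continuousOn.integrableOn_compact (isCompact_closedBall 0 R)).mono_set hR

lemma PD_shift {L : PeriodPair} {E : Type*} [NormedAddCommGroup E] [NormedSpace ℝ E] {f : ℂ → E}
    (hf : ∀ z, ∀ l ∈ L.lattice, f (z + l) = f z) (a : ℂ) :
    ∫ z in PD L, f (z + a) = ∫ z in PD L, f z := by
  have h0 : VAddInvariantMeasure (Submodule.span ℤ (Set.range L.basis)) ℂ (volume : Measure ℂ) :=
    ⟨fun c s _ => by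
      have : (fun x : ℂ => c +ᵥ x) = fun x => (c : ℂ) + x := by
        funext x; rw [Submodule.vadd_def, vadd_eq_add]
      rw [this]
      exact measure_preimage_add _ _ _⟩
  have h1 := ZSpan.isAddFundamentalDomain L.basis (volume : Measure ℂ)
  have h2 := h1.vadd_of_comm a
  have h3 := h2.setIntegral_eq h1 (f := f) (fun g x => by
    have := hf x g (by rw [L.lattice_eq_span_range_basis]; exact g.2)
    rw [← this, Submodule.vadd_def, vadd_eq_add, add_comm])
  have h4 := (measurePreserving_add_right (volume : Measure ℂ) a).setIntegral_image_emb
    (MeasurableEquiv.addRight a).measurableEmbedding f (PD L)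
  rw [← h4]
  unfold PD
  rw [← h3]
  congr 2
  ext z
  rw [Set.mem_vadd_set]
  constructor
  · rintro ⟨y, hy, rfl⟩
    exact ⟨y, hy, by rw [vadd_eq_add, add_comm]⟩
  · rintro ⟨y, hy, rfl⟩
    exact ⟨y, hy, by rw [vadd_eq_add, add_comm]⟩

lemma dui {L : PeriodPair} {E : Type*} [NormedAddCommGroup E] [NormedSpace ℝ E] 
    {f : ℝ × ℂ → E} (hf : ContDiff ℝ 1 f) (t0 : ℝ) :
    HasDerivAt (fun t => ∫ z in PD L, f (t, z)) (∫ z in PD L, fderiv ℝ f (t0, z) (1, 0)) t0 := by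
  obtain ⟨R, _, hR⟩ := PD_bdd L
  have hc : Continuous fun p : ℝ × ℂ => fderiv ℝ f p (1, 0) :=
    (hf.continuous_fderiv one_ne_zero).clm_apply continuous_const
  obtain ⟨C, hC⟩ := ((isCompact_Icc (a := t0-1) (b := t0+1)).prod (isCompact_closedBall (0:ℂ) R)).image
    hc |>.isBounded.exists_norm_le
  have hfin : volume (PD L) ≠ ⊤ := ne_top_of_le_ne_top (isCompact_closedBall (0:ℂ) R).measure_lt_top.ne
    (measure_mono hR)
  have key := hasDerivAt_integral_of_dominated_loc_of_deriv_le (μ := volume.restrict (PD L)) (x₀ := t0)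
    (s := Icc (t0-1) (t0+1)) (F := fun t z => f (t, z)) (F' := fun t z => fderiv ℝ f (t, z) (1,0))
    (bound := fun _ => C) (Icc_mem_nhds (by linarith) (by linarith)) ?_ ?_ ?_ ?_ ?_ ?_
  · exact key.2
  · refine Eventually.of_forall fun t => (PD_int (L := L) (f := fun z => f (t, z)) ?_).aestronglyMeasurable
    exact hf.continuous.comp (by fun_prop)
  · exact PD_int (hf.continuous.comp (by fun_prop))
  · exact (PD_int (L := L) (f := fun z => fderiv ℝ f (t0, z) (1, 0)) (hc.comp (by fun_prop))).aestronglyMeasurable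
  · refine (ae_restrict_iff' (PD_meas L)).2 (Eventually.of_forall fun z hz t ht => ?_)
    exact hC _ ⟨(t, z), ⟨ht, hR hz⟩, rfl⟩
  · exact integrableOn_const hfin
  · refine Eventually.of_forall fun z t _ => ?_
    have h1 : HasFDerivAt f (fderiv ℝ f (t, z)) (t, z) := (hf.differentiable one_ne_zero _).hasFDerivAt
    have h2 : HasDerivAt (fun t : ℝ => (t, z)) ((1:ℝ), (0:ℂ)) t := (hasDerivAt_id t).prodMk (hasDerivAt_const t z)
    exact h1.comp_hasDerivAt t h2

lemma int_deriv_zero {L : PeriodPair} {E : Type*} [NormedAddCommGroup E] [NormedSpace ℝ E]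
    {f : ℂ → E} (hf : ContDiff ℝ 1 f)
    (hp : ∀ z, ∀ l ∈ L.lattice, f (z + l) = f z) (e : ℂ) :
    ∫ z in PD L, fderiv ℝ f z e = 0 := by
  have h1 := dui (L := L) (f := fun p : ℝ × ℂ => f (p.2 + p.1 • e)) (hf.comp (by fun_prop)) 0
  have h2 : (fun t : ℝ => ∫ z in PD L, f (z + t • e)) = fun _ => ∫ z in PD L, f z := by
    funext t; exact PD_shift hp _
  simp only [h2] at h1
  have h3 := h1.unique (hasDerivAt_const _ _)
  rw [← h3]
  congr 1
  funext z
  have h4 : HasFDerivAt f (fderiv ℝ f z) (z + (0:ℝ) • e) := by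
    simpa using (hf.differentiable one_ne_zero z).hasFDerivAt
  have h5 : HasFDerivAt (fun p : ℝ × ℂ => p.2 + p.1 • e)
      (ContinuousLinearMap.snd ℝ ℝ ℂ + (ContinuousLinearMap.fst ℝ ℝ ℂ).smulRight e) ((0:ℝ), z) :=
    hasFDerivAt_snd.add (hasFDerivAt_fst.smul_const e)
  have h6 := HasFDerivAt.comp (g := f) ((0:ℝ), z) h4 h5
  rw [show (fun p : ℝ × ℂ => f (p.2 + p.1 • e)) = f ∘ fun p : ℝ × ℂ => p.2 + p.1 • e from rfl, h6.fderiv]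
  simp

end HZ

namespace HZ
open ComplexConjugate MeasureTheory

noncomputable def Zf (F : ℂ → ℂ) (z : ℂ) : ℂ := F z - conj z
noncomputable def Jf (F : ℂ → ℂ) (z : ℂ) : ℝ := ‖deriv F z‖ ^ 2 - 1
noncomputable def DZ (a : ℂ) : ℂ →L[ℝ] ℂ :=
  ContinuousLinearMap.mul ℝ ℂ a - (Complex.conjCLE : ℂ →L[ℝ] ℂ)

lemma DZ_apply (a t : ℂ) : DZ a t = a * t - conj t := by
  simp [DZ]

lemma DZ_det (a : ℂ) : (DZ a).det = ‖a‖ ^ 2 - 1 := by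
  have h : (DZ a).det = LinearMap.det (DZ a : ℂ →ₗ[ℝ] ℂ) := rfl
  rw [h, ← LinearMap.det_toMatrix Complex.basisOneI, Matrix.det_fin_two]
  simp [LinearMap.toMatrix_apply, DZ_apply, Complex.sq_norm, Complex.normSq_apply]
  ring

lemma DZ_sol (a u : ℂ) : DZ a (conj a * u + conj u) = ((‖a‖ ^ 2 - 1 : ℝ)) • u := by
  rw [DZ_apply]
  simp only [map_add, map_mul, Complex.conj_conj, Complex.real_smul]
  push_cast
  rw [← Complex.mul_conj']
  ring

open Classical in
noncomputable def ext (L : PeriodPair) (F : ℂ → ℂ) (φ : ℂ → ℝ) (v : ℂ) (Y : ℂ → ℝ) (z : ℂ) : ℝ :=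
  if z ∈ L.lattice then 0 else φ (Zf F z - v) * Y z

variable {L : PeriodPair} {F : ℂ → ℂ} {c0 : ℂ}

lemma ext_of {φ : ℂ → ℝ} {v : ℂ} {Y : ℂ → ℝ} {z : ℂ} (hz : z ∉ L.lattice) :
    ext L F φ v Y z = φ (Zf F z - v) * Y z := by
  unfold ext; rw [if_neg hz]

lemma ext_mem {φ : ℂ → ℝ} {v : ℂ} {Y : ℂ → ℝ} {z : ℂ} (hz : z ∈ L.lattice) :
    ext L F φ v Y z = 0 := by
  unfold ext; rw [if_pos hz]

namespace Core

lemma Zstrict (h : Core L F c0) {z : ℂ} (hz : z ∉ L.lattice) :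
    HasStrictFDerivAt (Zf F) (DZ (deriv F z)) z := by
  have hs : HasStrictDerivAt F (deriv F z) z := (h.anal hz).hasStrictDerivAt
  have h1 := (hs.hasStrictFDerivAt.restrictScalars ℝ).sub
    (Complex.conjCLE : ℂ →L[ℝ] ℂ).hasStrictFDerivAt (x := z)
  have e : DZ (deriv F z) = ContinuousLinearMap.restrictScalars ℝ
      (ContinuousLinearMap.toSpanSingleton ℂ (deriv F z)) - (Complex.conjCLE : ℂ →L[ℝ] ℂ) := by
    refine ContinuousLinearMap.ext fun t => ?_
    simp [DZ_apply, mul_comm]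
  rw [e]
  exact h1

lemma Zp (h : Core L F c0) (z : ℂ) {l : ℂ} (hl : l ∈ L.lattice) : Zf F (z + l) = Zf F z :=
  h.Zper z hl

lemma Jp (h : Core L F c0) (z : ℂ) {l : ℂ} (hl : l ∈ L.lattice) : Jf F (z + l) = Jf F z := by
  unfold Jf; rw [h.dper z hl]

lemma ext_per (h : Core L F c0) {φ : ℂ → ℝ} {v : ℂ} {Y : ℂ → ℝ}
    (hY : ∀ z, ∀ l ∈ L.lattice, Y (z + l) = Y z) (z : ℂ) (l : ℂ) (hl : l ∈ L.lattice) :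
    ext L F φ v Y (z + l) = ext L F φ v Y z := by
  unfold ext
  rw [h.Zp z hl, hY z l hl]
  by_cases hz : z ∈ L.lattice
  · rw [if_pos hz, if_pos (add_mem hz hl)]
  · rw [if_neg hz, if_neg (by rwa [add_mem_iff hl])]

lemma ZcontDiff (h : Core L F c0) {z : ℂ} (hz : z ∉ L.lattice) : ContDiffAt ℝ 1 (Zf F) z := by
  have h1 : ContDiffAt ℝ 1 F z := (h.anal hz).contDiffAt.restrict_scalars ℝ
  exact h1.sub Complex.conjCLE.contDiff.contDiffAt

lemma dcontDiff (h : Core L F c0) {z : ℂ} (hz : z ∉ L.lattice) : ContDiffAt ℝ 1 (deriv F) z :=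
  (h.anal hz).deriv.contDiffAt.restrict_scalars ℝ

lemma JcontDiff (h : Core L F c0) {z : ℂ} (hz : z ∉ L.lattice) : ContDiffAt ℝ 1 (Jf F) z := by
  unfold Jf
  exact ((h.dcontDiff hz).norm_sq ℝ).sub contDiffAt_const

lemma ext_contDiff (h : Core L F c0) {φ : ℂ → ℝ} (hφ : ContDiff ℝ 1 φ) {R : ℝ}
    (hR : ∀ y, R < ‖y‖ → φ y = 0) (v u : ℂ) {Y : ℂ → ℝ}
    (hY : ∀ z, z ∉ L.lattice → ContDiffAt ℝ 1 Y z) :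
    ContDiff ℝ 1 (fun p : ℝ × ℂ => ext L F φ (v + p.1 • u) Y p.2) := by
  rw [contDiff_iff_contDiffAt]
  rintro ⟨t0, z0⟩
  by_cases hz : z0 ∈ L.lattice
  · obtain ⟨δ, hδ, hb⟩ := h.near_lat (R + ‖v‖ + (|t0| + 1) * ‖u‖)
    have : (fun p : ℝ × ℂ => ext L F φ (v + p.1 • u) Y p.2) =ᶠ[𝓝 (t0, z0)] fun _ => (0:ℝ) := by
      filter_upwards [prod_mem_nhds (ball_mem_nhds t0 one_pos) (ball_mem_nhds z0 hδ)]
      rintro ⟨t, z⟩ ⟨ht, hzz⟩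
      by_cases hzL : z ∈ L.lattice
      · exact ext_mem hzL
      · have hne : z ≠ z0 := fun e => hzL (e ▸ hz)
        have h1 := hb z z0 hz hne (by simpa [dist_eq_norm] using hzz)
        rw [ext_of hzL, hR, zero_mul]
        have ht' : |t| ≤ |t0| + 1 := by
          have : |t - t0| < 1 := by simpa [Real.dist_eq] using ht
          have h2 := abs_add_le (t - t0) t0
          rw [sub_add_cancel] at h2
          linarith
        have h3 : ‖v + t • u‖ ≤ ‖v‖ + (|t0| + 1) * ‖u‖ := by
          refine (norm_add_le _ _).trans ?_
          rw [norm_smul, Real.norm_eq_abs]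
          gcongr
        have h4 := norm_sub_norm_le (Zf F z) (v + t • u)
        unfold Zf at h4 ⊢
        linarith
    exact contDiffAt_const.congr_of_eventuallyEq this
  · have : (fun p : ℝ × ℂ => ext L F φ (v + p.1 • u) Y p.2) =ᶠ[𝓝 (t0, z0)]
        fun p => φ (Zf F p.2 - (v + p.1 • u)) * Y p.2 := by
      have h1 : ∀ᶠ p : ℝ × ℂ in 𝓝 (t0, z0), p.2 ∉ L.lattice :=
        continuous_snd.continuousAt.eventually (lat_nhds hz)
      filter_upwards [h1] with p hp using ext_of hp
    refine ContDiffAt.congr_of_eventuallyEq ?_ this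
    refine ContDiffAt.mul ?_ ?_
    · refine hφ.contDiffAt.comp (t0, z0) (ContDiffAt.sub ?_ (by fun_prop))
      exact (h.ZcontDiff hz).comp (t0, z0) contDiffAt_snd
    · exact (hY z0 hz).comp (t0, z0) contDiffAt_snd

lemma ext_contDiff' (h : Core L F c0) {φ : ℂ → ℝ} (hφ : ContDiff ℝ 1 φ) {R : ℝ}
    (hR : ∀ y, R < ‖y‖ → φ y = 0) (v : ℂ) {Y : ℂ → ℝ}
    (hY : ∀ z, z ∉ L.lattice → ContDiffAt ℝ 1 Y z) :
    ContDiff ℝ 1 (ext L F φ v Y) := by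
  have h1 := h.ext_contDiff hφ hR v 0 hY
  have h2 : ContDiff ℝ 1 (fun z : ℂ => ((0:ℝ), z)) := by fun_prop
  have h3 := h1.comp h2
  have e : ((fun p : ℝ × ℂ => ext L F φ (v + p.1 • (0:ℂ)) Y p.2) ∘ fun z => ((0:ℝ), z)) = ext L F φ v Y := by
    funext z
    simp
  rwa [e] at h3

lemma ext_fderiv (h : Core L F c0) {φ : ℂ → ℝ} (hφ : ContDiff ℝ 1 φ) (v : ℂ) {Y : ℂ → ℝ} {z : ℂ}
    (hz : z ∉ L.lattice) {Y' : ℂ →L[ℝ] ℝ} (hY : HasFDerivAt Y Y' z) (t : ℂ) :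
    fderiv ℝ (ext L F φ v Y) z t =
      φ (Zf F z - v) * Y' t + Y z * fderiv ℝ φ (Zf F z - v) (DZ (deriv F z) t) := by
  have h1 : ext L F φ v Y =ᶠ[𝓝 z] fun z => φ (Zf F z - v) * Y z := by
    filter_upwards [lat_nhds hz] with y hy using ext_of hy
  have h2 : HasFDerivAt (fun z => φ (Zf F z - v)) ((fderiv ℝ φ (Zf F z - v)).comp (DZ (deriv F z))) z := by
    have h3 := (h.Zstrict hz).hasFDerivAt.sub_const v
    exact ((hφ.differentiable one_ne_zero _).hasFDerivAt).comp z h3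
  have h3 : HasFDerivAt (fun z => φ (Zf F z - v) * Y z) _ z := h2.mul hY
  rw [h1.fderiv_eq, h3.fderiv]
  simp

lemma lat_null (L : PeriodPair) : ∀ᵐ z : ℂ, z ∉ L.lattice := by
  have : (L.lattice : Set ℂ).Countable :=
    countable_coe_iff.1 (L.latticeEquivProd.toEquiv.injective.countable)
  exact this.ae_notMem _

lemma deriv_zero (h : Core L F c0) {φ : ℂ → ℝ} (hφ : ContDiff ℝ 1 φ) {R : ℝ}
    (hR : ∀ y, R < ‖y‖ → φ y = 0) (v u : ℂ) :
    ∫ z in PD L, fderiv ℝ φ (Zf F z - v) u * Jf F z = 0 := by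
  let X0 : ℂ → ℂ := fun z => conj (deriv F z) * u + conj u
  have hX0 : ∀ z, z ∉ L.lattice → ContDiffAt ℝ 1 X0 z := fun z hz =>
    ((Complex.conjCLE.contDiff.contDiffAt.comp z (h.dcontDiff hz)).mul contDiffAt_const).add
      contDiffAt_const
  have hre : ∀ z, z ∉ L.lattice → ContDiffAt ℝ 1 (fun z => (X0 z).re) z := fun z hz =>
    Complex.reCLM.contDiff.contDiffAt.comp z (hX0 z hz)
  have him : ∀ z, z ∉ L.lattice → ContDiffAt ℝ 1 (fun z => (X0 z).im) z := fun z hz =>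
    Complex.imCLM.contDiff.contDiffAt.comp z (hX0 z hz)
  have hXp : ∀ z, ∀ l ∈ L.lattice, X0 (z + l) = X0 z := fun z l hl => by
    simp only [X0, h.dper z hl]
  have c1 := h.ext_contDiff' hφ hR v hre
  have c2 := h.ext_contDiff' hφ hR v him
  have i1 := int_deriv_zero c1 (h.ext_per fun z l hl => by simp only [hXp z l hl]) 1
  have i2 := int_deriv_zero c2 (h.ext_per fun z l hl => by simp only [hXp z l hl]) Complex.I
  have n1 : IntegrableOn (fun z => fderiv ℝ (ext L F φ v fun z => (X0 z).re) z 1) (PD L) :=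
    PD_int ((c1.continuous_fderiv one_ne_zero).clm_apply continuous_const)
  have n2 : IntegrableOn (fun z => fderiv ℝ (ext L F φ v fun z => (X0 z).im) z Complex.I) (PD L) :=
    PD_int ((c2.continuous_fderiv one_ne_zero).clm_apply continuous_const)
  have i3 := integral_add n1 n2
  rw [i1, i2, add_zero] at i3
  rw [← i3]
  refine setIntegral_congr_ae (PD_meas L) ?_
  filter_upwards [lat_null L] with z hz _
  have hdd : HasFDerivAt (deriv F) ((ContinuousLinearMap.mul ℝ ℂ) (deriv (deriv F) z)) z := by
    have := ((h.anal hz).deriv.differentiableAt.hasDerivAt).hasFDerivAt.restrictScalars ℝ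
    have e : (ContinuousLinearMap.mul ℝ ℂ) (deriv (deriv F) z) = ContinuousLinearMap.restrictScalars ℝ
        (ContinuousLinearMap.toSpanSingleton ℂ (deriv (deriv F) z)) := by
      refine ContinuousLinearMap.ext fun t => ?_
      simp [mul_comm]
    rw [e]
    exact this
  have hX' : HasFDerivAt X0 ((ContinuousLinearMap.mul ℝ ℂ u).comp
      ((Complex.conjCLE : ℂ →L[ℝ] ℂ).comp ((ContinuousLinearMap.mul ℝ ℂ) (deriv (deriv F) z)))) z := by
    have h1 := ((ContinuousLinearMap.mul ℝ ℂ u).hasFDerivAt (x := conj (deriv F z))).comp z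
      ((Complex.conjCLE : ℂ →L[ℝ] ℂ).hasFDerivAt (x := deriv F z) |>.comp z hdd)
    have h2 := h1.add_const (conj u)
    refine h2.congr_of_eventuallyEq (Eventually.of_forall fun y => ?_)
    simp [X0, mul_comm]
  have r1 := h.ext_fderiv hφ v hz ((Complex.reCLM.hasFDerivAt).comp z hX') 1
  have r2 := h.ext_fderiv hφ v hz ((Complex.imCLM.hasFDerivAt).comp z hX') Complex.I
  have e1 : (Complex.reCLM ∘ X0) = fun z => (X0 z).re := rfl
  have e2 : (Complex.imCLM ∘ X0) = fun z => (X0 z).im := rfl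
  rw [e1] at r1
  rw [e2] at r2
  rw [r1, r2]
  have key : (X0 z).re • DZ (deriv F z) 1 + (X0 z).im • DZ (deriv F z) Complex.I = (Jf F z) • u := by
    rw [← map_smul, ← map_smul, ← map_add]
    have : (X0 z).re • (1:ℂ) + (X0 z).im • Complex.I = X0 z := by
      simp [Complex.re_add_im]
    rw [this]
    exact DZ_sol _ _
  have key2 := congrArg (fderiv ℝ φ (Zf F z - v)) key
  rw [map_add, map_smul, map_smul, map_smul] at key2
  simp only [smul_eq_mul] at key2
  have key3 : Complex.reCLM ((ContinuousLinearMap.mul ℝ ℂ u).comp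
      ((Complex.conjCLE : ℂ →L[ℝ] ℂ).comp ((ContinuousLinearMap.mul ℝ ℂ) (deriv (deriv F) z))) 1) +
      Complex.imCLM ((ContinuousLinearMap.mul ℝ ℂ u).comp
      ((Complex.conjCLE : ℂ →L[ℝ] ℂ).comp ((ContinuousLinearMap.mul ℝ ℂ) (deriv (deriv F) z))) Complex.I) = 0 := by
    simp
  simp only [ContinuousLinearMap.comp_apply] at key3 ⊢
  linear_combination -key2 - φ (Zf F z - v) * key3

lemma I_const (h : Core L F c0) {φ : ℂ → ℝ} (hφ : ContDiff ℝ 1 φ) {R : ℝ}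
    (hR : ∀ y, R < ‖y‖ → φ y = 0) (v v' : ℂ) :
    ∫ z in PD L, ext L F φ v (Jf F) z = ∫ z in PD L, ext L F φ v' (Jf F) z := by
  set u := v' - v with hu
  have hc := h.ext_contDiff hφ hR v u (fun z hz => h.JcontDiff hz)
  have hd : ∀ t : ℝ, HasDerivAt (fun t : ℝ => ∫ z in PD L, ext L F φ (v + t • u) (Jf F) z) 0 t := by
    intro t
    have h1 := dui (L := L) hc t
    suffices hs : (0:ℝ) = ∫ (z : ℂ) in PD L,
        (fderiv ℝ (fun p : ℝ × ℂ => ext L F φ (v + p.1 • u) (Jf F) p.2) (t, z)) (1, 0) by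
      rw [hs]; exact h1
    have h2 := h.deriv_zero hφ hR (v + t • u) u
    have h3 : (0:ℝ) = - ∫ z in PD L, fderiv ℝ φ (Zf F z - (v + t • u)) u * Jf F z := by rw [h2, neg_zero]
    rw [h3, ← integral_neg]
    refine setIntegral_congr_ae (PD_meas L) ?_
    filter_upwards [lat_null L] with z hz _
    have hd1 : HasDerivAt (fun t : ℝ => ext L F φ (v + t • u) (Jf F) z)
        (fderiv ℝ (fun p : ℝ × ℂ => ext L F φ (v + p.1 • u) (Jf F) p.2) (t, z) (1, 0)) t := by
      have h1 := (hc.differentiable one_ne_zero (t, z)).hasFDerivAt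
      have h2 : HasDerivAt (fun t : ℝ => (t, z)) ((1:ℝ), (0:ℂ)) t :=
        (hasDerivAt_id t).prodMk (hasDerivAt_const t z)
      exact h1.comp_hasDerivAt t h2
    have hd2 : HasDerivAt (fun t : ℝ => ext L F φ (v + t • u) (Jf F) z)
        (-(fderiv ℝ φ (Zf F z - (v + t • u)) u * Jf F z)) t := by
      have e : (fun t : ℝ => ext L F φ (v + t • u) (Jf F) z) =
          fun t : ℝ => φ (Zf F z - (v + t • u)) * Jf F z := by
        funext t; exact ext_of hz
      rw [e]
      have g1 : HasDerivAt (fun t : ℝ => Zf F z - (v + t • u)) (-u) t := by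
        have := (((hasDerivAt_id t).smul_const u).const_add v).const_sub (Zf F z)
        simpa using this
      have g2 := ((hφ.differentiable one_ne_zero (Zf F z - (v + t • u))).hasFDerivAt).comp_hasDerivAt t g1
      have g3 := g2.mul_const (Jf F z)
      simpa using g3
    exact hd2.unique hd1
  have hh := is_const_of_deriv_eq_zero (fun t => (hd t).differentiableAt) (fun t => (hd t).deriv) 0 1
  simpa [hu] using hh

end Core
end HZ

namespace HZ
open ComplexConjugate MeasureTheory

variable {L : PeriodPair} {F : ℂ → ℂ} {c0 : ℂ}

namespace Core

lemma area (h : Core L F c0) {φ : ℂ → ℝ} (hφ0 : ∀ y, 0 ≤ φ y) (v : ℂ) {S : Set ℂ} (hS : MeasurableSet S)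
    (hSL : ∀ z ∈ S, z ∉ L.lattice) (hi : InjOn (Zf F) S) :
    ∫ z in S, |ext L F φ v (Jf F) z| = ∫ y in Zf F '' S, φ (y - v) := by
  rw [integral_image_eq_integral_abs_det_fderiv_smul volume hS
    (fun z hz => (h.Zstrict (hSL z hz)).hasFDerivAt.hasFDerivWithinAt) hi]
  refine setIntegral_congr_fun hS fun z hz => ?_
  simp only [ext_of (hSL z hz), DZ_det, smul_eq_mul, abs_mul, Jf]
  rw [abs_of_nonneg (hφ0 _), mul_comm]

lemma area_le (h : Core L F c0) {φ : ℂ → ℝ} (hφ0 : ∀ y, 0 ≤ φ y) (hφi : Integrable φ) (v : ℂ) {S : Set ℂ}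
    (hS : MeasurableSet S)
    (hSL : ∀ z ∈ S, z ∉ L.lattice) (hi : InjOn (Zf F) S) :
    ∫ z in S, |ext L F φ v (Jf F) z| ≤ ∫ y, φ y := by
  rw [h.area hφ0 v hS hSL hi, ← integral_sub_right_eq_self φ v]
  exact setIntegral_le_integral (hφi.comp_sub_right v) (Eventually.of_forall fun y => hφ0 _)

lemma area_eq (h : Core L F c0) {φ : ℂ → ℝ} (hφ0 : ∀ y, 0 ≤ φ y) (v : ℂ) {S : Set ℂ}
    (hS : MeasurableSet S)
    (hSL : ∀ z ∈ S, z ∉ L.lattice) (hi : InjOn (Zf F) S)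
    (hc : ∀ y, y ∉ Zf F '' S → φ (y - v) = 0) :
    ∫ z in S, |ext L F φ v (Jf F) z| = ∫ y, φ y := by
  rw [h.area hφ0 v hS hSL hi, ← integral_sub_right_eq_self φ v]
  exact setIntegral_eq_integral_of_forall_compl_eq_zero fun y hy => hc y hy

lemma pole_inj (h : Core L F c0) : ∃ δ > 0, ∀ z z' : ℂ, z ≠ 0 → z' ≠ 0 → ‖z‖ < δ → ‖z'‖ < δ →
    Zf F z = Zf F z' → z = z' := by
  obtain ⟨κ, hκ, H, hH, hF⟩ := h.pole
  obtain ⟨K, s, hs, hK⟩ := (hH.contDiffAt (n := 1)).exists_lipschitzOnWith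
  obtain ⟨δ1, hδ1, hb1⟩ := Metric.mem_nhds_iff.1 hs
  rw [eventually_nhdsWithin_iff] at hF
  obtain ⟨δ2, hδ2, hb2⟩ := Metric.mem_nhds_iff.1 hF
  have hκ0 : 0 < ‖κ‖ := norm_pos_iff.2 hκ
  obtain ⟨δ3, hδ3, hb3⟩ : ∃ δ3 > 0, δ3 ^ 2 * ((K:ℝ) + 1) < ‖κ‖ := by
    have : Tendsto (fun d : ℝ => d ^ 2 * ((K:ℝ) + 1)) (𝓝[>] 0) (𝓝 0) := by
      have : Tendsto (fun d : ℝ => d ^ 2 * ((K:ℝ) + 1)) (𝓝 0) (𝓝 (0 ^ 2 * ((K:ℝ) + 1))) :=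
        (by fun_prop : Continuous fun d : ℝ => d ^ 2 * ((K:ℝ) + 1)).tendsto 0
      simpa using this.mono_left nhdsWithin_le_nhds
    obtain ⟨d, hd1, hd2⟩ := ((this.eventually (gt_mem_nhds hκ0)).and self_mem_nhdsWithin).exists
    exact ⟨d, hd2, hd1⟩
  refine ⟨min δ1 (min δ2 δ3), by positivity, fun z z' hz hz' hzd hzd' he => ?_⟩
  simp only [lt_min_iff] at hzd hzd'
  have e1 : F z = κ / z + H z := hb2 (by simpa using hzd.2.1) hz
  have e2 : F z' = κ / z' + H z' := hb2 (by simpa using hzd'.2.1) hz'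
  have l1 := hK.norm_sub_le (hb1 (by simpa using hzd.1)) (hb1 (by simpa using hzd'.1) : z' ∈ s)
  by_contra hne
  have hpos : 0 < ‖z - z'‖ := norm_pos_iff.2 (sub_ne_zero.2 hne)
  unfold Zf at he
  have e3 : κ * (z - z') = z * z' * ((H z - H z') - conj (z - z')) := by
    rw [e1, e2] at he
    field_simp at he
    rw [map_sub]
    linear_combination (-1) * he
  have e4 := congrArg norm e3
  rw [norm_mul, norm_mul, norm_mul] at e4
  have e5 : ‖H z - H z' - conj (z - z')‖ ≤ (K + 1) * ‖z - z'‖ := by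
    refine (norm_sub_le _ _).trans ?_
    rw [Complex.norm_conj]
    linarith
  have e6 : ‖z‖ * ‖z'‖ ≤ δ3 ^ 2 := by
    rw [sq]; exact mul_le_mul hzd.2.2.le hzd'.2.2.le (norm_nonneg _) hδ3.le
  have e7 : ‖z‖ * ‖z'‖ * ‖H z - H z' - conj (z - z')‖ ≤ δ3 ^ 2 * ((K + 1) * ‖z - z'‖) :=
    mul_le_mul e6 e5 (norm_nonneg _) (by positivity)
  have e8 : δ3 ^ 2 * (K + 1) * ‖z - z'‖ < ‖κ‖ * ‖z - z'‖ := mul_lt_mul_of_pos_right hb3 hpos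
  nlinarith

lemma I_le (h : Core L F c0) {φ : ℂ → ℝ} (hφ0 : ∀ y, 0 ≤ φ y) (hφ : ContDiff ℝ 1 φ) (hφi : Integrable φ) {R : ℝ}
    (hR : ∀ y, R < ‖y‖ → φ y = 0) (v : ℂ) :
    ∫ z in PD L, ext L F φ v (Jf F) z ≤ ∫ y, φ y := by
  obtain ⟨δ, hδ, hinj⟩ := h.pole_inj
  obtain ⟨M, hM⟩ := h.bdd hδ
  obtain ⟨m, hm⟩ := exists_nat_gt (M + R)
  let v1 : ℂ := m
  have hv1 : ‖v1‖ = m := by simp [v1]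
  rw [h.I_const hφ hR v v1]
  let E : Set ℂ := (PD L ∩ (L.lattice : Set ℂ)ᶜ) ∩ ⋃ l ∈ (L.lattice : Set ℂ), ball l δ
  have hE : MeasurableSet E := ((PD_meas L).inter L.isClosed_lattice.measurableSet.compl).inter
    (isOpen_biUnion fun _ _ => isOpen_ball).measurableSet
  have hEL : ∀ z ∈ E, z ∉ L.lattice := fun z hz => hz.1.2
  have hEi : InjOn (Zf F) E := by
    rintro z ⟨⟨hz, hzL⟩, hzU⟩ z' ⟨⟨hz', hzL'⟩, hzU'⟩ he
    simp only [mem_iUnion, mem_ball, exists_prop, dist_eq_norm] at hzU hzU'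
    obtain ⟨l, hl, hzl⟩ := hzU
    obtain ⟨l', hl', hzl'⟩ := hzU'
    have e := hinj (z - l) (z' - l') (fun e => hzL (by rw [sub_eq_zero.1 e]; exact hl))
      (fun e => hzL' (by rw [sub_eq_zero.1 e]; exact hl')) hzl hzl' (by
        rw [sub_eq_add_neg, sub_eq_add_neg, h.Zp _ (neg_mem hl), h.Zp _ (neg_mem hl'), he])
    refine PD_unique hz hz' ?_
    have : z - z' = l - l' := by linear_combination e
    rw [this]
    exact sub_mem hl hl'
  have hcont := h.ext_contDiff' hφ hR v1 (fun z hz => h.JcontDiff hz)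
  have hint : IntegrableOn (ext L F φ v1 (Jf F)) (PD L) := PD_int hcont.continuous
  have hsub : E ⊆ PD L := fun z hz => hz.1.1
  calc ∫ z in PD L, ext L F φ v1 (Jf F) z = ∫ z in E, ext L F φ v1 (Jf F) z := by
        refine setIntegral_eq_of_subset_of_forall_sdiff_eq_zero (PD_meas L) hsub ?_
        rintro z ⟨hz, hzE⟩
        by_cases hzL : z ∈ L.lattice
        · exact ext_mem hzL
        · have h1 : ∀ l ∈ L.lattice, δ ≤ ‖z - l‖ := by
            intro l hl
            by_contra! hlt
            exact hzE ⟨⟨hz, hzL⟩, mem_biUnion hl (by simpa [dist_eq_norm] using hlt)⟩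
          have h2 := hM z h1
          rw [ext_of hzL, hR, zero_mul]
          have h3 := norm_sub_norm_le v1 (Zf F z)
          rw [norm_sub_rev] at h3
          unfold Zf at *
          linarith
    _ ≤ ∫ z in E, |ext L F φ v1 (Jf F) z| :=
        setIntegral_mono_on (hint.mono_set hsub) (hint.mono_set hsub).abs hE (fun z _ => le_abs_self _)
    _ ≤ _ := h.area_le hφ0 hφi v1 hE hEL hEi

lemma F_lat (h : Core L F c0) {l : ℂ} (hl : l ∈ L.lattice) : F l = conj l := by
  have h0 : F 0 = 0 := by
    have := h.odd 0
    rw [neg_zero] at this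
    linear_combination (1/2) * this
  have := h.per 0 l hl
  rwa [zero_add, h0, zero_add] at this

lemma F_meas (h : Core L F c0) : Measurable F := by
  classical
  have e : F = (L.lattice : Set ℂ).piecewise conj F := by
    funext z
    by_cases hz : z ∈ L.lattice
    · rw [Set.piecewise_eq_of_mem _ _ _ hz, h.F_lat hz]
    · rw [Set.piecewise_eq_of_notMem _ _ _ hz]
  rw [e]
  refine ContinuousOn.measurable_piecewise Complex.continuous_conj.continuousOn ?_
    L.isClosed_lattice.measurableSet
  exact fun z hz => (h.diff z hz).continuousAt.continuousWithinAt

def Aset (L : PeriodPair) (F : ℂ → ℂ) (ε : ℂ) : Set ℂ :=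
  {z | (z ∈ PD L ∧ z ∉ L.lattice ∧ ‖deriv F z‖ < 1) ∧
    ∀ k : ℕ, ∃ N : ℕ, ∀ n ≥ N, infDist ((gm F (Zf F z))^[n] ε - z) (L.lattice : Set ℂ) < 1 / ((k:ℝ) + 1)}

lemma iter_meas (h : Core L F c0) (ε : ℂ) (n : ℕ) : Measurable fun z => (gm F (Zf F z))^[n] ε := by
  induction n with
  | zero => exact measurable_const
  | succ n ih =>
    simp only [Function.iterate_succ_apply']
    unfold gm
    have hZ : Measurable (Zf F) := h.F_meas.sub Complex.continuous_conj.measurable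
    exact Complex.continuous_conj.measurable.comp ((h.F_meas.comp ih).sub hZ)

lemma Aset_meas (h : Core L F c0) (ε : ℂ) : MeasurableSet (Aset L F ε) := by
  have h1 : MeasurableSet {z | z ∈ PD L ∧ z ∉ L.lattice ∧ ‖deriv F z‖ < 1} :=
    (PD_meas L).inter (L.isClosed_lattice.measurableSet.compl.inter
      (measurableSet_lt (measurable_deriv F).norm measurable_const))
  have h2 : ∀ (n k : ℕ), MeasurableSet {z | infDist ((gm F (Zf F z))^[n] ε - z) (L.lattice : Set ℂ) < 1 / ((k:ℝ) + 1)} :=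
    fun n k => measurableSet_lt (((h.iter_meas ε n).sub measurable_id).infDist) measurable_const
  have h3 : Aset L F ε = {z | z ∈ PD L ∧ z ∉ L.lattice ∧ ‖deriv F z‖ < 1} ∩
      ⋂ k : ℕ, ⋃ N : ℕ, ⋂ n : ℕ, ⋂ _ : n ≥ N,
        {z | infDist ((gm F (Zf F z))^[n] ε - z) (L.lattice : Set ℂ) < 1 / ((k:ℝ) + 1)} := by
    ext z
    simp only [Aset, mem_ofPred_eq, mem_inter_iff, mem_iInter, mem_iUnion]
  rw [h3]
  exact h1.inter (MeasurableSet.iInter fun k => MeasurableSet.iUnion fun N => MeasurableSet.iInter fun n =>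
    MeasurableSet.iInter fun _ => h2 n k)

lemma lat_ne (L : PeriodPair) : (L.lattice : Set ℂ).Nonempty := ⟨0, L.lattice.zero_mem⟩

lemma Aset_inj (ε : ℂ) : InjOn (Zf F) (Aset L F ε) := by
  rintro z ⟨⟨hz, -, -⟩, hzA⟩ z' ⟨⟨hz', -, -⟩, hzA'⟩ he
  refine PD_unique hz hz' ?_
  have : z - z' ∈ closure (L.lattice : Set ℂ) := by
    rw [Metric.mem_closure_iff]
    intro δ hδ
    obtain ⟨k, hk⟩ := exists_nat_one_div_lt (half_pos hδ)
    obtain ⟨N, hN⟩ := hzA k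
    obtain ⟨N', hN'⟩ := hzA' k
    obtain ⟨l, hl, h1⟩ := (infDist_lt_iff (lat_ne L)).1 ((hN (max N N') (le_max_left _ _)).trans hk)
    obtain ⟨l', hl', h2⟩ := (infDist_lt_iff (lat_ne L)).1 ((hN' (max N N') (le_max_right _ _)).trans hk)
    refine ⟨l' - l, sub_mem hl' hl, ?_⟩
    rw [he] at h1
    rw [dist_eq_norm] at *
    set w := (gm F (Zf F z'))^[max N N'] ε
    calc ‖z - z' - (l' - l)‖ = ‖(w - z' - l') - (w - z - l)‖ := by congr 1; ring
      _ ≤ _ := norm_sub_le _ _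
      _ < δ := by linarith
  rwa [L.isClosed_lattice.closure_eq] at this

lemma Aset_cov (h : Core L F c0) {z : ℂ} (hz : z ∈ PD L) (hzL : z ∉ L.lattice) (hd : ‖deriv F z‖ < 1) :
    z ∈ Aset L F c0 ∨ z ∈ Aset L F (-c0) := by
  obtain ⟨ε, hε, hc⟩ := h.fatou (v := Zf F z) hzL rfl hd
  have : z ∈ Aset L F ε := by
    refine ⟨⟨hz, hzL, hd⟩, fun k => ?_⟩
    obtain ⟨N, hN⟩ := hc (1 / ((k:ℝ) + 1)) (by positivity)
    refine ⟨N, fun n hn => ?_⟩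
    obtain ⟨l, hl, h1⟩ := hN n hn
    refine (infDist_lt_iff (lat_ne L)).2 ⟨l, hl, ?_⟩
    rwa [dist_eq_norm, sub_sub]
  rcases hε with rfl | rfl
  · exact Or.inl this
  · exact Or.inr this

lemma local_Z (h : Core L F c0) {z0 : ℂ} (hz : z0 ∉ L.lattice) (hd : 1 < ‖deriv F z0‖) {U : Set ℂ} (hU : U ∈ 𝓝 z0) :
    ∃ S ⊆ U, IsOpen S ∧ z0 ∈ S ∧ (∀ y ∈ S, y ∉ L.lattice ∧ 1 < ‖deriv F y‖) ∧ InjOn (Zf F) S ∧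
      Zf F '' S ∈ 𝓝 (Zf F z0) := by
  have hdet : (DZ (deriv F z0)).det ≠ 0 := by
    rw [DZ_det]; nlinarith
  have hs := h.Zstrict hz
  rw [← ContinuousLinearMap.coe_toContinuousLinearEquivOfDetNeZero (DZ (deriv F z0)) hdet] at hs
  let ψ := hs.toOpenPartialHomeomorph (Zf F)
  have hψ : (ψ : ℂ → ℂ) = Zf F := hs.toOpenPartialHomeomorph_coe
  have hsrc : z0 ∈ ψ.source := hs.mem_toOpenPartialHomeomorph_source
  have hcd : ContinuousAt (deriv F) z0 := (h.anal hz).deriv.continuousAt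
  have hev : ∀ᶠ y in 𝓝 z0, y ∉ L.lattice ∧ 1 < ‖deriv F y‖ :=
    (lat_nhds hz).and (hcd.norm.eventually (lt_mem_nhds hd))
  have hU' := Filter.inter_mem hU hev
  refine ⟨ψ.source ∩ interior (U ∩ {y | y ∉ L.lattice ∧ 1 < ‖deriv F y‖}), ?_, ?_, ?_, ?_, ?_, ?_⟩
  · exact fun y hy => (interior_subset hy.2).1
  · exact ψ.open_source.inter isOpen_interior
  · exact ⟨hsrc, mem_interior_iff_mem_nhds.2 hU'⟩
  · exact fun y hy => (interior_subset hy.2).2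
  · rw [← hψ]
    exact ψ.injOn.mono inter_subset_left
  · rw [← hψ]
    exact (ψ.isOpen_image_of_subset_source (ψ.open_source.inter isOpen_interior) inter_subset_left).mem_nhds
      ⟨z0, ⟨hsrc, mem_interior_iff_mem_nhds.2 hU'⟩, rfl⟩

end Core
end HZ

namespace HZ
open ComplexConjugate MeasureTheory

variable {L : PeriodPair} {F : ℂ → ℂ} {c0 : ℂ}

namespace Core

lemma sep_nhds {L : PeriodPair} {a b : ℂ} (hab : a - b ∉ L.lattice) :
    ∀ᶠ ρ in 𝓝[>] (0:ℝ), ∀ x ∈ ball a ρ, ∀ y ∈ ball b ρ, x - y ∉ L.lattice := by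
  obtain ⟨r, hr, hb⟩ := Metric.mem_nhds_iff.1 (lat_nhds hab)
  have h1 : ∀ᶠ ρ in 𝓝[>] (0:ℝ), ρ < r / 2 := nhdsWithin_le_nhds (gt_mem_nhds (half_pos hr))
  filter_upwards [h1] with ρ hρ x hx y hy
  refine hb ?_
  rw [mem_ball, dist_eq_norm] at *
  calc ‖x - y - (a - b)‖ = ‖(x - a) - (y - b)‖ := by congr 1; ring
    _ ≤ _ := norm_sub_le _ _
    _ < r := by linarith

theorem count (h : Core L F c0) (v : ℂ) (z : Fin 4 → ℂ) (hz : ∀ i, z i ∉ L.lattice)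
    (hne : ∀ i j, i ≠ j → z i - z j ∉ L.lattice) (hv : ∀ i, Zf F (z i) = v)
    (hd : ∀ i, 1 < ‖deriv F (z i)‖) : False := by
  classical
  obtain ⟨ρ, hρsep, hρ⟩ : ∃ ρ : ℝ, (∀ i j, i ≠ j → ∀ x ∈ ball (z i) ρ, ∀ y ∈ ball (z j) ρ, x - y ∉ L.lattice) ∧
      0 < ρ := by
    have h1 : ∀ᶠ ρ in 𝓝[>] (0:ℝ), ∀ i j, i ≠ j → ∀ x ∈ ball (z i) ρ, ∀ y ∈ ball (z j) ρ, x - y ∉ L.lattice := by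
      rw [eventually_all]; intro i
      rw [eventually_all]; intro j
      by_cases hij : i = j
      · exact Eventually.of_forall fun _ hn => absurd hij hn
      · filter_upwards [sep_nhds (hne i j hij)] with ρ h2 _ using h2
    exact (h1.and self_mem_nhdsWithin).exists
  choose S hSU hSo hSz hSd hSi hSn using fun i => h.local_Z (hz i) (hd i) (ball_mem_nhds (z i) hρ)
  have hev : ∀ᶠ y in 𝓝 v, ∀ i, y ∈ Zf F '' S i := by
    rw [eventually_all]; intro i
    have := hSn i
    rwa [hv i] at this
  obtain ⟨r, hr, hrb⟩ := Metric.mem_nhds_iff.1 hev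
  let φ : ContDiffBump (0:ℂ) := ⟨r / 2, r, by positivity, by linarith⟩
  have hφ0 : ∀ y, 0 ≤ φ y := fun y => φ.nonneg
  have hφ : ContDiff ℝ 1 φ := φ.contDiff
  have hφi : Integrable φ := φ.integrable
  have hφz : ∀ y, r ≤ ‖y‖ → φ y = 0 := fun y hy => φ.zero_of_le_dist (by simpa using hy)
  have hR : ∀ y, r < ‖y‖ → φ y = 0 := fun y hy => hφz y hy.le
  have hpos : 0 < ∫ y, φ y := φ.integral_pos
  have hle := h.I_le hφ0 hφ hφi hR v
  set G : ℂ → ℝ := ext L F φ v (Jf F) with hG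
  have hcont : Continuous G := (h.ext_contDiff' hφ hR v (fun z hz => h.JcontDiff hz)).continuous
  have hint : IntegrableOn G (PD L) := PD_int hcont
  let E : Fin 4 → Set ℂ := fun i => PD L ∩ ⋃ l ∈ (L.lattice : Set ℂ), (fun y => y + l) ⁻¹' S i
  have hEm : ∀ i, MeasurableSet (E i) := fun i => (PD_meas L).inter
    (isOpen_biUnion fun l _ => (hSo i).preimage (by fun_prop)).measurableSet
  have hEmem : ∀ i y, y ∈ E i ↔ y ∈ PD L ∧ ∃ l ∈ L.lattice, y + l ∈ S i := by
    intro i y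
    simp only [E, mem_inter_iff, mem_iUnion, mem_preimage, exists_prop, SetLike.mem_coe]
  have hEL : ∀ i, ∀ y ∈ E i, y ∉ L.lattice ∧ 1 < ‖deriv F y‖ := by
    intro i y hy
    obtain ⟨_, l, hl, hyl⟩ := (hEmem i y).1 hy
    have := hSd i _ hyl
    rwa [add_mem_iff hl, h.dper y hl] at this
  have hEi : ∀ i, InjOn (Zf F) (E i) := by
    intro i y hy y' hy' he
    obtain ⟨hp, l, hl, hyl⟩ := (hEmem i y).1 hy
    obtain ⟨hp', l', hl', hyl'⟩ := (hEmem i y').1 hy'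
    have e := hSi i hyl hyl' (by rw [h.Zp _ hl, h.Zp _ hl', he])
    refine PD_unique hp hp' ?_
    have : y - y' = l' - l := by linear_combination e
    rw [this]; exact sub_mem hl' hl
  have hEd : ∀ i j y, y ∈ E i → y ∈ E j → i = j := by
    intro i j y hy hy'
    by_contra hij
    obtain ⟨hp, l, hl, hyl⟩ := (hEmem i y).1 hy
    obtain ⟨hp', l', hl', hyl'⟩ := (hEmem j y).1 hy'
    refine hρsep i j hij _ (hSU i hyl) _ (hSU j hyl') ?_
    rw [add_sub_add_left_eq_sub]
    exact sub_mem hl hl'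
  have hEa : ∀ i, ∫ y in E i, |G y| = ∫ y, φ y := by
    intro i
    refine h.area_eq hφ0 v (hEm i) (fun y hy => (hEL i y hy).1) (hEi i) fun y hy => ?_
    refine hφz _ ?_
    by_contra! hlt
    refine hy ?_
    obtain ⟨x, hx, hxy⟩ := hrb (by simpa [dist_eq_norm] using hlt : y ∈ ball v r) i
    obtain ⟨l, hl, hxl⟩ := PD_exists L x
    exact ⟨x + l, (hEmem i _).2 ⟨hxl, -l, neg_mem hl, by simpa using hx⟩, by rw [h.Zp x hl, hxy]⟩
  have hA : ∀ ε, ∫ y in Aset L F ε, |G y| ≤ ∫ y, φ y := fun ε =>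
    h.area_le hφ0 hφi v (h.Aset_meas ε) (fun y hy => hy.1.2.1) (Aset_inj ε)
  have hAsub : ∀ ε, Aset L F ε ⊆ PD L := fun ε y hy => hy.1.1
  have hEsub : ∀ i, E i ⊆ PD L := fun i y hy => hy.1
  have conv : ∀ T : Set ℂ, MeasurableSet T → T ⊆ PD L →
      (IntegrableOn (T.indicator fun y => |G y|) (PD L) ∧
      ∫ y in PD L, T.indicator (fun y => |G y|) y = ∫ y in T, |G y|) := by
    intro T hT hs
    refine ⟨hint.abs.indicator hT, ?_⟩
    rw [setIntegral_indicator hT, inter_eq_self_of_subset_right hs]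
  have hmain : ∫ y in PD L, (∑ i, (E i).indicator (fun y => |G y|) y -
      ((Aset L F c0).indicator (fun y => |G y|) y + (Aset L F (-c0)).indicator (fun y => |G y|) y)) ≤
      ∫ y in PD L, G y := by
    have hi1 : IntegrableOn (fun y => ∑ i, (E i).indicator (fun y => |G y|) y) (PD L) :=
      integrable_finsetSum _ fun i _ => (conv (E i) (hEm i) (hEsub i)).1
    refine setIntegral_mono_on (hi1.sub (((conv _ (h.Aset_meas c0) (hAsub _)).1).add
      ((conv _ (h.Aset_meas (-c0)) (hAsub _)).1))) hint (PD_meas L) fun y hy => ?_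
    have p1 : 0 ≤ (Aset L F c0).indicator (fun y => |G y|) y := indicator_nonneg (fun _ _ => abs_nonneg _) _
    have p2 : 0 ≤ (Aset L F (-c0)).indicator (fun y => |G y|) y := indicator_nonneg (fun _ _ => abs_nonneg _) _
    by_cases hyL : y ∈ L.lattice
    · have hg : |G y| = 0 := by rw [hG, ext_mem hyL, abs_zero]
      have : ∀ T : Set ℂ, T.indicator (fun y => |G y|) y = 0 := by
        intro T
        rw [indicator_apply, hg, ite_self]
      simp only [this]
      rw [hG, ext_mem hyL]
      simp
    by_cases hE : ∃ i, y ∈ E i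
    · obtain ⟨i, hi⟩ := hE
      have hs : ∑ i, (E i).indicator (fun y => |G y|) y = |G y| := by
        rw [Finset.sum_eq_single i]
        · exact indicator_of_mem hi _
        · intro j _ hj
          exact indicator_of_notMem (fun hj' => hj (hEd j i y hj' hi)) _
        · simp
      have hG0 : 0 ≤ G y := by
        rw [hG, ext_of hyL]
        refine mul_nonneg (hφ0 _) ?_
        unfold Jf
        nlinarith [(hEL i y hi).2]
      rw [hs, abs_of_nonneg hG0]
      linarith
    · push Not at hE
      have hs : ∑ i, (E i).indicator (fun y => |G y|) y = 0 :=
        Finset.sum_eq_zero fun i _ => indicator_of_notMem (hE i) _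
      rw [hs]
      by_cases hJ : ‖deriv F y‖ < 1
      · rcases h.Aset_cov hy hyL hJ with hc | hc
        · rw [indicator_of_mem hc]
          have := neg_abs_le (G y)
          linarith
        · rw [indicator_of_mem hc (fun y => |G y|)]
          have := neg_abs_le (G y)
          linarith
      · have hG0 : 0 ≤ G y := by
          rw [hG, ext_of hyL]
          refine mul_nonneg (hφ0 _) ?_
          unfold Jf
          nlinarith
        linarith
  have hAi : IntegrableOn (fun y => (Aset L F c0).indicator (fun y => |G y|) y +
      (Aset L F (-c0)).indicator (fun y => |G y|) y) (PD L) :=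
    ((conv _ (h.Aset_meas c0) (hAsub _)).1).add ((conv _ (h.Aset_meas (-c0)) (hAsub _)).1)
  rw [integral_sub (integrable_finsetSum _ fun i _ => (conv (E i) (hEm i) (hEsub i)).1) hAi,
    integral_add (conv _ (h.Aset_meas c0) (hAsub _)).1 (conv _ (h.Aset_meas (-c0)) (hAsub _)).1,
    integral_finsetSum _ fun i _ => (conv (E i) (hEm i) (hEsub i)).1,
    (conv _ (h.Aset_meas c0) (hAsub _)).2, (conv _ (h.Aset_meas (-c0)) (hAsub _)).2] at hmain
  have hs : ∑ i, ∫ y in PD L, (E i).indicator (fun y => |G y|) y = 4 * ∫ y, φ y := by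
    rw [Finset.sum_congr rfl fun i _ => ((conv (E i) (hEm i) (hEsub i)).2.trans (hEa i))]
    simp
  rw [hs] at hmain
  have := hA c0
  have := hA (-c0)
  linarith

end Core
end HZ

namespace HZ
open ComplexConjugate MeasureTheory

variable {L : PeriodPair} {F : ℂ → ℂ} {c0 : ℂ}

namespace Core

lemma Zodd (h : Core L F c0) (z : ℂ) : Zf F (-z) = - Zf F z := by
  unfold Zf; rw [h.odd, map_neg]; ring

lemma Zhalf (h : Core L F c0) {q : ℂ} (hq : 2 * q ∈ L.lattice) : Zf F q = 0 := by
  have h1 := h.Zp (-q) hq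
  rw [show -q + 2 * q = q by ring, h.Zodd] at h1
  linear_combination (1/2) * h1

lemma lat_compl_conn (L : PeriodPair) : IsPreconnected ((L.lattice : Set ℂ)ᶜ) := by
  have hc : (L.lattice : Set ℂ).Countable :=
    countable_coe_iff.1 (L.latticeEquivProd.toEquiv.injective.countable)
  exact (hc.isConnected_compl_of_one_lt_rank (by
    rw [Complex.rank_real_complex]; exact Nat.one_lt_ofNat)).isPreconnected

lemma dopen (h : Core L F c0) {x : ℂ} (hx : x ∉ L.lattice) :
    𝓝 (deriv F x) ≤ map (deriv F) (𝓝 x) := by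
  rcases (h.anal hx).deriv.eventually_constant_or_nhds_le_map_nhds with hc | hc
  · exfalso
    set a := deriv F x
    have han : AnalyticOnNhd ℂ (deriv F) (L.lattice : Set ℂ)ᶜ := fun y hy => (h.anal hy).deriv
    have hall := han.eqOn_of_preconnected_of_eventuallyEq (g := fun _ => a) analyticOnNhd_const
      (lat_compl_conn L) hx hc
    have hd0 : ∀ y, y ∉ L.lattice → HasDerivAt (fun y => F y - a * y) 0 y := by
      intro y hy
      have h1 := (h.hd hy).sub ((hasDerivAt_id y).const_mul a)
      rw [hall hy] at h1
      have e : a - a * 1 = 0 := by ring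
      rw [e] at h1
      exact h1
    have hk : ∀ y, y ∉ L.lattice → F y - a * y = F x - a * x := fun y hy => L.isClosed_lattice.isOpen_compl.is_const_of_deriv_eq_zero (lat_compl_conn L)
      (fun y hy => (hd0 y hy).differentiableAt.differentiableWithinAt)
      (fun y hy => (hd0 y hy).deriv) (f := fun y => F y - a * y) hy hx
    set k := F x - a * x with hkdef
    obtain ⟨δ, hδ, hb⟩ := h.near_lat (‖a‖ + 1 + ‖k‖)
    obtain ⟨ρ, hρ, hs⟩ := lat_sep L
    have hm : 0 < min (min δ 1) ρ / 2 := by positivity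
    set m : ℝ := min (min δ 1) ρ / 2 with hmd
    have m1 : m < δ := by
      have : min (min δ 1) ρ ≤ δ := (min_le_left _ _).trans (min_le_left _ _)
      linarith
    have m2 : m < 1 := by
      have : min (min δ 1) ρ ≤ 1 := (min_le_left _ _).trans (min_le_right _ _)
      linarith
    have m3 : m < ρ := by
      have : min (min δ 1) ρ ≤ ρ := min_le_right _ _
      linarith
    have nm : ‖(m:ℂ)‖ = m := by rw [Complex.norm_real, Real.norm_eq_abs, abs_of_pos hm]
    have m0 : (m:ℂ) ≠ 0 := by exact_mod_cast hm.ne'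
    have hmL : (m:ℂ) ∉ L.lattice := fun hm' => by
      have := hs _ hm' m0
      linarith
    have h1 := hb m 0 L.lattice.zero_mem m0 (by rw [sub_zero, nm]; exact m1)
    have h2 : F m - a * m = k := hk _ hmL
    have h3 : F m - conj (m:ℂ) = a * m - m + k := by
      rw [Complex.conj_ofReal]; linear_combination h2
    rw [h3] at h1
    have h4 : ‖a * m - m + k‖ ≤ ‖a‖ * m + m + ‖k‖ := by
      refine (norm_add_le _ _).trans ?_
      have := norm_sub_le (a * m) (m:ℂ)
      rw [norm_mul, nm] at this
      linarith
    have h5 : ‖a‖ * m ≤ ‖a‖ := mul_le_of_le_one_right (norm_nonneg _) m2.le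
    linarith
  · exact hc

lemma freq_lt (h : Core L F c0) {x : ℂ} (hx : x ∉ L.lattice) (hd : ‖deriv F x‖ ≤ 1) :
    ∃ᶠ z in 𝓝 x, ‖deriv F z‖ < 1 := by
  have h1 : deriv F x ∈ closure (ball (0:ℂ) 1) := by
    rw [closure_ball _ one_ne_zero]; simpa using hd
  have h2 := (mem_closure_iff_frequently.1 h1).filter_mono (h.dopen hx)
  rw [frequently_map] at h2
  exact h2.mono fun z hz => by simpa using hz

lemma freq_gt (h : Core L F c0) {x : ℂ} (hx : x ∉ L.lattice) (hd : 1 ≤ ‖deriv F x‖) :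
    ∃ᶠ z in 𝓝 x, 1 < ‖deriv F z‖ := by
  have h1 : deriv F x ∈ closure (closedBall (0:ℂ) 1)ᶜ := by
    rw [closure_compl, interior_closedBall _ one_ne_zero]; simpa using hd
  have h2 := (mem_closure_iff_frequently.1 h1).filter_mono (h.dopen hx)
  rw [frequently_map] at h2
  exact h2.mono fun z hz => by simpa using hz

lemma Zcont (h : Core L F c0) {x : ℂ} (hx : x ∉ L.lattice) : ContinuousAt (Zf F) x :=
  (h.Zstrict hx).hasFDerivAt.continuousAt

lemma giter_odd (h : Core L F c0) (n : ℕ) (z : ℂ) : (gm F 0)^[n] (-z) = - (gm F 0)^[n] z := by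
  induction n generalizing z with
  | zero => rfl
  | succ n ih => rw [Function.iterate_succ_apply, h.godd, ih, Function.iterate_succ_apply]

lemma iter_cont (h : Core L F c0) (ε : ℂ) (hn : ∀ n, (gm F 0)^[n] ε ∉ L.lattice) (n : ℕ) :
    ContinuousAt (fun v => (gm F v)^[n] ε) 0 := by
  induction n with
  | zero => exact continuousAt_const
  | succ n ih =>
    simp only [Function.iterate_succ_apply']
    unfold gm at *
    have h1 : ContinuousAt F ((fun z => conj (F z - 0))^[n] ε) := (h.diff _ (hn n)).continuousAt
    have h2 : ContinuousAt (fun v => F ((fun z => conj (F z - v))^[n] ε)) 0 :=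
      ContinuousAt.comp (f := fun v => (fun z => conj (F z - v))^[n] ε) (g := F) h1 ih
    exact Complex.continuous_conj.continuousAt.comp (h2.sub continuousAt_id)

theorem lemN (h : Core L F c0) {q : ℂ} (hq : q ∉ L.lattice) (hq2 : 2 * q ∈ L.lattice)
    (hdq : ‖deriv F q‖ < 1) {x : ℂ} (hx : x ∉ L.lattice) (hZx : Zf F x = 0) (hxq : x - q ∉ L.lattice) :
    1 < ‖deriv F x‖ := by
  by_contra! hdx
  have hZq := h.Zhalf hq2
  have hboth : ∀ ε, (ε = c0 ∨ ε = -c0) → ∀ δ > 0, ∃ N : ℕ, ∀ n ≥ N, ∃ l ∈ L.lattice,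
      ‖(gm F 0)^[n] ε - (q + l)‖ < δ := by
    obtain ⟨ε0, hε0, hc⟩ := h.fatou hq hZq hdq
    have hneg : ∀ δ > 0, ∃ N : ℕ, ∀ n ≥ N, ∃ l ∈ L.lattice, ‖(gm F 0)^[n] (-ε0) - (q + l)‖ < δ := by
      intro δ hδ
      obtain ⟨N, hN⟩ := hc δ hδ
      refine ⟨N, fun n hn => ?_⟩
      obtain ⟨l, hl, hb⟩ := hN n hn
      refine ⟨-(2 * q) - l, sub_mem (neg_mem hq2) hl, ?_⟩
      rw [h.giter_odd, ← norm_neg]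
      rw [show -(-(gm F 0)^[n] ε0 - (q + (-(2 * q) - l))) = (gm F 0)^[n] ε0 - (q + l) by ring]
      exact hb
    intro ε hε
    have : ε = ε0 ∨ ε = -ε0 := by
      rcases hε with rfl | rfl <;> rcases hε0 with rfl | rfl <;> simp
    rcases this with rfl | rfl
    · exact hc
    · exact hneg
  have hnot : ∀ ε, (ε = c0 ∨ ε = -c0) → ∀ n, (gm F 0)^[n] ε ∉ L.lattice := by
    intro ε hε n hn
    obtain ⟨δ, hδ, hb⟩ := Metric.mem_nhds_iff.1 (lat_nhds hq)
    obtain ⟨N, hN⟩ := hboth ε hε δ hδ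
    have hfix : ∀ l ∈ L.lattice, ∀ m, (gm F 0)^[m] l = l := by
      intro l hl m
      refine Function.iterate_fixed ?_ m
      rw [gm, h.F_lat hl, sub_zero, Complex.conj_conj]
    obtain ⟨l, hl, hbl⟩ := hN (N + n) (by omega)
    rw [Function.iterate_add_apply, hfix _ hn] at hbl
    have : (gm F 0)^[n] ε - l ∈ ball q δ := by
      rw [mem_ball, dist_eq_norm, sub_sub, add_comm l]; exact hbl
    exact hb this (sub_mem hn hl)
  obtain ⟨κ, hκ0, hκ1, hcon⟩ := h.contr hq hZq hdq
  obtain ⟨r0, hr0, hcb⟩ := Metric.mem_nhds_iff.1 hcon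
  obtain ⟨r, ⟨hsep, hrr⟩, hr⟩ := ((sep_nhds hxq).and
    (nhdsWithin_le_nhds (gt_mem_nhds hr0)) |>.and self_mem_nhdsWithin).exists
  replace hr : 0 < r := hr
  have step : ∀ v y : ℂ, ‖v‖ < (1 - κ) * r → (∃ l ∈ L.lattice, ‖y - (q + l)‖ < r) →
      ∃ l ∈ L.lattice, ‖gm F v y - (q + l)‖ < r := by
    rintro v y hv ⟨l, hl, hy⟩
    refine ⟨l, hl, ?_⟩
    have h1 : ‖gm F 0 (y - l) - q‖ ≤ κ * ‖y - l - q‖ := hcb (by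
      rw [mem_ball, dist_eq_norm, sub_sub, add_comm l]; exact hy.trans hrr)
    have h2 : gm F v y - (q + l) = (gm F 0 (y - l) - q) - conj v := by
      have := h.gper 0 (y - l) hl
      rw [sub_add_cancel] at this
      simp only [gm, map_sub, map_zero] at this ⊢
      linear_combination this
    rw [h2]
    have h3 := norm_sub_le (gm F 0 (y - l) - q) (conj v)
    rw [Complex.norm_conj] at h3
    rw [sub_sub, add_comm l] at h1
    have h4 : κ * ‖y - (q + l)‖ ≤ κ * r := mul_le_mul_of_nonneg_left hy.le hκ0
    linarith
  have hent : ∀ ε, (ε = c0 ∨ ε = -c0) → ∀ᶠ v in 𝓝 (0:ℂ), ∃ N, ∀ n ≥ N, ∃ l ∈ L.lattice,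
      ‖(gm F v)^[n] ε - (q + l)‖ < r := by
    intro ε hε
    obtain ⟨N, hN⟩ := hboth ε hε r hr
    obtain ⟨l, hl, hb⟩ := hN N le_rfl
    have hct := (((h.iter_cont ε (hnot ε hε) N).sub_const (q + l)).norm).eventually (gt_mem_nhds hb)
    have hsm : ∀ᶠ v in 𝓝 (0:ℂ), ‖v‖ < (1 - κ) * r := by
      have : 0 < (1 - κ) * r := mul_pos (by linarith) hr
      filter_upwards [ball_mem_nhds (0:ℂ) this] with v hv
      simpa using hv
    filter_upwards [hct, hsm] with v h1 h2
    refine ⟨N, fun n hn => ?_⟩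
    induction n, hn using Nat.le_induction with
    | base => exact ⟨l, hl, h1⟩
    | succ n hn ih =>
      rw [Function.iterate_succ_apply']
      exact step v _ h2 ih
  have hent2 := (hent c0 (Or.inl rfl)).and (hent (-c0) (Or.inr rfl))
  have hcx := h.Zcont hx
  rw [ContinuousAt, hZx] at hcx
  obtain ⟨z, hzd, ⟨⟨hz1, hz2⟩, hzr⟩, hzL⟩ := ((h.freq_lt hx hdx).and_eventually
    ((hcx.eventually hent2).and (ball_mem_nhds x hr) |>.and (lat_nhds hx))).exists
  obtain ⟨ε, hε, hc⟩ := h.fatou (v := Zf F z) hzL rfl hzd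
  have hN : ∃ N, ∀ n ≥ N, ∃ l ∈ L.lattice, ‖(gm F (Zf F z))^[n] ε - (q + l)‖ < r := by
    rcases hε with rfl | rfl
    · exact hz1
    · exact hz2
  obtain ⟨N, hN⟩ := hN
  obtain ⟨N', hN'⟩ := hc (r - dist z x) (sub_pos.2 hzr)
  obtain ⟨l, hl, h1⟩ := hN (max N N') (le_max_left _ _)
  obtain ⟨l', hl', h2⟩ := hN' (max N N') (le_max_right _ _)
  set p := (gm F (Zf F z))^[max N N'] ε
  refine hsep (p - l') ?_ (p - l) ?_ ?_
  · rw [mem_ball]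
    refine (dist_triangle _ z _).trans_lt ?_
    rw [dist_eq_norm (p - l') z, sub_sub, add_comm l']
    linarith
  · rw [mem_ball, dist_eq_norm, sub_sub, add_comm l]; exact h1
  · rw [sub_sub_sub_cancel_left]
    exact sub_mem hl hl'

lemma sep_fin {n : ℕ} {L : PeriodPair} (z : Fin n → ℂ) (hne : ∀ i j, i ≠ j → z i - z j ∉ L.lattice) :
    ∃ ρ : ℝ, (∀ i j, i ≠ j → ∀ x ∈ ball (z i) ρ, ∀ y ∈ ball (z j) ρ, x - y ∉ L.lattice) ∧ 0 < ρ := by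
  have h1 : ∀ᶠ ρ in 𝓝[>] (0:ℝ), ∀ i j, i ≠ j → ∀ x ∈ ball (z i) ρ, ∀ y ∈ ball (z j) ρ, x - y ∉ L.lattice := by
    rw [eventually_all]; intro i
    rw [eventually_all]; intro j
    by_cases hij : i = j
    · exact Eventually.of_forall fun _ hn => absurd hij hn
    · filter_upwards [sep_nhds (hne i j hij)] with ρ h2 _ using h2
  exact (h1.and self_mem_nhdsWithin).exists

lemma four_ne {L : PeriodPair} {a b c d : ℂ} (hab : a - b ∉ L.lattice) (hac : a - c ∉ L.lattice)
    (had : a - d ∉ L.lattice) (hbc : b - c ∉ L.lattice) (hbd : b - d ∉ L.lattice) (hcd : c - d ∉ L.lattice) :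
    ∀ i j : Fin 4, i ≠ j → (![a, b, c, d] : Fin 4 → ℂ) i - (![a, b, c, d] : Fin 4 → ℂ) j ∉ L.lattice := by
  have sw : ∀ {x y : ℂ}, x - y ∉ L.lattice → y - x ∉ L.lattice := fun {x y} hxy hyx =>
    hxy (by simpa using neg_mem hyx)
  intro i j hij
  fin_cases i <;> fin_cases j <;> first | exact absurd rfl hij | assumption | (apply sw; assumption)

lemma half_sub {L : PeriodPair} {w q : ℂ} (hw : 2 * w ∉ L.lattice) (hq2 : 2 * q ∈ L.lattice) :
    w - q ∉ L.lattice ∧ -w - q ∉ L.lattice := by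
  refine ⟨fun h1 => hw ?_, fun h1 => hw ?_⟩
  · have := add_mem (add_mem h1 h1) hq2
    convert this using 1; ring
  · have := neg_mem (add_mem (add_mem h1 h1) hq2)
    convert this using 1; ring

theorem C1 (h : Core L F c0) {w : ℂ} (hw : 2 * w ∉ L.lattice) (hZ : Zf F w = 0) {q q' q'' : ℂ}
    (hq : q ∉ L.lattice) (hq2 : 2 * q ∈ L.lattice) (hq' : q' ∉ L.lattice) (hq2' : 2 * q' ∈ L.lattice)
    (hq'' : q'' ∉ L.lattice) (hq2'' : 2 * q'' ∈ L.lattice) (h1 : q' - q ∉ L.lattice)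
    (h2 : q'' - q ∉ L.lattice) (h3 : q' - q'' ∉ L.lattice) : 1 ≤ ‖deriv F q‖ := by
  by_contra! hd
  have hwL : w ∉ L.lattice := fun hh => hw (by rw [two_mul]; exact add_mem hh hh)
  have hwL' : -w ∉ L.lattice := fun hh => hwL (by simpa using neg_mem hh)
  have hZ' : Zf F (-w) = 0 := by rw [h.Zodd, hZ, neg_zero]
  refine h.count 0 ![w, -w, q', q''] ?_ (four_ne (by rwa [sub_neg_eq_add, ← two_mul]) (half_sub hw hq2').1
    (half_sub hw hq2'').1 (half_sub hw hq2').2 (half_sub hw hq2'').2 h3) ?_ ?_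
  · intro i; fin_cases i <;> assumption
  · intro i; fin_cases i
    · exact hZ
    · exact hZ'
    · exact h.Zhalf hq2'
    · exact h.Zhalf hq2''
  · intro i; fin_cases i
    · exact h.lemN hq hq2 hd hwL hZ (half_sub hw hq2).1
    · exact h.lemN hq hq2 hd hwL' hZ' (half_sub hw hq2).2
    · exact h.lemN hq hq2 hd hq' (h.Zhalf hq2') h1
    · exact h.lemN hq hq2 hd hq'' (h.Zhalf hq2'') h2

theorem C2 (h : Core L F c0) {w : ℂ} (hw : 2 * w ∉ L.lattice) (hZ : Zf F w = 0) {q q' q'' : ℂ}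
    (hq : q ∉ L.lattice) (hq2 : 2 * q ∈ L.lattice) (hq' : q' ∉ L.lattice) (hq2' : 2 * q' ∈ L.lattice)
    (hq'' : q'' ∉ L.lattice) (hq2'' : 2 * q'' ∈ L.lattice) (h1 : q' - q ∉ L.lattice)
    (h2 : q'' - q ∉ L.lattice) (h3 : q' - q'' ∉ L.lattice) (hdw : 1 < ‖deriv F w‖) : ‖deriv F q‖ ≤ 1 := by
  by_contra! hd
  have sw : ∀ {x y : ℂ}, x - y ∉ L.lattice → y - x ∉ L.lattice := fun {x y} hxy hyx =>
    hxy (by simpa using neg_mem hyx)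
  have hwL : w ∉ L.lattice := fun hh => hw (by rw [two_mul]; exact add_mem hh hh)
  have hwL' : -w ∉ L.lattice := fun hh => hwL (by simpa using neg_mem hh)
  have hZ' : Zf F (-w) = 0 := by rw [h.Zodd, hZ, neg_zero]
  have hd' := h.C1 hw hZ hq' hq2' hq hq2 hq'' hq2'' (sw h1) (sw h3) (sw h2)
  obtain ⟨ρ, hsep, hρ⟩ := sep_fin ![q', w, -w, q] (four_ne (sw (half_sub hw hq2').1)
    (sw (half_sub hw hq2').2) h1 (by rwa [sub_neg_eq_add, ← two_mul]) (half_sub hw hq2).1 (half_sub hw hq2).2)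
  obtain ⟨S1, s1, -, -, d1, -, n1⟩ := h.local_Z hwL hdw (ball_mem_nhds w hρ)
  obtain ⟨S2, s2, -, -, d2, -, n2⟩ := h.local_Z hwL' (by rwa [h.dodd]) (ball_mem_nhds (-w) hρ)
  obtain ⟨S3, s3, -, -, d3, -, n3⟩ := h.local_Z hq hd (ball_mem_nhds q hρ)
  rw [hZ] at n1
  rw [hZ'] at n2
  rw [h.Zhalf hq2] at n3
  have hcx := h.Zcont hq'
  rw [ContinuousAt, h.Zhalf hq2'] at hcx
  obtain ⟨z, hzd, ⟨⟨⟨z1, hz1, e1⟩, ⟨z2, hz2, e2⟩, ⟨z3, hz3, e3⟩⟩, hzρ⟩, hzL⟩ :=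
    ((h.freq_gt hq' hd').and_eventually
    ((hcx.eventually (inter_mem n1 (inter_mem n2 n3))).and (ball_mem_nhds q' hρ) |>.and (lat_nhds hq'))).exists
  refine h.count (Zf F z) ![z, z1, z2, z3] ?_ (four_ne ?_ ?_ ?_ ?_ ?_ ?_) ?_ ?_
  · intro i; fin_cases i
    · exact hzL
    · exact (d1 _ hz1).1
    · exact (d2 _ hz2).1
    · exact (d3 _ hz3).1
  · exact hsep 0 1 (by decide) _ hzρ _ (s1 hz1)
  · exact hsep 0 2 (by decide) _ hzρ _ (s2 hz2)
  · exact hsep 0 3 (by decide) _ hzρ _ (s3 hz3)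
  · exact hsep 1 2 (by decide) _ (s1 hz1) _ (s2 hz2)
  · exact hsep 1 3 (by decide) _ (s1 hz1) _ (s3 hz3)
  · exact hsep 2 3 (by decide) _ (s2 hz2) _ (s3 hz3)
  · intro i; fin_cases i
    · rfl
    · exact e1
    · exact e2
    · exact e3
  · intro i; fin_cases i
    · exact hzd
    · exact (d1 _ hz1).2
    · exact (d2 _ hz2).2
    · exact (d3 _ hz3).2

end Core
end HZ

namespace HZ
open ComplexConjugate MeasureTheory

lemma tail_deriv {ι : Type*} {w : ι → ℂ} (hw : ∀ i, w i ≠ 0) (hs : Summable fun i => (‖w i‖ ^ 3)⁻¹)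
    {z0 : ℂ} {d : ℝ} (hd : 0 < d) (hz : ∀ i, d ≤ ‖z0 - w i‖) :
    HasDerivAt (fun z => ∑' i, (1 / (z - w i) + 1 / w i + z / w i ^ 2))
      (-∑' i, (1 / (z0 - w i) ^ 2 - 1 / w i ^ 2)) z0 := by
  set M := ‖z0‖ + d with hM
  have hM0 : 0 < M := by positivity
  set c := d / (4 * M) with hc
  have hc0 : 0 < c := by positivity
  have hcd : c ≤ 1 / 4 := by
    rw [hc, div_le_iff₀ (by positivity)]; have := norm_nonneg z0; rw [hM]; linarith
  set U := ball z0 (d / 2)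
  have hUd : ∀ z ∈ U, ∀ i, d / 2 ≤ ‖z - w i‖ := by
    intro z hz' i
    have h1 : ‖z - z0‖ < d / 2 := by simpa [U, dist_eq_norm] using hz'
    have h2 := hz i
    have h3 : ‖z0 - w i‖ ≤ ‖z - z0‖ + ‖z - w i‖ := by
      have := norm_sub_le (z - w i) (z - z0)
      rw [show z - w i - (z - z0) = z0 - w i by ring] at this; linarith
    linarith
  have hUc : ∀ z ∈ U, ∀ i, c * ‖w i‖ ≤ ‖z - w i‖ := by
    intro z hz' i
    have h1 : ‖z - z0‖ < d / 2 := by simpa [U, dist_eq_norm] using hz'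
    have hzM : ‖z‖ ≤ M := by
      have := norm_sub_norm_le z z0; rw [hM]; linarith
    by_cases hb : 2 * M ≤ ‖w i‖
    · have := norm_sub_norm_le (w i) z
      rw [norm_sub_rev] at this
      nlinarith
    · push Not at hb
      have := hUd z hz' i
      have : c * ‖w i‖ ≤ c * (2 * M) := by gcongr
      have e : c * (2 * M) = d / 2 := by rw [hc]; field_simp; norm_num
      linarith
  have hne : ∀ z ∈ U, ∀ i, z - w i ≠ 0 := by
    intro z hz' i h
    have := hUd z hz' i
    rw [h] at this; simp at this; linarith
  have hzM : ∀ z ∈ U, ‖z‖ ≤ M := by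
    intro z hz'
    have h1 : ‖z - z0‖ < d / 2 := by simpa [U, dist_eq_norm] using hz'
    have := norm_sub_norm_le z z0; rw [hM]; linarith
  have hu : Summable fun i => (M ^ 2 / c) * (‖w i‖ ^ 3)⁻¹ := hs.mul_left _
  have hD : ∀ i, ∀ z ∈ U, HasDerivAt (fun z => 1 / (z - w i) + 1 / w i + z / w i ^ 2)
      (-(1 / (z - w i) ^ 2 - 1 / w i ^ 2)) z := by
    intro i z hz'
    have h1 : HasDerivAt (fun z => z - w i) 1 z := (hasDerivAt_id z).sub_const _
    have h2 := ((h1.inv (hne z hz' i)).add_const (1 / w i)).add ((hasDerivAt_id z).div_const (w i ^ 2))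
    have e : -(1 / (z - w i) ^ 2 - 1 / w i ^ 2) = -1 / (z - w i) ^ 2 + 1 / w i ^ 2 := by ring
    rw [e]
    refine h2.congr_of_eventuallyEq (Eventually.of_forall fun y => ?_)
    simp
  have hb : ∀ i, ∀ z ∈ U, ‖1 / (z - w i) + 1 / w i + z / w i ^ 2‖ ≤ (M ^ 2 / c) * (‖w i‖ ^ 3)⁻¹ := by
    intro i z hz'
    have e : 1 / (z - w i) + 1 / w i + z / w i ^ 2 = z ^ 2 / ((z - w i) * w i ^ 2) := by
      have := hne z hz' i; have := hw i; field_simp; ring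
    rw [e, norm_div, norm_mul, norm_pow, norm_pow]
    have hwp : 0 < ‖w i‖ := norm_pos_iff.2 (hw i)
    have e2 : (M ^ 2 / c) * (‖w i‖ ^ 3)⁻¹ = M ^ 2 / ((c * ‖w i‖) * ‖w i‖ ^ 2) := by
      field_simp
    rw [e2]
    have := hUc z hz' i
    have := hzM z hz'
    gcongr
  have hz0 : z0 ∈ U := mem_ball_self (by positivity)
  have hdo : ∀ i, DifferentiableOn ℂ (fun z => 1 / (z - w i) + 1 / w i + z / w i ^ 2) U :=
    fun i z hz' => (hD i z hz').differentiableAt.differentiableWithinAt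
  have h1 := Complex.differentiableOn_tsum_of_summable_norm hu hdo isOpen_ball hb
  have h2 := Complex.hasSum_deriv_of_summable_norm hu hdo isOpen_ball hb hz0
  have h3 := (h1.differentiableAt (isOpen_ball.mem_nhds hz0)).hasDerivAt
  rw [← h2.tsum_eq] at h3
  rw [← tsum_neg]
  have e : (fun i => deriv (fun z => 1 / (z - w i) + 1 / w i + z / w i ^ 2) z0) =
     fun i => (-(1 / (z0 - w i) ^ 2 - 1 / w i ^ 2)) := by
    ext i; exact (hD i z0 hz0).deriv
  rw [e] at h3
  exact h3

/-- period pair for tau -/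
noncomputable def Lt (τ : ℂ) (h : 0 < τ.im) : PeriodPair where
  ω₁ := 1
  ω₂ := τ
  indep := by
    rw [LinearIndependent.pair_iff]
    intro s t hst
    have h1 := congrArg Complex.im hst
    have h2 := congrArg Complex.re hst
    simp at h1 h2
    rcases h1 with h1 | h1
    · subst h1; simpa using h2
    · exact absurd h1 h.ne'

lemma mem_Lt {τ : ℂ} (h : 0 < τ.im) {z : ℂ} :
    z ∈ (Lt τ h).lattice ↔ ∃ m n : ℤ, (m : ℂ) + n * τ = z := by
  rw [PeriodPair.mem_lattice]
  simp [Lt]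

lemma latPt_mem {τ : ℂ} (h : 0 < τ.im) (p : ℤ × ℤ) : latPt τ p ∈ (Lt τ h).lattice :=
  (mem_Lt h).2 ⟨p.1, p.2, rfl⟩

lemma latPt_eq {τ : ℂ} (h : 0 < τ.im) (p : ℤ × ℤ) :
    ((Lt τ h).latticeEquivProd.symm p : ℂ) = latPt τ p := by
  rw [PeriodPair.latticeEquiv_symm_apply]; simp [Lt, latPt]

lemma latPt_ne {τ : ℂ} (h : 0 < τ.im) (p : {p : ℤ × ℤ // p ≠ 0}) : latPt τ p.1 ≠ 0 := by
  rw [← latPt_eq h]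
  have : (Lt τ h).latticeEquivProd.symm p.1 ≠ 0 := by simpa using p.2
  simpa using this

open PeriodPair in
lemma tail_P {τ : ℂ} (h : 0 < τ.im) (z : ℂ) :
    ∑' p : {p : ℤ × ℤ // p ≠ 0}, (1 / (z - latPt τ p.1) ^ 2 - 1 / latPt τ p.1 ^ 2)
      = (Lt τ h).weierstrassPExcept 0 z := by
  rw [PeriodPair.weierstrassPExcept]
  rw [← (Lt τ h).latticeEquivProd.symm.toEquiv.tsum_eq]
  refine (tsum_subtype {p : ℤ × ℤ | p ≠ 0}
    (fun p => (1 / (z - latPt τ p) ^ 2 - 1 / latPt τ p ^ 2))).trans ?_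
  congr 1
  ext p
  by_cases hp : p = 0
  · subst hp; simp
  · have h1 := latPt_ne h ⟨p, hp⟩
    have h2 := latPt_eq h p
    simp only [LinearEquiv.coe_toEquiv]
    rw [if_neg (by rw [h2]; exact h1), indicator_of_mem (by exact hp), h2]

lemma wp_eq {τ : ℂ} (h : 0 < τ.im) (z : ℂ) : wp τ z = (Lt τ h).weierstrassP z := by
  rw [wp, tail_P h]
  have := (Lt τ h).weierstrassPExcept_add 0 z
  rw [← this]; simp [add_comm]

lemma summ {τ : ℂ} (h : 0 < τ.im) :
    Summable fun p : {p : ℤ × ℤ // p ≠ 0} => (‖latPt τ p.1‖ ^ 3)⁻¹ := by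
  have h1 := ZLattice.summable_norm_pow_inv (L := (Lt τ h).lattice) 3 (by simp)
  have h2 := ((Lt τ h).latticeEquivProd.symm.toEquiv.summable_iff.2 h1).subtype {p : ℤ × ℤ | p ≠ 0}
  refine h2.congr fun p => ?_
  have := latPt_eq h p.1
  simp only [Function.comp, LinearEquiv.coe_toEquiv]
  rw [← this]; simp

noncomputable def ztail (τ z : ℂ) : ℂ := ∑' p : {p : ℤ × ℤ // p ≠ 0},
    (1 / (z - latPt τ p.1) + 1 / latPt τ p.1 + z / latPt τ p.1 ^ 2)

lemma ztail_deriv {τ : ℂ} (h : 0 < τ.im) {z : ℂ} (hz : z ∉ (Lt τ h).lattice ∨ z = 0) :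
    HasDerivAt (ztail τ) (-(Lt τ h).weierstrassPExcept 0 z) z := by
  have ho : IsOpen (((Lt τ h).lattice : Set ℂ) \ {0})ᶜ := (Lt τ h).isOpen_compl_lattice_sdiff
  have hm : z ∈ (((Lt τ h).lattice : Set ℂ) \ {0})ᶜ := by
    rcases hz with hz | hz
    · exact fun h => hz h.1
    · exact fun h => h.2 hz
  obtain ⟨d, hd, hb⟩ := Metric.isOpen_iff.1 ho z hm
  have := tail_deriv (latPt_ne h) (summ h) (z0 := z) hd (fun p => by
    by_contra! hlt
    exact hb (show latPt τ p.1 ∈ ball z d by rw [mem_ball, dist_comm, dist_eq_norm]; exact hlt)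
      ⟨latPt_mem h _, latPt_ne h p⟩)
  rw [tail_P h] at this
  exact this

lemma wzeta_eq (τ z : ℂ) : wzeta τ z = 1 / z + ztail τ z := rfl

lemma wzeta_deriv {τ : ℂ} (h : 0 < τ.im) {z : ℂ} (hz : z ∉ (Lt τ h).lattice) :
    HasDerivAt (wzeta τ) (-(Lt τ h).weierstrassP z) z := by
  have hz0 : z ≠ 0 := fun h' => hz (h' ▸ zero_mem _)
  have h1 := (hasDerivAt_inv hz0).add (ztail_deriv h (Or.inl hz))
  have e : -(Lt τ h).weierstrassP z = -(z ^ 2)⁻¹ + -(Lt τ h).weierstrassPExcept 0 z := by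
    have := (Lt τ h).weierstrassPExcept_add 0 z
    rw [← this]; simp
  rw [e]
  refine h1.congr_of_eventuallyEq (Eventually.of_forall fun y => ?_)
  simp [wzeta_eq]

lemma ztail_an {τ : ℂ} (h : 0 < τ.im) : AnalyticAt ℂ (ztail τ) 0 := by
  have ho : IsOpen (((Lt τ h).lattice : Set ℂ) \ {0})ᶜ := (Lt τ h).isOpen_compl_lattice_sdiff
  have : DifferentiableOn ℂ (ztail τ) (((Lt τ h).lattice : Set ℂ) \ {0})ᶜ := fun z hz => by
    refine (ztail_deriv h ?_).differentiableAt.differentiableWithinAt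
    by_contra! hc
    exact hz ⟨hc.1, hc.2⟩
  exact this.analyticAt (ho.mem_nhds (by simp))

lemma wzeta_odd (τ z : ℂ) : wzeta τ (-z) = -wzeta τ z := by
  rw [wzeta_eq, wzeta_eq, ztail, ztail]
  rw [← (Equiv.tsum_eq (⟨fun p => ⟨-p.1, by simpa using p.2⟩, fun p => ⟨-p.1, by simpa using p.2⟩,
    fun p => by simp, fun p => by simp⟩ : {p : ℤ × ℤ // p ≠ 0} ≃ {p : ℤ × ℤ // p ≠ 0}))]
  rw [neg_add, ← tsum_neg]
  congr 1
  · rw [div_neg]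
  · congr 1
    ext p
    have e : latPt τ (-p.1) = -latPt τ p.1 := by simp [latPt]; ring
    simp only [Equiv.coe_fn_mk, e]
    rw [show -z - -latPt τ p.1 = -(z - latPt τ p.1) by ring, div_neg, div_neg]
    ring

lemma wzeta_per {τ : ℂ} (h : 0 < τ.im) {w : ℂ} (hw : w ∈ (Lt τ h).lattice)
    (hw2 : w / 2 ∉ (Lt τ h).lattice) {z : ℂ} (hz : z ∉ (Lt τ h).lattice) :
    wzeta τ (z + w) = wzeta τ z + 2 * wzeta τ (w / 2) := by
  set L := Lt τ h
  have hd : ∀ y, y ∉ L.lattice → HasDerivAt (fun y => wzeta τ (y + w) - wzeta τ y) 0 y := by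
    intro y hy
    have h1 := (wzeta_deriv h (z := y + w) (by rwa [add_mem_iff hw])).comp_add_const
    have h2 := h1.sub (wzeta_deriv h hy)
    have e : L.weierstrassP (y + w) = L.weierstrassP y := L.weierstrassP_add_coe y ⟨w, hw⟩
    rw [show (0:ℂ) = -L.weierstrassP (y + w) - -L.weierstrassP y by rw [e]; ring]
    exact h2
  have hn : -(w / 2) ∉ L.lattice := by simpa using hw2
  obtain ⟨C, hC⟩ := L.isClosed_lattice.isOpen_compl.exists_is_const_of_deriv_eq_zero
    (Core.lat_compl_conn L) (f := fun y => wzeta τ (y + w) - wzeta τ y)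
    (fun y hy => (hd y hy).differentiableAt.differentiableWithinAt)
    (fun y hy => (hd y hy).deriv)
  have e1 := hC z hz
  have e2 := hC _ hn
  rw [wzeta_odd, show -(w / 2) + w = w / 2 by ring] at e2
  linear_combination e1 - e2
end HZ

namespace HZ
open ComplexConjugate MeasureTheory

structure Zt (L : PeriodPair) (ζ : ℂ → ℂ) (R c : ℂ) : Prop where
  der : ∀ z, z ∉ L.lattice → HasDerivAt ζ (-L.weierstrassP z) z
  per : ∀ z l, l ∈ L.lattice → ζ (z + l) = ζ z + (R * conj l - c * l)
  odd : ∀ z, ζ (-z) = -ζ z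
  pole : ∃ H : ℂ → ℂ, AnalyticAt ℂ H 0 ∧ ∀ᶠ z in 𝓝[≠] (0:ℂ), ζ z = 1 / z + H z

variable {L : PeriodPair}

lemma P_der {z : ℂ} (hz : z ∉ L.lattice) :
    HasDerivAt L.weierstrassP (L.derivWeierstrassP z) z := by
  have := (L.analyticOnNhd_weierstrassP z hz).differentiableAt.hasDerivAt
  rwa [PeriodPair.deriv_weierstrassP] at this

lemma P_per (z : ℂ) {l : ℂ} (hl : l ∈ L.lattice) : L.weierstrassP (z + l) = L.weierstrassP z :=
  L.weierstrassP_add_coe z ⟨l, hl⟩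

lemma D_per (z : ℂ) {l : ℂ} (hl : l ∈ L.lattice) :
    L.derivWeierstrassP (z + l) = L.derivWeierstrassP z :=
  L.derivWeierstrassP_add_coe z ⟨l, hl⟩

lemma P_congr {x y : ℂ} (h : x - y ∈ L.lattice) : L.weierstrassP x = L.weierstrassP y := by
  have := P_per y h
  rwa [add_sub_cancel] at this

lemma D_congr {x y : ℂ} (h : x - y ∈ L.lattice) : L.derivWeierstrassP x = L.derivWeierstrassP y := by
  have := D_per y h
  rwa [add_sub_cancel] at this

lemma P_split (z : ℂ) : L.weierstrassP z = 1 / z ^ 2 + L.weierstrassPExcept 0 z := by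
  have := L.weierstrassPExcept_add 0 z
  rw [← this]; simp [add_comm]

lemma ne0_ev : ∀ᶠ z in 𝓝[≠] (0:ℂ), z ≠ 0 := self_mem_nhdsWithin

lemma lat_ev (L : PeriodPair) (l : ℂ) : ∀ᶠ z in 𝓝[≠] l, z ∉ L.lattice := by
  filter_upwards [self_mem_nhdsWithin,
    mem_nhdsWithin_of_mem_nhds (L.compl_lattice_sdiff_singleton_mem_nhds l)] with z h1 h2 h3
  exact h2 ⟨h3, h1⟩

lemma P_lim : Tendsto (fun z => z ^ 2 * L.weierstrassP z) (𝓝[≠] 0) (𝓝 1) := by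
  have h1 : ContinuousAt (fun z : ℂ => 1 + z ^ 2 * L.weierstrassPExcept 0 z) 0 := by
    have := (L.analyticAt_weierstrassPExcept 0).continuousAt
    fun_prop
  have h2 := h1.tendsto.mono_left (nhdsWithin_le_nhds (s := {0}ᶜ))
  simp only [ne_eq, OfNat.ofNat_ne_zero, not_false_eq_true, zero_pow, zero_mul, add_zero] at h2
  refine h2.congr' ?_
  filter_upwards [ne0_ev] with z hz
  rw [P_split]; field_simp

lemma P_ne_ev (v : ℂ) : ∀ᶠ z in 𝓝[≠] (0:ℂ), L.weierstrassP z ≠ v := by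
  have h1 : Tendsto (fun z : ℂ => z ^ 2 * v) (𝓝[≠] 0) (𝓝 0) := by
    have : ContinuousAt (fun z : ℂ => z ^ 2 * v) 0 := by fun_prop
    simpa using this.tendsto.mono_left (nhdsWithin_le_nhds (s := {0}ᶜ))
  have h2 := (P_lim (L := L)).sub h1
  rw [sub_zero] at h2
  filter_upwards [h2.eventually_ne one_ne_zero] with z hz h
  rw [h] at hz; simp at hz

lemma P_nonconst {z0 v : ℂ} (hz : z0 ∉ L.lattice) : ¬ ∀ᶠ y in 𝓝 z0, L.weierstrassP y = v := by
  intro h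
  have h1 := (L.analyticOnNhd_weierstrassP).eqOn_of_preconnected_of_eventuallyEq
    (analyticOnNhd_const (v := v)) (Core.lat_compl_conn L) hz h
  obtain ⟨z, hz1, hz2⟩ := ((P_ne_ev (L := L) v).and (lat_ev L 0)).exists
  exact hz1 (h1 hz2)

lemma P_nonconst' {z0 v : ℂ} (hz : z0 ∉ L.lattice) :
    ∀ᶠ y in 𝓝[≠] z0, L.weierstrassP y ≠ v := by
  rcases (L.analyticOnNhd_weierstrassP z0 hz).eventually_eq_or_eventually_ne
    (analyticAt_const (v := v)) with h | h
  · exact absurd h (P_nonconst hz)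
  · exact h

/-- Liouville -/
lemma liou {G : ℂ → ℂ} (hp : ∀ z l, l ∈ L.lattice → G (z + l) = G z)
    (hd : ∀ z, ∀ᶠ y in 𝓝[≠] z, DifferentiableAt ℂ G y)
    (hl : ∀ z, ∃ v, Tendsto G (𝓝[≠] z) (𝓝 v)) :
    ∃ C, ∀ z, Tendsto G (𝓝[≠] z) (𝓝 C) := by
  choose g hg using hl
  have key : ∀ z, ∀ᶠ y in 𝓝 z, g y = Function.update G z (g z) y := by
    intro z
    have := hd z
    rw [eventually_nhdsWithin_iff] at this
    filter_upwards [this] with y hy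
    by_cases hyz : y = z
    · subst hyz; simp
    · rw [Function.update_of_ne hyz]
      exact tendsto_nhds_unique (hg y) ((hy hyz).continuousAt.tendsto.mono_left nhdsWithin_le_nhds)
  have han : ∀ z, AnalyticAt ℂ g z := by
    intro z
    have h1 : AnalyticAt ℂ (Function.update G z (g z)) z := by
      apply Complex.analyticAt_of_differentiable_on_punctured_nhds_of_continuousAt
      · have := hd z
        filter_upwards [this, self_mem_nhdsWithin] with y hy hyz
        refine hy.congr_of_eventuallyEq ?_
        filter_upwards [isOpen_ne.mem_nhds hyz] with x hx
        exact Function.update_of_ne hx _ _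
      · exact continuousAt_update_same.2 (hg z)
    exact h1.congr ((key z).mono fun y hy => hy.symm)
  have hgd : Differentiable ℂ g := fun z => (han z).differentiableAt
  have hgp : ∀ z l, l ∈ L.lattice → g (z + l) = g z := by
    intro z l hl'
    refine tendsto_nhds_unique (f := fun y => G (y + l)) (l := 𝓝[≠] z) ?_ ?_
    · refine (hg (z + l)).comp ?_
      refine tendsto_nhdsWithin_iff.2 ⟨?_, ?_⟩
      · exact ((continuous_add_const l).tendsto z).mono_left nhdsWithin_le_nhds
      · filter_upwards [self_mem_nhdsWithin] with y hy
        simpa using hy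
    · refine (hg z).congr fun y => (hp y l hl').symm
  obtain ⟨D, -, hD⟩ := lat_cov L
  obtain ⟨K, hK⟩ := ((isCompact_closedBall (0:ℂ) D).image hgd.continuous).isBounded.exists_norm_le
  have hbd : Bornology.IsBounded (range g) := by
    rw [isBounded_iff_forall_norm_le]
    refine ⟨K, ?_⟩
    rintro _ ⟨z, rfl⟩
    obtain ⟨l, hl', hz⟩ := lat_cov L |>.choose_spec.2 z |> fun _ => hD z
    have := hgp (z - l) l hl'
    rw [sub_add_cancel] at this
    rw [this]
    exact hK _ ⟨z - l, by simpa using hz, rfl⟩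
  refine ⟨g 0, fun z => ?_⟩
  rw [hgd.apply_eq_apply_of_bounded hbd 0 z]
  exact hg z

lemma tendsto_shift {G : ℂ → ℂ} {z l v : ℂ} (hp : ∀ z, G (z + l) = G z)
    (h : Tendsto G (𝓝[≠] z) (𝓝 v)) : Tendsto G (𝓝[≠] (z + l)) (𝓝 v) := by
  have h1 : Tendsto (fun y => y - l) (𝓝[≠] (z + l)) (𝓝[≠] z) := by
    refine tendsto_nhdsWithin_iff.2 ⟨?_, ?_⟩
    · have := ((continuous_sub_right l).tendsto (z + l)).mono_left (nhdsWithin_le_nhds (s := {z + l}ᶜ))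
      simpa using this
    · filter_upwards [self_mem_nhdsWithin] with y hy h
      apply hy
      rw [mem_singleton_iff] at h ⊢
      rw [← h]; ring
  refine (h.comp h1).congr fun y => ?_
  have := hp (y - l)
  rw [sub_add_cancel] at this
  exact this.symm

/-- even double zero -/
lemma dbl {E : ℂ → ℂ} {z0 : ℂ} (hE : AnalyticAt ℂ E z0) (h0 : E z0 = 0) (h1 : deriv E z0 = 0) :
    ∃ v, Tendsto (fun z => E z / (z - z0) ^ 2) (𝓝[≠] z0) (𝓝 v) := by
  obtain ⟨p, hp⟩ := hE
  have hp1 := hp.has_fpower_series_dslope_fslope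
  have hp2 := hp1.has_fpower_series_dslope_fslope
  refine ⟨_, (hp2.continuousAt.tendsto.mono_left nhdsWithin_le_nhds).congr' ?_⟩
  filter_upwards [self_mem_nhdsWithin] with z hz
  rw [dslope_of_ne _ hz, slope_def_field, dslope_of_ne _ hz, slope_def_field, dslope_same, h0, h1]
  have : z - z0 ≠ 0 := sub_ne_zero.2 hz
  field_simp
  ring
end HZ

namespace HZ
open ComplexConjugate MeasureTheory
variable {L : PeriodPair} {ζ : ℂ → ℂ} {R c : ℂ}

lemma conj_two (q : ℂ) : conj (2 * q) = 2 * conj q := by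
  rw [map_mul]; congr 1; exact Complex.conj_ofNat 2

lemma shift_ne (a l : ℂ) : Tendsto (fun y => y + l) (𝓝[≠] a) (𝓝[≠] (a + l)) := by
  refine tendsto_nhdsWithin_iff.2 ⟨?_, ?_⟩
  · exact ((continuous_add_const l).tendsto a).mono_left nhdsWithin_le_nhds
  · filter_upwards [self_mem_nhdsWithin] with y hy
    simpa using hy

lemma shift_ev {p : ℂ → Prop} {a l : ℂ} (h : ∀ᶠ y in 𝓝[≠] (a + l), p y) :
    ∀ᶠ y in 𝓝[≠] a, p (y + l) := (shift_ne a l).eventually h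

lemma lat_ev' (L : PeriodPair) (z l : ℂ) : ∀ᶠ y in 𝓝[≠] z, y + l ∉ L.lattice :=
  shift_ev (lat_ev L (z + l))

lemma D_half {q : ℂ} (hq2 : 2 * q ∈ L.lattice) : L.derivWeierstrassP q = 0 := by
  have h1 := L.derivWeierstrassP_neg q
  have h2 : L.derivWeierstrassP q = L.derivWeierstrassP (-q) := D_congr (by
    rw [show q - -q = 2 * q by ring]; exact hq2)
  linear_combination (h2 + h1) / 2

lemma P_half_prod {q : ℂ} (hq : q ∉ L.lattice) (hq2 : 2 * q ∈ L.lattice) :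
    ∃ C, C ≠ 0 ∧ ∀ z, z ∉ L.lattice → z + q ∉ L.lattice →
      (L.weierstrassP z - L.weierstrassP q) * (L.weierstrassP (z + q) - L.weierstrassP q) = C := by
  set e := L.weierstrassP q with he
  set G : ℂ → ℂ := fun z => (L.weierstrassP z - e) * (L.weierstrassP (z + q) - e) with hG
  have hp : ∀ z l, l ∈ L.lattice → G (z + l) = G z := by
    intro z l hl
    simp only [hG]
    rw [P_per z hl, show z + l + q = z + q + l by ring, P_per _ hl]
  have hpq : ∀ z, G (z + q) = G z := by
    intro z
    simp only [hG]
    rw [show z + q + q = z + 2 * q by ring, P_per _ hq2]; ring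
  have hdf : ∀ z, z ∉ L.lattice → z + q ∉ L.lattice → DifferentiableAt ℂ G z := by
    intro z h1 h2
    have a1 := (P_der h1).differentiableAt
    have a2 := ((P_der h2).comp_add_const).differentiableAt
    exact (a1.sub_const e).mul (a2.sub_const e)
  have h0 : ∃ v, Tendsto G (𝓝[≠] 0) (𝓝 v) := by
    have hq' : (0:ℂ) + q ∉ L.lattice := by simpa using hq
    have hE : AnalyticAt ℂ (fun z => L.weierstrassP (z + q) - e) 0 := by
      have : AnalyticAt ℂ L.weierstrassP ((fun z : ℂ => z + q) 0) :=
        L.analyticOnNhd_weierstrassP _ hq'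
      exact (this.comp (f := fun z : ℂ => z + q) (by fun_prop)).sub analyticAt_const
    obtain ⟨v, hv⟩ := dbl hE (by simp [he]) (by
      have := ((P_der hq').comp_add_const).sub_const e
      rw [zero_add, D_half hq2] at this
      exact this.deriv)
    have h1 : Tendsto (fun z : ℂ => z ^ 2 * e) (𝓝[≠] 0) (𝓝 0) := by
      have : ContinuousAt (fun z : ℂ => z ^ 2 * e) 0 := by fun_prop
      simpa using this.tendsto.mono_left (nhdsWithin_le_nhds (s := {0}ᶜ))
    refine ⟨_, (((P_lim (L := L)).sub h1).mul hv).congr' ?_⟩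
    filter_upwards [ne0_ev] with z hz
    simp only [hG, sub_zero]
    field_simp
  have hl : ∀ z, ∃ v, Tendsto G (𝓝[≠] z) (𝓝 v) := by
    intro z
    by_cases h1 : z ∈ L.lattice
    · obtain ⟨v, hv⟩ := h0
      refine ⟨v, ?_⟩
      have := tendsto_shift (fun y => hp y z h1) hv
      rwa [zero_add] at this
    by_cases h2 : z + q ∈ L.lattice
    · obtain ⟨v, hv⟩ := h0
      refine ⟨v, ?_⟩
      have := tendsto_shift (fun y => hp y _ h2) hv
      have := tendsto_shift (l := -q) (fun y => by rw [← hpq (y + -q)]; ring_nf) this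
      rwa [show 0 + (z + q) + -q = z by ring] at this
    · exact ⟨_, (hdf z h1 h2).continuousAt.tendsto.mono_left nhdsWithin_le_nhds⟩
  obtain ⟨C, hC⟩ := liou hp (fun z => by
    filter_upwards [lat_ev L z, lat_ev' L z q] with y h1 h2
    exact hdf y h1 h2) hl
  have hGC : ∀ z, z ∉ L.lattice → z + q ∉ L.lattice → G z = C := fun z h1 h2 =>
    tendsto_nhds_unique ((hdf z h1 h2).continuousAt.tendsto.mono_left nhdsWithin_le_nhds) (hC z)
  refine ⟨C, ?_, hGC⟩
  intro hC0
  have h1 := P_ne_ev (L := L) e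
  have h2 : ∀ᶠ y in 𝓝[≠] (0:ℂ), L.weierstrassP (y + q) ≠ e :=
    shift_ev (p := fun y => L.weierstrassP y ≠ e) (by rw [zero_add]; exact P_nonconst' (v := e) hq)
  obtain ⟨y, ⟨⟨⟨a, b⟩, c⟩, d⟩⟩ := (((h1.and h2).and (lat_ev L 0)).and (lat_ev' L 0 q)).exists
  have := hGC y c d
  rw [hC0] at this
  rcases mul_eq_zero.1 this with h | h
  · exact a (sub_eq_zero.1 h)
  · exact b (sub_eq_zero.1 h)

/-- E-identity -/
lemma Zt.E_id (h : Zt L ζ R c) {a : ℂ} (ha : 2 * a ∉ L.lattice) {z : ℂ} (hz : z ∉ L.lattice)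
    (h1 : z - a ∉ L.lattice) (h2 : z + a ∉ L.lattice) :
    (ζ (z - a) - ζ (z + a) + 2 * ζ a) * (L.weierstrassP z - L.weierstrassP a) =
      L.derivWeierstrassP a := by
  have ha1 : a ∉ L.lattice := fun h' => ha (by rw [two_mul]; exact add_mem h' h')
  set e := L.weierstrassP a with he
  set E : ℂ → ℂ := fun z => ζ (z - a) - ζ (z + a) + 2 * ζ a with hE
  set G : ℂ → ℂ := fun z => E z * (L.weierstrassP z - e) with hG
  have hEd : ∀ z, z - a ∉ L.lattice → z + a ∉ L.lattice →
      HasDerivAt E (-L.weierstrassP (z - a) - -L.weierstrassP (z + a)) z := by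
    intro z h1 h2
    have a1 := (h.der _ h1).comp_sub_const
    have a2 := (h.der _ h2).comp_add_const
    exact (a1.sub a2).add_const _
  have hdf : ∀ z, z ∉ L.lattice → z - a ∉ L.lattice → z + a ∉ L.lattice → DifferentiableAt ℂ G z :=
    fun z h0 h1 h2 => (hEd z h1 h2).differentiableAt.mul ((P_der h0).differentiableAt.sub_const e)
  have hp : ∀ z l, l ∈ L.lattice → G (z + l) = G z := by
    intro z l hl
    simp only [hG, hE]
    rw [P_per z hl, show z + l + a = z + a + l by ring, show z + l - a = z - a + l by ring,
      h.per _ _ hl, h.per _ _ hl]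
    ring
  have heven : ∀ z, G (-z) = G z := by
    intro z
    simp only [hG, hE]
    rw [L.weierstrassP_neg, show -z - a = -(z + a) by ring, show -z + a = -(z - a) by ring,
      h.odd, h.odd]
    ring
  -- at zero
  have h0 : ∃ v, Tendsto G (𝓝[≠] 0) (𝓝 v) := by
    have hna : 0 - a ∉ L.lattice := by simpa using ha1
    have hpa : 0 + a ∉ L.lattice := by simpa using ha1
    have hEan : AnalyticAt ℂ E 0 := by
      have o1 : IsOpen {z : ℂ | z - a ∉ L.lattice} :=
        L.isClosed_lattice.isOpen_compl.preimage (continuous_sub_right a)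
      have o2 : IsOpen {z : ℂ | z + a ∉ L.lattice} :=
        L.isClosed_lattice.isOpen_compl.preimage (continuous_add_const a)
      have hd : DifferentiableOn ℂ E ({z : ℂ | z - a ∉ L.lattice} ∩ {z : ℂ | z + a ∉ L.lattice}) :=
        fun z hz => (hEd z hz.1 hz.2).differentiableAt.differentiableWithinAt
      exact hd.analyticAt ((o1.inter o2).mem_nhds ⟨hna, hpa⟩)
    obtain ⟨v, hv⟩ := dbl hEan (by simp only [hE]; rw [zero_sub, zero_add, h.odd]; ring) (by
      rw [(hEd 0 hna hpa).deriv, zero_sub, zero_add, L.weierstrassP_neg]; ring)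
    have h1 : Tendsto (fun z : ℂ => z ^ 2 * e) (𝓝[≠] 0) (𝓝 0) := by
      have : ContinuousAt (fun z : ℂ => z ^ 2 * e) 0 := by fun_prop
      simpa using this.tendsto.mono_left (nhdsWithin_le_nhds (s := {0}ᶜ))
    refine ⟨_, (((P_lim (L := L)).sub h1).mul hv).congr' ?_⟩
    filter_upwards [ne0_ev] with z hz
    simp only [hG, sub_zero]
    field_simp
  -- at a
  have hA : Tendsto G (𝓝[≠] a) (𝓝 (L.derivWeierstrassP a)) := by
    obtain ⟨H, hH, hHe⟩ := h.pole
    have hHe' : ∀ᶠ z in 𝓝[≠] a, ζ (z - a) = 1 / (z - a) + H (z - a) := by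
      have : ∀ᶠ z in 𝓝[≠] (a + -a), ζ z = 1 / z + H z := by rwa [add_neg_cancel]
      have := shift_ev this
      simpa [sub_eq_add_neg] using this
    have hs := (hasDerivAt_iff_tendsto_slope.1 (P_der ha1))
    have c1 : ContinuousAt (fun z => (H (z - a) - ζ (z + a) + 2 * ζ a) * (L.weierstrassP z - e)) a := by
      have b1 : ContinuousAt H (a - a) := by rw [sub_self]; exact hH.continuousAt
      have b1' : ContinuousAt (fun z => H (z - a)) a :=
        ContinuousAt.comp (f := fun z => z - a) b1 (by fun_prop)
      have haa : a + a ∉ L.lattice := by rwa [← two_mul]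
      have b2 : ContinuousAt (fun z => ζ (z + a)) a := ((h.der _ haa).comp_add_const).continuousAt
      have b3 := (P_der ha1).continuousAt
      exact ((b1'.sub b2).add continuousAt_const).mul (b3.sub continuousAt_const)
    have c2 := c1.tendsto.mono_left (nhdsWithin_le_nhds (s := {a}ᶜ))
    have c3 := hs.add c2
    have e0 : L.derivWeierstrassP a + (H (a - a) - ζ (a + a) + 2 * ζ a) * (L.weierstrassP a - e) =
      L.derivWeierstrassP a := by rw [he]; ring
    rw [e0] at c3
    refine c3.congr' ?_
    filter_upwards [hHe', self_mem_nhdsWithin] with z h3 h4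
    have : z - a ≠ 0 := sub_ne_zero.2 h4
    simp only [hG, hE, slope_def_field]
    rw [h3, ← he]
    field_simp
    ring
  have hl : ∀ z, ∃ v, Tendsto G (𝓝[≠] z) (𝓝 v) := by
    intro z
    by_cases h1 : z ∈ L.lattice
    · obtain ⟨v, hv⟩ := h0
      refine ⟨v, ?_⟩
      have := tendsto_shift (fun y => hp y z h1) hv
      rwa [zero_add] at this
    by_cases h2 : z - a ∈ L.lattice
    · have := tendsto_shift (fun y => hp y _ h2) hA
      rw [add_sub_cancel] at this
      exact ⟨_, this⟩
    by_cases h3 : z + a ∈ L.lattice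
    · have h4 : Tendsto G (𝓝[≠] (-a)) (𝓝 (L.derivWeierstrassP a)) := by
        have : Tendsto (fun y : ℂ => -y) (𝓝[≠] (-a)) (𝓝[≠] a) := by
          refine tendsto_nhdsWithin_iff.2 ⟨?_, ?_⟩
          · have := (continuous_neg.tendsto (-a)).mono_left (nhdsWithin_le_nhds (s := {-a}ᶜ))
            rwa [neg_neg] at this
          · filter_upwards [self_mem_nhdsWithin] with y hy h
            apply hy
            rw [mem_singleton_iff] at h ⊢
            rw [← h, neg_neg]
        exact (hA.comp this).congr fun y => heven y
      have := tendsto_shift (fun y => hp y _ h3) h4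
      rw [show -a + (z + a) = z by ring] at this
      exact ⟨_, this⟩
    · exact ⟨_, (hdf z h1 h2 h3).continuousAt.tendsto.mono_left nhdsWithin_le_nhds⟩
  obtain ⟨C, hC⟩ := liou hp (fun z => by
    filter_upwards [lat_ev L z, lat_ev' L z a, lat_ev' L z (-a)] with y h1 h2 h3
    exact hdf y h1 (by rwa [sub_eq_add_neg]) h2) hl
  have hCa : C = L.derivWeierstrassP a := tendsto_nhds_unique (hC a) hA
  rw [← hCa]
  exact tendsto_nhds_unique ((hdf z hz h1 h2).continuousAt.tendsto.mono_left nhdsWithin_le_nhds) (hC z)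

lemma Zt.D_ne (h : Zt L ζ R c) {a : ℂ} (ha : 2 * a ∉ L.lattice) : L.derivWeierstrassP a ≠ 0 := by
  intro h0
  have ha1 : a ∉ L.lattice := fun h' => ha (by rw [two_mul]; exact add_mem h' h')
  obtain ⟨H, hH, hHe⟩ := h.pole
  have hHe' : ∀ᶠ z in 𝓝[≠] a, ζ (z - a) = 1 / (z - a) + H (z - a) := by
    have : ∀ᶠ z in 𝓝[≠] (a + -a), ζ z = 1 / z + H z := by rwa [add_neg_cancel]
    have := shift_ev this
    simpa [sub_eq_add_neg] using this
  have c1 : ContinuousAt (fun z => 1 + (z - a) * (H (z - a) - ζ (z + a) + 2 * ζ a)) a := by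
    have b1 : ContinuousAt H (a - a) := by rw [sub_self]; exact hH.continuousAt
    have b1' : ContinuousAt (fun z => H (z - a)) a :=
      ContinuousAt.comp (f := fun z => z - a) b1 (by fun_prop)
    have haa : a + a ∉ L.lattice := by rwa [← two_mul]
    have b2 : ContinuousAt (fun z => ζ (z + a)) a := ((h.der _ haa).comp_add_const).continuousAt
    have b0 : ContinuousAt (fun z : ℂ => z - a) a := by fun_prop
    exact continuousAt_const.add (b0.mul ((b1'.sub b2).add continuousAt_const))
  have c2 : ∀ᶠ z in 𝓝 a, 1 + (z - a) * (H (z - a) - ζ (z + a) + 2 * ζ a) ≠ 0 :=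
    c1.eventually_ne (by simp)
  have c3 := c2.filter_mono (nhdsWithin_le_nhds (s := {a}ᶜ))
  have hm : ∀ᶠ y in 𝓝[≠] a, y ∉ L.lattice := lat_ev L a
  obtain ⟨y, ⟨⟨⟨⟨⟨⟨y1, y2⟩, y3⟩, y4⟩, y5⟩, y6⟩, y7⟩⟩ :=
    ((((((c3.and hHe').and (lat_ev L a)).and (lat_ev' L a a)).and (lat_ev' L a (-a))).and
      (P_nonconst' (v := L.weierstrassP a) ha1)).and self_mem_nhdsWithin).exists
  have hE := h.E_id ha y3 (by rwa [sub_eq_add_neg]) y4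
  rw [h0] at hE
  rcases mul_eq_zero.1 hE with hE | hE
  · apply y1
    rw [y2] at hE
    have : y - a ≠ 0 := sub_ne_zero.2 y7
    have : (y - a) * (1 / (y - a) + H (y - a) - ζ (y + a) + 2 * ζ a) = 0 := by rw [hE, mul_zero]
    rw [← this]; field_simp; ring
  · exact y6 (sub_eq_zero.1 hE)

lemma Zt.P_inj (h : Zt L ζ R c) {a b : ℂ} (ha : a ∉ L.lattice) (hb : b ∉ L.lattice)
    (hab : L.weierstrassP a = L.weierstrassP b) : a - b ∈ L.lattice ∨ a + b ∈ L.lattice := by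
  by_contra! hc
  by_cases hb2 : 2 * b ∈ L.lattice
  · obtain ⟨C, hC, hP⟩ := P_half_prod hb hb2
    have := hP a ha hc.2
    rw [hab, sub_self, zero_mul] at this
    exact hC this.symm
  · have := h.E_id hb2 ha hc.1 hc.2
    rw [hab, sub_self, mul_zero] at this
    exact h.D_ne hb2 this.symm

/-- addition with half period -/
lemma Zt.half_val (h : Zt L ζ R c) {q : ℂ} (hq2 : 2 * q ∈ L.lattice) :
    ζ q = R * conj q - c * q := by
  have h1 := h.per (-q) _ hq2
  rw [show -q + 2 * q = q by ring, h.odd] at h1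
  have : conj (2 * q) = 2 * conj q := conj_two q
  rw [this] at h1
  linear_combination h1 / 2

lemma half_shift {q z : ℂ} (hq2 : 2 * q ∈ L.lattice) : z - q ∈ L.lattice ↔ z + q ∈ L.lattice := by
  rw [← add_mem_iff (z := z - q) hq2, show z - q + 2 * q = z + q by ring]

lemma half_notmem {q z : ℂ} (hq2 : 2 * q ∈ L.lattice) (hz : 2 * z ∉ L.lattice) :
    z ∉ L.lattice ∧ z + q ∉ L.lattice ∧ z - q ∉ L.lattice := by
  refine ⟨fun h => hz ?_, fun h => hz ?_, fun h => hz ?_⟩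
  · rw [two_mul]; exact add_mem h h
  · have := sub_mem (add_mem h h) hq2
    rwa [show z + q + (z + q) - 2 * q = 2 * z by ring] at this
  · have := add_mem (add_mem h h) hq2
    rwa [show z - q + (z - q) + 2 * q = 2 * z by ring] at this

lemma Zt.half_add (h : Zt L ζ R c) {q z : ℂ} (hq : q ∉ L.lattice) (hq2 : 2 * q ∈ L.lattice)
    (hz : 2 * z ∉ L.lattice) : 2 * (ζ (z + q) - ζ z - (R * conj q - c * q)) *
      (L.weierstrassP z - L.weierstrassP q) = L.derivWeierstrassP z := by
  obtain ⟨z1, z2, z3⟩ := half_notmem hq2 hz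
  have h1 := h.E_id hz (z := q) hq (by rw [← neg_sub, neg_mem_iff]; exact z3) (by rwa [add_comm])
  have h2 : ζ (q - z) = -ζ (z + q) + 2 * (R * conj q - c * q) := by
    have := h.per (-(z + q)) _ hq2
    rw [show -(z + q) + 2 * q = q - z by ring, h.odd] at this
    have e : conj (2 * q) = 2 * conj q := conj_two q
    rw [e] at this
    rw [this]; ring
  rw [h2, add_comm q z] at h1
  linear_combination h1

lemma Zt.add (h : Zt L ζ R c) {a z : ℂ} (ha : 2 * a ∉ L.lattice) (hz : 2 * z ∉ L.lattice)
    (h1 : z - a ∉ L.lattice) (h2 : z + a ∉ L.lattice) :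
    2 * (ζ (z + a) - ζ z - ζ a) * (L.weierstrassP z - L.weierstrassP a) =
      L.derivWeierstrassP z - L.derivWeierstrassP a := by
  have e1 := h.E_id ha (half_notmem (q := 0) (by simp) hz).1 h1 h2
  have e2 := h.E_id hz (half_notmem (q := 0) (by simp) ha).1
    (by rwa [← neg_sub, neg_mem_iff]) (by rwa [add_comm])
  rw [← neg_sub z a, h.odd, add_comm a z] at e2
  linear_combination e2 - e1

/-- differentiated E identity -/
lemma Zt.P_diff (h : Zt L ζ R c) {a z : ℂ} (ha : 2 * a ∉ L.lattice) (hz : z ∉ L.lattice)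
    (h1 : z - a ∉ L.lattice) (h2 : z + a ∉ L.lattice) :
    (L.weierstrassP (z + a) - L.weierstrassP (z - a)) * (L.weierstrassP z - L.weierstrassP a) ^ 2 =
      -L.derivWeierstrassP a * L.derivWeierstrassP z := by
  set E : ℂ → ℂ := fun z => ζ (z - a) - ζ (z + a) + 2 * ζ a with hE
  have hEd : HasDerivAt E (-L.weierstrassP (z - a) - -L.weierstrassP (z + a)) z := by
    have a1 := (h.der _ h1).comp_sub_const
    have a2 := (h.der _ h2).comp_add_const
    exact (a1.sub a2).add_const _
  have hG := hEd.mul ((P_der hz).sub_const (L.weierstrassP a))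
  have hG2 : HasDerivAt (E * fun y => L.weierstrassP y - L.weierstrassP a) 0 z := by
    refine (hasDerivAt_const z (L.derivWeierstrassP a)).congr_of_eventuallyEq ?_
    have o1 : IsOpen {z : ℂ | z - a ∉ L.lattice} :=
      L.isClosed_lattice.isOpen_compl.preimage (continuous_sub_right a)
    have o2 : IsOpen {z : ℂ | z + a ∉ L.lattice} :=
      L.isClosed_lattice.isOpen_compl.preimage (continuous_add_const a)
    filter_upwards [lat_nhds hz, o1.mem_nhds h1, o2.mem_nhds h2] with y y1 y2 y3
    exact h.E_id ha y1 y2 y3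
  have e1 := hG.unique hG2
  have e2 := h.E_id ha hz h1 h2
  have e3 : E z * (L.weierstrassP z - L.weierstrassP a) = L.derivWeierstrassP a := e2
  linear_combination (L.weierstrassP z - L.weierstrassP a) * e1 - L.derivWeierstrassP z * e3
end HZ

namespace HZ
open ComplexConjugate MeasureTheory
variable {L L' : PeriodPair} {ζ : ℂ → ℂ} {R c q q1 q2 : ℂ}

structure Tri (L : PeriodPair) (q q1 q2 : ℂ) : Prop where
  n0 : q ∉ L.lattice
  n1 : q1 ∉ L.lattice
  n2 : q2 ∉ L.lattice
  h0 : 2 * q ∈ L.lattice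
  h1 : 2 * q1 ∈ L.lattice
  h2 : 2 * q2 ∈ L.lattice
  s : q + q1 - q2 ∈ L.lattice

namespace Tri

lemma d01 (T : Tri L q q1 q2) : q1 - q ∉ L.lattice := fun h => T.n2 (by
  have := sub_mem (add_mem h T.h0) T.s
  rwa [show q1 - q + 2 * q - (q + q1 - q2) = q2 by ring] at this)

lemma d02 (T : Tri L q q1 q2) : q2 - q ∉ L.lattice := fun h => T.n1 (by
  have := add_mem h T.s
  rwa [show q2 - q + (q + q1 - q2) = q1 by ring] at this)

lemma d12 (T : Tri L q q1 q2) : q1 - q2 ∉ L.lattice := fun h => T.n0 (by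
  have := sub_mem T.s h
  rwa [show (q + q1 - q2) - (q1 - q2) = q by ring] at this)

lemma Pne (h : Zt L ζ R c) {a b : ℂ} (ha : a ∉ L.lattice) (hb : b ∉ L.lattice)
    (hb2 : 2 * b ∈ L.lattice) (hab : a - b ∉ L.lattice) : L.weierstrassP a ≠ L.weierstrassP b := by
  intro he
  rcases h.P_inj ha hb he with h | h
  · exact hab h
  · exact hab ((half_shift hb2).2 h)

lemma e01 (T : Tri L q q1 q2) (h : Zt L ζ R c) : L.weierstrassP q1 ≠ L.weierstrassP q :=
  Pne h T.n1 T.n0 T.h0 T.d01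
lemma e02 (T : Tri L q q1 q2) (h : Zt L ζ R c) : L.weierstrassP q2 ≠ L.weierstrassP q :=
  Pne h T.n2 T.n0 T.h0 T.d02
lemma e12 (T : Tri L q q1 q2) (h : Zt L ζ R c) : L.weierstrassP q1 ≠ L.weierstrassP q2 :=
  Pne h T.n1 T.n2 T.h2 T.d12

lemma cubic (T : Tri L q q1 q2) (h : Zt L ζ R c) :
    L.weierstrassP q + L.weierstrassP q1 + L.weierstrassP q2 = 0 ∧
    ∀ z, z ∉ L.lattice → L.derivWeierstrassP z ^ 2 = 4 * (L.weierstrassP z - L.weierstrassP q) *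
      (L.weierstrassP z - L.weierstrassP q1) * (L.weierstrassP z - L.weierstrassP q2) := by
  have a0 := L.derivWeierstrassP_sq q T.n0
  have a1 := L.derivWeierstrassP_sq q1 T.n1
  have a2 := L.derivWeierstrassP_sq q2 T.n2
  rw [D_half T.h0] at a0
  rw [D_half T.h1] at a1
  rw [D_half T.h2] at a2
  have n01 := sub_ne_zero.2 (T.e01 h)
  have n02 := sub_ne_zero.2 (T.e02 h)
  have n12 := sub_ne_zero.2 (T.e12 h)
  have hz := fun z hz => L.derivWeierstrassP_sq z hz
  generalize L.weierstrassP q = e at *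
  generalize L.weierstrassP q1 = e1 at *
  generalize L.weierstrassP q2 = e2 at *
  generalize L.g₂ = g at *
  generalize L.g₃ = g' at *
  have b1 : 4 * (e1 ^ 2 + e1 * e + e ^ 2) - g = 0 := mul_left_cancel₀ n01 (by
    linear_combination a0 - a1)
  have b2 : 4 * (e2 ^ 2 + e2 * e + e ^ 2) - g = 0 := mul_left_cancel₀ n02 (by
    linear_combination a0 - a2)
  have b3 : e + e1 + e2 = 0 := mul_left_cancel₀ n12 (by linear_combination (b1 - b2) / 4)
  refine ⟨b3, fun z hz' => ?_⟩
  rw [hz z hz']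
  have e2e : e2 = -e - e1 := by linear_combination b3
  subst e2e
  have hg : g = 4 * (e1 ^ 2 + e1 * e + e ^ 2) := by linear_combination -b1
  subst hg
  linear_combination -a0

lemma prod (T : Tri L q q1 q2) {z : ℂ} (hz : z ∉ L.lattice) (hz2 : z + q ∉ L.lattice) :
    (L.weierstrassP z - L.weierstrassP q) * (L.weierstrassP (z + q) - L.weierstrassP q) =
    (L.weierstrassP q1 - L.weierstrassP q) * (L.weierstrassP q2 - L.weierstrassP q) := by
  obtain ⟨C, -, hC⟩ := P_half_prod T.n0 T.h0
  rw [hC z hz hz2, ← hC q1 T.n1 (fun h => T.d01 ((half_shift T.h0).2 h)),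
    P_congr (x := q1 + q) (y := q2) (by rw [add_comm]; exact T.s)]

lemma dprod (T : Tri L q q1 q2) {z : ℂ} (hz : z ∉ L.lattice) (hz2 : z + q ∉ L.lattice) :
    L.derivWeierstrassP z * (L.weierstrassP (z + q) - L.weierstrassP q) +
    (L.weierstrassP z - L.weierstrassP q) * L.derivWeierstrassP (z + q) = 0 := by
  have h1 := ((P_der hz).sub_const (L.weierstrassP q)).mul
    (((P_der hz2).comp_add_const).sub_const (L.weierstrassP q))
  refine h1.unique ((hasDerivAt_const z ((L.weierstrassP q1 - L.weierstrassP q) *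
    (L.weierstrassP q2 - L.weierstrassP q))).congr_of_eventuallyEq ?_)
  have o2 : IsOpen {z : ℂ | z + q ∉ L.lattice} :=
    L.isClosed_lattice.isOpen_compl.preimage (continuous_add_const q)
  filter_upwards [lat_nhds hz, o2.mem_nhds hz2] with y y1 y2
  exact T.prod y1 y2

lemma R_ne (T : Tri L q q1 q2) (h : Zt L ζ R c) : R ≠ 0 := by
  intro hR
  set f : ℂ → ℂ := fun z => ζ z + c * z with hf
  set G : ℂ → ℂ := fun z => f z ^ 2 - L.weierstrassP z with hG
  have hfp : ∀ z l, l ∈ L.lattice → f (z + l) = f z := by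
    intro z l hl
    simp only [hf]
    rw [h.per z l hl, hR]; ring
  have hp : ∀ z l, l ∈ L.lattice → G (z + l) = G z := by
    intro z l hl
    simp only [hG]
    rw [hfp z l hl, P_per z hl]
  have hdf : ∀ z, z ∉ L.lattice → DifferentiableAt ℂ G z := by
    intro z hz
    have a1 : DifferentiableAt ℂ f z :=
      (h.der z hz).differentiableAt.add (differentiableAt_id.const_mul c)
    exact (a1.pow 2).sub (P_der hz).differentiableAt
  have h0 : ∃ v, Tendsto G (𝓝[≠] 0) (𝓝 v) := by
    obtain ⟨H, hH, hHe⟩ := h.pole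
    have hH0 : H 0 = 0 := by
      have hn : Tendsto (fun y : ℂ => -y) (𝓝[≠] 0) (𝓝[≠] 0) := by
        refine tendsto_nhdsWithin_iff.2 ⟨?_, ?_⟩
        · have := (continuous_neg.tendsto (0:ℂ)).mono_left (nhdsWithin_le_nhds (s := {0}ᶜ))
          rwa [neg_zero] at this
        · filter_upwards [self_mem_nhdsWithin] with y hy
          simpa using hy
      have t1 : Tendsto H (𝓝[≠] 0) (𝓝 (H 0)) :=
        hH.continuousAt.tendsto.mono_left nhdsWithin_le_nhds
      have t2 := t1.comp hn
      have t3 : Tendsto (fun y => -H y) (𝓝[≠] 0) (𝓝 (H 0)) := by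
        refine t2.congr' ?_
        filter_upwards [hHe, hn.eventually hHe] with y y1 y2
        rw [h.odd, y1] at y2
        simp only [Function.comp]
        linear_combination -y2 + (by rw [div_neg]; ring : 1 / y + 1 / (-y) = 0)
      have := tendsto_nhds_unique t3 t1.neg
      linear_combination this / 2
    set K : ℂ → ℂ := fun z => H z + c * z with hK
    have hKd : HasDerivAt K (deriv H 0 + c * 1) 0 :=
      hH.differentiableAt.hasDerivAt.add ((hasDerivAt_id 0).const_mul c)
    have hK0 : K 0 = 0 := by simp [hK, hH0]
    have s1 := hasDerivAt_iff_tendsto_slope.1 hKd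
    have s2 := hKd.continuousAt.tendsto.mono_left (nhdsWithin_le_nhds (s := {0}ᶜ))
    have s3 := (L.analyticAt_weierstrassPExcept 0).continuousAt.tendsto.mono_left
      (nhdsWithin_le_nhds (s := {0}ᶜ))
    refine ⟨_, (((s1.const_mul 2).add (s2.pow 2)).sub s3).congr' ?_⟩
    filter_upwards [hHe, ne0_ev] with z z1 z2
    simp only [hG, hf, slope_def_field, hK0]
    rw [z1, P_split]
    simp only [hK]
    field_simp
    ring
  obtain ⟨C, hC⟩ := liou hp (fun z => by
    filter_upwards [lat_ev L z] with y h1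
    exact hdf y h1) (fun z => by
    by_cases h1 : z ∈ L.lattice
    · obtain ⟨v, hv⟩ := h0
      refine ⟨v, ?_⟩
      have := tendsto_shift (fun y => hp y z h1) hv
      rwa [zero_add] at this
    · exact ⟨_, (hdf z h1).continuousAt.tendsto.mono_left nhdsWithin_le_nhds⟩)
  have hGC : ∀ z, z ∉ L.lattice → G z = C := fun z h1 =>
    tendsto_nhds_unique ((hdf z h1).continuousAt.tendsto.mono_left nhdsWithin_le_nhds) (hC z)
  have fq : ∀ q, 2 * q ∈ L.lattice → f q = 0 := by
    intro q hq
    simp only [hf]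
    rw [h.half_val hq, hR]; ring
  have g0 := hGC q T.n0
  have g1 := hGC q1 T.n1
  simp only [hG] at g0 g1
  rw [fq _ T.h0] at g0
  rw [fq _ T.h1] at g1
  exact T.e01 h (by linear_combination g0 - g1)
end Tri

noncomputable def FF (ζ : ℂ → ℂ) (R c : ℂ) (z : ℂ) : ℂ := (ζ z + c * z) / R

lemma Zt.FF_der (h : Zt L ζ R c) {z : ℂ} (hz : z ∉ L.lattice) :
    HasDerivAt (FF ζ R c) ((c - L.weierstrassP z) / R) z := by
  have h1 := ((h.der z hz).add ((hasDerivAt_id z).const_mul c)).div_const R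
  have e : (c - L.weierstrassP z) / R = (-L.weierstrassP z + c * 1) / R := by ring
  rw [e]; exact h1

lemma Zt.FF_per (h : Zt L ζ R c) (hR : R ≠ 0) (z l : ℂ) (hl : l ∈ L.lattice) :
    FF ζ R c (z + l) = FF ζ R c z + conj l := by
  rw [FF, FF, h.per z l hl]; field_simp; ring

lemma Zt.FF_odd (h : Zt L ζ R c) (z : ℂ) : FF ζ R c (-z) = -FF ζ R c z := by
  rw [FF, FF, h.odd]; ring

lemma Zt.core (h : Zt L ζ R c) (hR : R ≠ 0) : ∃ c0, Core L (FF ζ R c) c0 := by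
  have key : ∀ c0, (∀ z, z ∉ L.lattice → deriv (FF ζ R c) z = 0 →
      z - c0 ∈ L.lattice ∨ z + c0 ∈ L.lattice) → Core L (FF ζ R c) c0 := by
    intro c0 hc
    refine ⟨fun z hz => (h.FF_der hz).differentiableAt, h.FF_per hR, h.FF_odd, ?_, hc⟩
    obtain ⟨H, hH, hHe⟩ := h.pole
    refine ⟨1 / R, by simpa using hR, fun z => (H z + c * z) / R, ?_, ?_⟩
    · exact (hH.add (analyticAt_const.mul analyticAt_id)).div analyticAt_const hR
    · filter_upwards [hHe] with z hz
      rw [FF, hz]; ring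
  by_cases hex : ∃ z0, z0 ∉ L.lattice ∧ L.weierstrassP z0 = c
  · obtain ⟨z0, h0, h1⟩ := hex
    refine ⟨z0, key z0 fun z hz hd => ?_⟩
    rw [(h.FF_der hz).deriv, div_eq_zero_iff, or_iff_left hR] at hd
    exact h.P_inj hz h0 (by rw [h1]; linear_combination -hd)
  · refine ⟨0, key 0 fun z hz hd => ?_⟩
    rw [(h.FF_der hz).deriv, div_eq_zero_iff, or_iff_left hR] at hd
    exact absurd ⟨z, hz, by linear_combination -hd⟩ hex

noncomputable def F1 (ζ : ℂ → ℂ) (R c q : ℂ) (z : ℂ) : ℂ :=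
  (FF ζ R c z + FF ζ R c (z + q)) / 2 - conj q / 2

lemma Zt.F1_der (h : Zt L ζ R c) {z : ℂ} (hz : z ∉ L.lattice) (hz2 : z + q ∉ L.lattice) :
    HasDerivAt (F1 ζ R c q)
      ((c - (L.weierstrassP z + L.weierstrassP (z + q)) / 2) / R) z := by
  have h1 := (((h.FF_der hz).add ((h.FF_der hz2).comp_add_const)).div_const 2).sub_const (conj q / 2)
  have e : (c - (L.weierstrassP z + L.weierstrassP (z + q)) / 2) / R =
    ((c - L.weierstrassP z) / R + (c - L.weierstrassP (z + q)) / R) / 2 := by ring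
  rw [e]; exact h1

lemma Zt.core1 (h : Zt L ζ R c) (T : Tri L q q1 q2)
    (hL : ∀ z, z ∈ L'.lattice ↔ z ∈ L.lattice ∨ z + q ∈ L.lattice) :
    ∃ c0, Core L' (F1 ζ R c q) c0 := by
  have hR := T.R_ne h
  have nm : ∀ {z}, z ∉ L'.lattice → z ∉ L.lattice ∧ z + q ∉ L.lattice := by
    intro z hz
    rw [hL] at hz
    push Not at hz
    exact hz
  have hFq : ∀ z, FF ζ R c (z + 2 * q) = FF ζ R c z + 2 * conj q := by
    intro z; rw [h.FF_per hR z _ T.h0, conj_two]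
  have per0 : ∀ z l, l ∈ L.lattice → F1 ζ R c q (z + l) = F1 ζ R c q z + conj l := by
    intro z l hl
    rw [F1, F1, show z + l + q = z + q + l by ring, h.FF_per hR _ _ hl, h.FF_per hR _ _ hl]
    ring
  have perq : ∀ z, F1 ζ R c q (z + q) = F1 ζ R c q z + conj q := by
    intro z
    rw [F1, F1, show z + q + q = z + 2 * q by ring, hFq]
    ring
  have key : ∀ c0, (∀ z, z ∉ L'.lattice → deriv (F1 ζ R c q) z = 0 →
      z - c0 ∈ L'.lattice ∨ z + c0 ∈ L'.lattice) → Core L' (F1 ζ R c q) c0 := by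
    intro c0 hc
    refine ⟨fun z hz => (h.F1_der (nm hz).1 (nm hz).2).differentiableAt, ?_, ?_, ?_, hc⟩
    · intro z l hl
      rcases (hL l).1 hl with hl | hl
      · exact per0 z l hl
      · have e1 := per0 z _ hl
        have e2 := perq (z + l)
        rw [show z + l + q = z + (l + q) by ring, e1, map_add] at e2
        linear_combination -e2
    · intro z
      have e1 := hFq (-(z + q))
      rw [h.FF_odd, show -(z + q) + 2 * q = -z + q by ring] at e1
      rw [F1, F1, h.FF_odd, e1]
      ring
    · obtain ⟨H, hH, hHe⟩ := h.pole
      refine ⟨1 / (2 * R), by simpa using hR, fun z => ((H z + c * z) / R + FF ζ R c (z + q)) / 2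
        - conj q / 2, ?_, ?_⟩
      · have a1 : AnalyticAt ℂ (FF ζ R c) ((fun z : ℂ => z + q) 0) := by
          have hd : DifferentiableOn ℂ (FF ζ R c) (L.lattice : Set ℂ)ᶜ := fun z hz =>
            (h.FF_der hz).differentiableAt.differentiableWithinAt
          refine hd.analyticAt (L.isClosed_lattice.isOpen_compl.mem_nhds ?_)
          simpa using T.n0
        have a2 := a1.comp (f := fun z : ℂ => z + q) (by fun_prop)
        exact ((((hH.add (analyticAt_const.mul analyticAt_id)).div analyticAt_const hR).add a2).div
          analyticAt_const two_ne_zero).sub analyticAt_const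
      · filter_upwards [hHe] with z hz
        rw [F1]
        nth_rewrite 1 [FF]
        rw [hz]
        field_simp
        ring
  have hd : ∀ z, z ∉ L'.lattice → deriv (F1 ζ R c q) z = 0 →
      L.weierstrassP z + L.weierstrassP (z + q) = 2 * c := by
    intro z hz hd
    rw [(h.F1_der (nm hz).1 (nm hz).2).deriv, div_eq_zero_iff, or_iff_left hR] at hd
    linear_combination -2 * hd
  by_cases hex : ∃ z0, z0 ∉ L'.lattice ∧ L.weierstrassP z0 + L.weierstrassP (z0 + q) = 2 * c
  · obtain ⟨z0, h0, h1⟩ := hex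
    refine ⟨z0, key z0 fun z hz hd' => ?_⟩
    have h2 := hd z hz hd'
    have p1 := T.prod (nm hz).1 (nm hz).2
    have p2 := T.prod (nm h0).1 (nm h0).2
    have p3 : (L.weierstrassP z - L.weierstrassP z0) *
        (L.weierstrassP z - L.weierstrassP (z0 + q)) = 0 := by
      linear_combination (L.weierstrassP z - L.weierstrassP q) * (h2 - h1) - p1 + p2
    rcases mul_eq_zero.1 p3 with h3 | h3
    · rcases h.P_inj (nm hz).1 (nm h0).1 (sub_eq_zero.1 h3) with h4 | h4
      · exact Or.inl ((hL _).2 (Or.inl h4))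
      · exact Or.inr ((hL _).2 (Or.inl h4))
    · rcases h.P_inj (nm hz).1 (nm h0).2 (sub_eq_zero.1 h3) with h4 | h4
      · refine Or.inl ((hL _).2 (Or.inr ?_))
        rw [← half_shift T.h0]
        rwa [sub_sub]
      · refine Or.inr ((hL _).2 (Or.inr ?_))
        rwa [add_assoc]
  · refine ⟨0, key 0 fun z hz hd' => ?_⟩
    exact absurd ⟨z, hz, hd z hz hd'⟩ hex
end HZ

namespace HZ
open ComplexConjugate MeasureTheory
variable {L L' : PeriodPair} {ζ : ℂ → ℂ} {R c q q1 q2 : ℂ}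

lemma mid_lt {a b m : ℂ} {ρ : ℝ} (ha : ‖a‖ ≤ ρ) (hb : ‖b‖ ≤ ρ) (hab : a ≠ b) (hm : a + b = 2 * m) :
    ‖m‖ < ρ := by
  have h1 := parallelogram_law_with_norm ℝ a b
  have h2 : 0 < ‖a - b‖ := norm_pos_iff.2 (sub_ne_zero.2 hab)
  rw [hm, norm_mul, Complex.norm_ofNat] at h1
  have := norm_nonneg a; have := norm_nonneg b; have := norm_nonneg m
  by_contra! hc
  nlinarith [mul_self_le_mul_self (norm_nonneg a) ha, mul_self_le_mul_self (norm_nonneg b) hb,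
    mul_self_le_mul_self (le_trans (norm_nonneg a) ha) hc, mul_pos h2 h2]

lemma mid_le {a b m : ℂ} {ρ : ℝ} (ha : ‖a‖ ≤ ρ) (hb : ‖b‖ ≤ ρ) (hm : a + b = 2 * m) :
    ‖m‖ ≤ ρ := by
  have h1 := norm_add_le a b
  rw [hm, norm_mul, Complex.norm_ofNat] at h1
  linarith

theorem final (h : Zt L ζ R c) (T : Tri L q q1 q2)
    (hL : ∀ z, z ∈ L'.lattice ↔ z ∈ L.lattice ∨ z + q ∈ L.lattice)
    {z : ℂ} (hz : 2 * z ∉ L.lattice) (hx : ζ (z + q) = R * conj (z + q) - c * (z + q))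
    (hm : (ζ z - (R * conj z - c * z)) ^ 2 = L.weierstrassP z - L.weierstrassP q) : False := by
  have hR := T.R_ne h
  have hRn : 0 < ‖R‖ := norm_pos_iff.2 hR
  obtain ⟨hsum, hcub⟩ := T.cubic h
  obtain ⟨z1, z2, z3⟩ := half_notmem T.h0 hz
  obtain ⟨e, he⟩ : ∃ e, e = L.weierstrassP q := ⟨_, rfl⟩
  obtain ⟨α, hα⟩ : ∃ α, α = L.weierstrassP q1 - e := ⟨_, rfl⟩
  obtain ⟨β, hβ⟩ : ∃ β, β = L.weierstrassP q2 - e := ⟨_, rfl⟩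
  have hα0 : α ≠ 0 := by rw [hα, he]; exact sub_ne_zero.2 (T.e01 h)
  have hβ0 : β ≠ 0 := by rw [hβ, he]; exact sub_ne_zero.2 (T.e02 h)
  have hP1 : L.weierstrassP q1 = e + α := by rw [hα]; ring
  have hP2 : L.weierstrassP q2 = e + β := by rw [hβ]; ring
  have hαβ : α + β = -3 * e := by rw [← he, hP1, hP2] at hsum; linear_combination hsum
  have hprod : ∀ y, y ∉ L.lattice → y + q ∉ L.lattice →
      (L.weierstrassP y - e) * (L.weierstrassP (y + q) - e) = α * β := by
    intro y y1 y2
    have := T.prod y1 y2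
    rwa [← he, ← hα, ← hβ] at this
  have hcub' : ∀ y, y ∉ L.lattice → L.derivWeierstrassP y ^ 2 =
      4 * (L.weierstrassP y - e) * (L.weierstrassP y - e - α) * (L.weierstrassP y - e - β) := by
    intro y hy
    rw [hcub y hy, hP1, hP2, ← he]; ring
  have htne : ∀ y, y ∉ L.lattice → y + q ∉ L.lattice → L.weierstrassP y - e ≠ 0 := by
    intro y y1 y2 h0
    have := hprod y y1 y2
    rw [h0, zero_mul] at this
    exact mul_ne_zero hα0 hβ0 this.symm
  -- values at z and x
  have hs0 := htne z z1 z2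
  have hPz : (α + β) * (L.weierstrassP z - e) = α * β := by
    have a1 := h.half_add T.n0 T.h0 hz
    have a2 := hcub' z z1
    rw [← he] at a1 hm
    rw [hx, map_add] at a1
    rw [← a1] at a2
    have a3 : (L.weierstrassP z - e) * 4 *
      ((α + β) * (L.weierstrassP z - e) - α * β) = 0 := by
      linear_combination a2 - 4 * (L.weierstrassP z - e) ^ 2 * hm
    have a4 : (L.weierstrassP z - e) * 4 ≠ 0 := mul_ne_zero hs0 (by norm_num)
    exact sub_eq_zero.1 ((mul_eq_zero.1 a3).resolve_left a4)
  have hαβ0 : α + β ≠ 0 := by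
    intro h0
    rw [h0, zero_mul] at hPz
    exact mul_ne_zero hα0 hβ0 hPz.symm
  have he0 : e ≠ 0 := by
    intro h0; rw [h0] at hαβ; exact hαβ0 (by rw [hαβ]; ring)
  have hPx' : L.weierstrassP (z + q) - e = α + β := by
    apply mul_left_cancel₀ hs0
    rw [hprod z z1 z2, ← hPz]; ring
  have hPx : L.weierstrassP (z + q) = -2 * e := by
    linear_combination hPx' + hαβ
  -- find w
  have hw : ∃ w, 2 * w - z ∈ L.lattice ∧ (L.weierstrassP w - e) ^ 2 = -(α * β) := by
    set u := z / 2 with hu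
    have hu2 : 2 * u = z := by rw [hu]; ring
    have hu2' : 2 * u ∉ L.lattice := by rwa [hu2]
    obtain ⟨u1, u2, -⟩ := half_notmem T.h0 hu2'
    have d1 := h.P_diff hu2' u2 (by rw [add_sub_cancel_left]; exact T.n0)
      (by rw [show u + q + u = z + q by rw [← hu2]; ring]; exact z2)
    rw [add_sub_cancel_left, show u + q + u = z + q by rw [← hu2]; ring, ← he, hPx'] at d1
    have d2 := T.dprod u1 u2
    rw [← he] at d2
    have d3 := hprod u u1 u2
    have d4 := hcub' u u1
    have ht0 := htne u u1 u2
    obtain ⟨t, ht⟩ : ∃ t, t = L.weierstrassP u - e := ⟨_, rfl⟩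
    obtain ⟨t', ht'⟩ : ∃ t', t' = L.weierstrassP (u + q) - e := ⟨_, rfl⟩
    have hd : L.weierstrassP (u + q) - L.weierstrassP u = t' - t := by rw [ht, ht']; ring
    rw [hd] at d1
    rw [← ht] at d2 d3 d4 ht0
    rw [← ht'] at d2 d3
    have k1 : t * ((α + β) * (t' - t) ^ 2 - 4 * (t - α) * (t - β) * t') = 0 := by
      linear_combination t * d1 - L.derivWeierstrassP u * d2 + t' * d4
    have k2 := (mul_eq_zero.1 k1).resolve_left ht0
    have k3 : (t ^ 2 + α * β) * ((α + β) * (t ^ 2 + α * β) - 4 * α * β * t) = 0 := by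
      linear_combination t ^ 2 * k2 +
        (4 * t * (t - α) * (t - β) - (α + β) * (t * t' + α * β - 2 * t ^ 2)) * d3
    rcases mul_eq_zero.1 k3 with k | k
    · refine ⟨u, ?_, ?_⟩
      · rw [hu2, sub_self]; exact zero_mem _
      · rw [← ht]; linear_combination k
    · refine ⟨u + q1, ?_, ?_⟩
      · rw [show 2 * (u + q1) - z = 2 * q1 by rw [← hu2]; ring]; exact T.h1
      · have T' : Tri L q1 q q2 := ⟨T.n1, T.n0, T.n2, T.h1, T.h0, T.h2, by
          rw [add_comm q1]; exact T.s⟩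
        obtain ⟨-, v2, -⟩ := half_notmem T.h1 hu2'
        have m1 := T'.prod u1 v2
        rw [hP1, hP2, ← he] at m1
        have hu' : L.weierstrassP u = e + t := by rw [ht]; ring
        rw [hu'] at m1
        have hta : t - α ≠ 0 := by
          intro h0
          have : (e + α - e) = 0 ∨ (e + β - (e + α)) = 0 := by
            right
            have : (e - (e + α)) * (e + β - (e + α)) = 0 := by
              linear_combination -m1 + (L.weierstrassP (u + q1) - (e + α)) * h0
            exact (mul_eq_zero.1 this).resolve_left (by
              rw [show e - (e + α) = -α by ring]; exact neg_ne_zero.2 hα0)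
          rcases this with h' | h'
          · exact hα0 (by linear_combination h')
          · exact T.e12 h (by rw [hP1, hP2]; linear_combination -h')
        obtain ⟨S, hS⟩ : ∃ S, S = L.weierstrassP (u + q1) - e := ⟨_, rfl⟩
        rw [← hS]
        have m2 : (t - α) * S = α * (t - β) := by
          rw [hS]; linear_combination m1
        have m3 : (t - α) ^ 2 * (S ^ 2 + α * β) = 0 := by
          linear_combination ((t - α) * S + α * (t - β)) * m2 + α * k
        have m4 := (mul_eq_zero.1 m3).resolve_left (pow_ne_zero 2 hta)
        linear_combination m4
  obtain ⟨w, hwz, hwt⟩ := hw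
  have hw2 : 2 * w ∉ L.lattice := fun h' => z1 (by
    have := sub_mem h' hwz; rwa [sub_sub_cancel] at this)
  obtain ⟨w1, w2, w3⟩ := half_notmem T.h0 hw2
  have hwx : w + q + w ∉ L.lattice := fun h' => z2 (by
    have := sub_mem h' hwz
    rwa [show w + q + w - (2 * w - z) = z + q by ring] at this)
  have hT0 := htne w w1 w2
  have hTT := hprod w w1 w2
  have hTv : L.weierstrassP (w + q) - e = -(L.weierstrassP w - e) := by
    apply mul_left_cancel₀ hT0
    rw [hTT]; linear_combination hwt
  have hDv : L.derivWeierstrassP (w + q) = L.derivWeierstrassP w := by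
    have := T.dprod w1 w2
    rw [← he, hTv] at this
    apply mul_left_cancel₀ hT0
    linear_combination this
  have hFw : Zf (F1 ζ R c q) w = 0 := by
    have a1 := h.add hw2 (z := w + q) (fun h' => hw2 (by
      have := sub_mem h' T.h0
      rwa [show 2 * (w + q) - 2 * q = 2 * w by ring] at this))
      (by rw [add_sub_cancel_left]; exact T.n0) hwx
    rw [hDv, sub_self] at a1
    have a2 : L.weierstrassP (w + q) - L.weierstrassP w ≠ 0 := by
      have : L.weierstrassP (w + q) - L.weierstrassP w = -2 * (L.weierstrassP w - e) := by
        linear_combination hTv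
      rw [this]
      exact mul_ne_zero (by norm_num) hT0
    have a3 := (mul_eq_zero.1 a1).resolve_right a2
    have a4 := h.per (z + q) _ hwz
    rw [show z + q + (2 * w - z) = w + q + w by ring, hx, map_add, map_sub, conj_two] at a4
    rw [Zf, F1, FF, FF]
    field_simp
    linear_combination a4 - a3 / 2
  have hw2' : 2 * w ∉ L'.lattice := by
    rw [hL]; push Not
    exact ⟨hw2, by rwa [show 2 * w + q = w + q + w by ring]⟩
  obtain ⟨c1, hc1⟩ := h.core1 T hL
  obtain ⟨c0, hc0⟩ := h.core hR
  -- half periods of L'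
  have q1q : q1 + q ∉ L.lattice := fun h' => T.d01 ((half_shift T.h0).2 h')
  have hq1n : q1 ∉ L'.lattice := by
    rw [hL]; push Not; exact ⟨T.n1, q1q⟩
  have hgen : ∀ y, 2 * y - q ∈ L.lattice → y ∉ L.lattice ∧ y + q ∉ L.lattice := by
    intro y hy
    have hy2 : 2 * y ∉ L.lattice := fun h' => T.n0 (by
      have := sub_mem h' hy; rwa [sub_sub_cancel] at this)
    have := half_notmem T.h0 hy2
    exact ⟨this.1, this.2.1⟩
  have hgenL : ∀ y, 2 * y - q ∈ L.lattice → y ∉ L'.lattice ∧ 2 * y ∈ L'.lattice := by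
    intro y hy
    refine ⟨?_, ?_⟩
    · rw [hL]; push Not; exact hgen y hy
    · rw [hL]; right; exact (half_shift T.h0).1 hy
  obtain ⟨p, hp⟩ : ∃ p, p = q / 2 := ⟨_, rfl⟩
  have hp2 : 2 * p - q ∈ L.lattice := by
    rw [hp, show 2 * (q / 2) - q = 0 by ring]; exact zero_mem _
  obtain ⟨p', hp'⟩ : ∃ p', p' = q / 2 + q1 := ⟨_, rfl⟩
  have hp2' : 2 * p' - q ∈ L.lattice := by
    rw [hp', show 2 * (q / 2 + q1) - q = 2 * q1 by ring]; exact T.h1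
  have hPg : ∀ y, 2 * y - q ∈ L.lattice → L.weierstrassP (y + q) = L.weierstrassP y ∧
      (L.weierstrassP y - e) ^ 2 = α * β ∧ deriv (F1 ζ R c q) y = (c - L.weierstrassP y) / R := by
    intro y hy
    have a1 : L.weierstrassP (y + q) = L.weierstrassP y := by
      rw [← L.weierstrassP_neg y]
      refine P_congr ?_
      have := add_mem hy T.h0
      rwa [show 2 * y - q + 2 * q = y + q - -y by ring] at this
    have hy' := hgen y hy
    refine ⟨a1, ?_, ?_⟩
    · have := hprod y hy'.1 hy'.2
      rw [a1] at this
      linear_combination this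
    · rw [(h.F1_der hy'.1 hy'.2).deriv, a1]; ring
  obtain ⟨-, s1, f1⟩ := hPg p hp2
  obtain ⟨-, s2, f2⟩ := hPg p' hp2'
  have hpp : L.weierstrassP p ≠ L.weierstrassP p' := by
    intro h0
    rcases h.P_inj (hgen p hp2).1 (hgen p' hp2').1 h0 with h' | h'
    · rw [hp, hp', show q / 2 - (q / 2 + q1) = -q1 by ring, neg_mem_iff] at h'
      exact T.n1 h'
    · rw [hp, hp', show q / 2 + (q / 2 + q1) = q1 + q by ring] at h'
      exact q1q h'
  have hpsum : L.weierstrassP p + L.weierstrassP p' = 2 * e := by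
    have : (L.weierstrassP p - L.weierstrassP p') *
      (L.weierstrassP p + L.weierstrassP p' - 2 * e) = 0 := by linear_combination s1 - s2
    exact sub_eq_zero.1 ((mul_eq_zero.1 this).resolve_left (sub_ne_zero.2 hpp))
  have hdiff1 : p' - p ∉ L'.lattice := by
    rw [hp, hp', add_sub_cancel_left]; exact hq1n
  have hq1L : 2 * q1 ∈ L'.lattice := (hL _).2 (Or.inl T.h1)
  have hd2 : ∀ y, 2 * y - q ∈ L.lattice → y - q1 ∉ L'.lattice := by
    intro y hy
    refine (hgenL (y - q1) ?_).1
    have := sub_mem hy T.h1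
    rw [show 2 * (y - q1) - q = 2 * y - q - 2 * q1 by ring]; exact this
  have hd3 : ∀ y, 2 * y - q ∈ L.lattice → q1 - y ∉ L'.lattice := by
    intro y hy h'
    refine hd2 y hy ?_
    rw [← neg_sub, neg_mem_iff]; exact h'
  have nle : ∀ v : ℂ, ‖(c - v) / R‖ ≤ 1 → ‖c - v‖ ≤ ‖R‖ := by
    intro v hv; rwa [norm_div, div_le_one hRn] at hv
  -- C1 at q1
  have step1 : ‖R‖ ≤ ‖c + e / 2‖ := by
    have := hc1.C1 hw2' hFw hq1n hq1L (hgenL p hp2).1 (hgenL p hp2).2 (hgenL p' hp2').1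
      (hgenL p' hp2').2 (hd2 p hp2) (hd2 p' hp2') (by
        rw [← neg_sub, neg_mem_iff]; exact hdiff1)
    rw [(h.F1_der T.n1 q1q).deriv, P_congr (x := q1 + q) (y := q2)
      (by rw [add_comm]; exact T.s), hP1, hP2, norm_div, le_div_iff₀ hRn, one_mul] at this
    rwa [show c - (e + α + (e + β)) / 2 = c + e / 2 by linear_combination -hαβ / 2] at this
  have step2 : ‖c - e‖ ≤ ‖R‖ := by
    by_contra! hlt
    have hdw : 1 < ‖deriv (F1 ζ R c q) w‖ := by
      rw [(h.F1_der w1 w2).deriv, show (L.weierstrassP w + L.weierstrassP (w + q)) / 2 = e by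
        linear_combination hTv / 2, norm_div, one_lt_div hRn]
      exact hlt
    have b1 := hc1.C2 hw2' hFw (hgenL p hp2).1 (hgenL p hp2).2 (hgenL p' hp2').1
      (hgenL p' hp2').2 hq1n hq1L hdiff1 (hd3 p hp2) (hd2 p' hp2') hdw
    have b2 := hc1.C2 hw2' hFw (hgenL p' hp2').1 (hgenL p' hp2').2 (hgenL p hp2).1
      (hgenL p hp2).2 hq1n hq1L (by rw [← neg_sub, neg_mem_iff]; exact hdiff1)
      (hd3 p' hp2') (hd2 p hp2) hdw
    rw [f1] at b1
    rw [f2] at b2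
    have := mid_le (nle _ b1) (nle _ b2) (m := c - e) (by linear_combination -hpsum)
    linarith
  have hx2 : 2 * (z + q) ∉ L.lattice := fun h' => hz (by
    have := sub_mem h' T.h0
    rwa [show 2 * (z + q) - 2 * q = 2 * z by ring] at this)
  have hFx : Zf (FF ζ R c) (z + q) = 0 := by
    rw [Zf, FF, hx]; field_simp; ring
  have sw : ∀ {a b : ℂ}, a - b ∉ L.lattice → b - a ∉ L.lattice := by
    intro a b hab; rwa [← neg_sub, neg_mem_iff]
  by_cases hlt : ‖R‖ < ‖c + 2 * e‖
  · have hdx : 1 < ‖deriv (FF ζ R c) (z + q)‖ := by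
      rw [(h.FF_der z2).deriv, hPx, norm_div, one_lt_div hRn,
        show c - -2 * e = c + 2 * e by ring]
      exact hlt
    have b1 := hc0.C2 hx2 hFx T.n1 T.h1 T.n0 T.h0 T.n2 T.h2 (sw T.d01) (sw T.d12) (sw T.d02) hdx
    have b2 := hc0.C2 hx2 hFx T.n2 T.h2 T.n0 T.h0 T.n1 T.h1 (sw T.d02) T.d12 (sw T.d01) hdx
    rw [(h.FF_der T.n1).deriv] at b1
    rw [(h.FF_der T.n2).deriv] at b2
    have := mid_lt (nle _ b1) (nle _ b2) (fun h0 => T.e12 h (by linear_combination -h0))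
      (m := c + e / 2) (by rw [hP1, hP2]; linear_combination -hαβ)
    linarith
  · push Not at hlt
    have := mid_lt hlt step2 (fun h0 => he0 (by linear_combination h0 / 3))
      (m := c + e / 2) (by ring)
    linarith
end HZ

namespace HZ
open ComplexConjugate MeasureTheory

lemma mem_re {τ : ℂ} (h : 0 < τ.im) (a b : ℝ) :
    (a : ℂ) + b * τ ∈ (Lt τ h).lattice ↔ ∃ m n : ℤ, a = m ∧ b = n := by
  rw [mem_Lt]
  constructor
  · rintro ⟨m, n, e⟩
    have e1 := congrArg Complex.im e
    have e2 := congrArg Complex.re e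
    simp at e1 e2
    have e3 : b = n := by
      rcases e1 with e1 | e1
      · exact e1.symm
      · exact absurd e1 h.ne'
    refine ⟨m, n, ?_, e3⟩
    rw [e3] at e2; linarith
  · rintro ⟨m, n, rfl, rfl⟩
    exact ⟨m, n, by push_cast; rfl⟩

lemma half_int {m : ℤ} (h : (1 / 2 : ℝ) = m) : False := by
  have : (1 : ℝ) = ((2 * m : ℤ) : ℝ) := by push_cast; linarith
  have : (1 : ℤ) = 2 * m := by exact_mod_cast this
  omega

noncomputable def Lh (τ : ℂ) (h : 0 < τ.im) : PeriodPair where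
  ω₁ := 1 / 2
  ω₂ := τ
  indep := by
    rw [LinearIndependent.pair_iff]
    intro s t e
    have e1 := congrArg Complex.im e
    have e2 := congrArg Complex.re e
    simp at e1 e2
    rcases e1 with e1 | e1
    · subst e1; simpa using e2
    · exact absurd e1 h.ne'

lemma conj_ne {τ : ℂ} (h : 0 < τ.im) : conj τ - τ ≠ 0 := by
  intro h0
  have := congrArg Complex.im h0
  simp at this
  linarith

noncomputable def Rt (τ : ℂ) : ℂ := (eta2 τ - τ * eta1 τ) / (conj τ - τ)

noncomputable def ct (τ : ℂ) : ℂ := Rt τ - eta1 τ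

lemma eta1_eq (τ : ℂ) : eta1 τ = Rt τ * conj 1 - ct τ * 1 := by
  rw [ct, map_one]; ring

lemma eta2_eq {τ : ℂ} (h : 0 < τ.im) : eta2 τ = Rt τ * conj τ - ct τ * τ := by
  have := conj_ne h
  have h1 : Rt τ * (conj τ - τ) = eta2 τ - τ * eta1 τ := by
    rw [Rt]; field_simp
  rw [ct]; linear_combination -h1

open Classical in
noncomputable def zt (τ : ℂ) (h : 0 < τ.im) (z : ℂ) : ℂ :=
  if z ∈ (Lt τ h).lattice then Rt τ * conj z - ct τ * z else wzeta τ z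

lemma zt_in {τ : ℂ} (h : 0 < τ.im) {z : ℂ} (hz : z ∈ (Lt τ h).lattice) :
    zt τ h z = Rt τ * conj z - ct τ * z := by rw [zt, if_pos hz]

lemma zt_out {τ : ℂ} (h : 0 < τ.im) {z : ℂ} (hz : z ∉ (Lt τ h).lattice) :
    zt τ h z = wzeta τ z := by rw [zt, if_neg hz]

lemma gen_per {τ : ℂ} (h : 0 < τ.im) {w A : ℂ} (hw : w ∈ (Lt τ h).lattice)
    (hA : ∀ z, z ∉ (Lt τ h).lattice → wzeta τ (z + w) = wzeta τ z + A) (n : ℤ) :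
    ∀ z, z ∉ (Lt τ h).lattice → wzeta τ (z + n * w) = wzeta τ z + n * A := by
  have hm : ∀ n : ℤ, (n : ℂ) * w ∈ (Lt τ h).lattice := fun n => by
    have := Submodule.smul_mem _ n hw
    rwa [zsmul_eq_mul] at this
  have hz' : ∀ z, z ∉ (Lt τ h).lattice → ∀ n : ℤ, z + n * w ∉ (Lt τ h).lattice :=
    fun z hz n h' => hz (by
      have := sub_mem h' (hm n); rwa [add_sub_cancel_right] at this)
  intro z hz
  induction n using Int.induction_on with
  | zero => simp
  | succ i ih =>
    have := hA _ (hz' z hz i)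
    rw [ih] at this
    push_cast at this ⊢
    rw [show z + ((i : ℂ) + 1) * w = z + i * w + w by ring, this]; ring
  | pred i ih =>
    have := hA _ (hz' z hz (-i - 1))
    push_cast at this ih ⊢
    rw [show z + (-(i : ℂ) - 1) * w + w = z + -(i : ℂ) * w by ring, ih] at this
    linear_combination -this

lemma zt_Zt {τ : ℂ} (h : 0 < τ.im) : Zt (Lt τ h) (zt τ h) (Rt τ) (ct τ) where
  der z hz := by
    refine (wzeta_deriv h hz).congr_of_eventuallyEq ?_
    filter_upwards [(Lt τ h).isClosed_lattice.isOpen_compl.mem_nhds hz] with y hy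
    exact zt_out h hy
  per z l hl := by
    by_cases hz : z ∈ (Lt τ h).lattice
    · rw [zt_in h hz, zt_in h (add_mem hz hl), map_add]; ring
    · have hzl : z + l ∉ (Lt τ h).lattice := fun h' => hz (by
        have := sub_mem h' hl; rwa [add_sub_cancel_right] at this)
      rw [zt_out h hz, zt_out h hzl]
      obtain ⟨m, n, rfl⟩ := (mem_Lt h).1 hl
      have h1 := gen_per h (w := 1) (A := eta1 τ) (Lt τ h).ω₁_mem_lattice
        (fun y hy => wzeta_per h (Lt τ h).ω₁_mem_lattice (Lt τ h).ω₁_div_two_notMem_lattice hy) m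
        z hz
      have hz1 : z + m * 1 ∉ (Lt τ h).lattice := fun h' => hz (by
        have := sub_mem h' ((mem_Lt h).2 ⟨m, 0, by simp⟩ : (m : ℂ) * 1 ∈ (Lt τ h).lattice)
        rwa [add_sub_cancel_right] at this)
      have h2 := gen_per h (w := τ) (A := eta2 τ) (Lt τ h).ω₂_mem_lattice
        (fun y hy => wzeta_per h (Lt τ h).ω₂_mem_lattice (Lt τ h).ω₂_div_two_notMem_lattice hy) n
        _ hz1
      rw [show z + (m + n * τ) = z + m * 1 + n * τ by ring, h2, h1, eta1_eq, eta2_eq h]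
      simp only [map_add, map_mul, map_one, map_intCast]
      ring
  odd z := by
    by_cases hz : z ∈ (Lt τ h).lattice
    · rw [zt_in h hz, zt_in h (neg_mem hz), map_neg]; ring
    · rw [zt_out h hz, zt_out h (by rwa [neg_mem_iff]), wzeta_odd]
  pole := by
    refine ⟨ztail τ, ztail_an h, ?_⟩
    filter_upwards [lat_ev (Lt τ h) 0] with z hz
    rw [zt_out h hz, wzeta_eq]

lemma hecke_eq {τ : ℂ} (h : 0 < τ.im) (r s : ℝ) (hz : (r : ℂ) + s * τ ∉ (Lt τ h).lattice) :
    heckeZ r s τ = zt τ h (r + s * τ) -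
      (Rt τ * conj ((r : ℂ) + s * τ) - ct τ * ((r : ℂ) + s * τ)) := by
  rw [heckeZ, zt_out h hz, eta1_eq, eta2_eq h]
  simp only [map_add, map_mul, map_one, Complex.conj_ofReal]
  ring

/-- common wrapper -/
lemma wrap {τ : ℂ} (h : 0 < τ.im) {L' : PeriodPair} {q q1 q2 : ℂ} (T : Tri (Lt τ h) q q1 q2)
    (hL : ∀ z, z ∈ L'.lattice ↔ z ∈ (Lt τ h).lattice ∨ z + q ∈ (Lt τ h).lattice)
    (r s r' s' : ℝ) (hrs : ¬ IsHalfIntPair (r : ℂ) (s : ℂ))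
    (hq : (r' : ℂ) + s' * τ = r + s * τ + q)
    (h1 : heckeZ r' s' τ = 0)
    (h2 : heckeZ r s τ ^ 2 - wp τ (r + s * τ) + wp τ q = 0) : False := by
  have hz : 2 * ((r : ℂ) + s * τ) ∉ (Lt τ h).lattice := by
    intro h'
    rw [show 2 * ((r : ℂ) + s * τ) = ((2 * r : ℝ) : ℂ) + ((2 * s : ℝ) : ℂ) * τ by
      push_cast; ring, mem_re] at h'
    obtain ⟨m, n, e1, e2⟩ := h'
    refine hrs ⟨m, n, ?_, ?_⟩
    · have : r = (m : ℝ) / 2 := by linarith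
      rw [this]; push_cast; rfl
    · have : s = (n : ℝ) / 2 := by linarith
      rw [this]; push_cast; rfl
  obtain ⟨z1, z2, -⟩ := half_notmem T.h0 hz
  rw [hecke_eq h r' s' (by rw [hq]; exact z2), hq] at h1
  rw [hecke_eq h r s z1, wp_eq h, wp_eq h] at h2
  exact final (zt_Zt h) T hL hz (sub_eq_zero.1 h1) (by linear_combination h2)

lemma nm {τ : ℂ} (h : 0 < τ.im) : (1 / 2 : ℂ) ∉ (Lt τ h).lattice ∧ τ / 2 ∉ (Lt τ h).lattice ∧
    (1 + τ) / 2 ∉ (Lt τ h).lattice := by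
  refine ⟨(Lt τ h).ω₁_div_two_notMem_lattice, (Lt τ h).ω₂_div_two_notMem_lattice, fun h' => ?_⟩
  rw [show (1 + τ) / 2 = ((1 / 2 : ℝ) : ℂ) + ((1 / 2 : ℝ) : ℂ) * τ by push_cast; ring,
    mem_re] at h'
  obtain ⟨m, n, e, -⟩ := h'
  exact half_int e

theorem main (k : ℕ) (hk : k = 1 ∨ k = 2 ∨ k = 3) (r s : ℝ)
    (hrs : ¬ IsHalfIntPair (r : ℂ) (s : ℂ)) :
    ¬ ∃ τ : ℂ, 0 < τ.im ∧ heckeZ (rkr k (r : ℂ)) (rks k (s : ℂ)) τ = 0 ∧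
      heckeZm k (r : ℂ) (s : ℂ) τ = 0 := by
  rintro ⟨τ, h, h1, h2⟩
  obtain ⟨n1, n2, n3⟩ := nm h
  have m1 : 2 * (1 / 2 : ℂ) ∈ (Lt τ h).lattice := (mem_Lt h).2 ⟨1, 0, by push_cast; ring⟩
  have m2 : 2 * (τ / 2) ∈ (Lt τ h).lattice := (mem_Lt h).2 ⟨0, 1, by push_cast; ring⟩
  have m3 : 2 * ((1 + τ) / 2) ∈ (Lt τ h).lattice := (mem_Lt h).2 ⟨1, 1, by push_cast; ring⟩
  rw [heckeZm, eper] at h2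
  rcases hk with rfl | rfl | rfl
  · simp only [rkr, rks, per] at h1 h2
    norm_num only [if_true, if_false] at h1
    have T : Tri (Lt τ h) (1 / 2) (τ / 2) ((1 + τ) / 2) := ⟨n1, n2, n3, m1, m2, m3, by
      rw [show 1 / 2 + τ / 2 - (1 + τ) / 2 = 0 by ring]; exact zero_mem _⟩
    refine wrap h T (L' := Lh τ h) ?_ r s (r + 1 / 2) s hrs (by push_cast; ring)
      (by push_cast; exact h1) h2
    intro z
    rw [mem_Lt, mem_Lt, PeriodPair.mem_lattice]
    constructor
    · rintro ⟨m, n, rfl⟩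
      rcases Int.even_or_odd' m with ⟨j, rfl | rfl⟩
      · left; exact ⟨j, n, by simp only [Lh]; push_cast; ring⟩
      · right; exact ⟨j + 1, n, by simp only [Lh]; push_cast; ring⟩
    · rintro (⟨m, n, e⟩ | ⟨m, n, e⟩)
      · exact ⟨2 * m, n, by simp only [Lh]; push_cast; linear_combination e⟩
      · exact ⟨2 * m - 1, n, by simp only [Lh]; push_cast; linear_combination e⟩
  · simp only [rkr, rks, per] at h1 h2
    norm_num only [if_true, if_false] at h1
    have T : Tri (Lt τ h) (τ / 2) (1 / 2) ((1 + τ) / 2) := ⟨n2, n1, n3, m2, m1, m3, by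
      rw [show τ / 2 + 1 / 2 - (1 + τ) / 2 = 0 by ring]; exact zero_mem _⟩
    have h' : 0 < (τ / 2).im := by simp; exact h
    refine wrap h T (L' := Lt (τ / 2) h') ?_ r s r (s + 1 / 2) hrs (by push_cast; ring)
      (by push_cast; exact h1) h2
    intro z
    rw [mem_Lt, mem_Lt, mem_Lt]
    constructor
    · rintro ⟨m, n, rfl⟩
      rcases Int.even_or_odd' n with ⟨j, rfl | rfl⟩
      · left; exact ⟨m, j, by push_cast; ring⟩
      · right; exact ⟨m, j + 1, by push_cast; ring⟩
    · rintro (⟨m, n, e⟩ | ⟨m, n, e⟩)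
      · exact ⟨m, 2 * n, by push_cast; linear_combination e⟩
      · exact ⟨m, 2 * n - 1, by push_cast; linear_combination e⟩
  · simp only [rkr, rks, per] at h1 h2
    norm_num only [if_true, if_false] at h1
    have T : Tri (Lt τ h) ((1 + τ) / 2) (1 / 2) (τ / 2) := ⟨n3, n1, n2, m3, m1, m2, by
      rw [show (1 + τ) / 2 + 1 / 2 - τ / 2 = 2 * (1 / 2) by ring]; exact m1⟩
    have h' : 0 < ((1 + τ) / 2).im := by simp; exact h
    refine wrap h T (L' := Lt ((1 + τ) / 2) h') ?_ r s (r + 1 / 2) (s + 1 / 2) hrs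
      (by push_cast; ring) (by push_cast; exact h1) h2
    intro z
    rw [mem_Lt, mem_Lt, mem_Lt]
    constructor
    · rintro ⟨m, n, rfl⟩
      rcases Int.even_or_odd' n with ⟨j, rfl | rfl⟩
      · left; exact ⟨m + j, j, by push_cast; ring⟩
      · right; exact ⟨m + j + 1, j + 1, by push_cast; ring⟩
    · rintro (⟨m, n, e⟩ | ⟨m, n, e⟩)
      · exact ⟨m - n, 2 * n, by push_cast; linear_combination e⟩
      · exact ⟨m - n, 2 * n - 1, by push_cast; linear_combination e⟩

end HZ

/-- **Theorem (Statement 4).** For every `k ∈ {1,2,3}` and `(r,s) ∈ ℝ² ∖ (1/2)ℤ²`,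
the functions `τ ↦ Z(r_k,s_k,τ)` and `τ ↦ Z^{(𝐦_k)}(r,s,τ)` have no common zero in `ℍ`. -/
theorem statement4 (k : ℕ) (hk : k = 1 ∨ k = 2 ∨ k = 3) (r s : ℝ)
    (hrs : ¬ IsHalfIntPair (r : ℂ) (s : ℂ)) :
    ¬ ∃ τ : ℂ, 0 < τ.im ∧ heckeZ (rkr k (r : ℂ)) (rks k (s : ℂ)) τ = 0 ∧
      heckeZm k (r : ℂ) (s : ℂ) τ = 0 := by
  exact HZ.main k hk r s hrs
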